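/- arXiv:1508.04597 — 3 statements merged into one kernel-verified Lean document; each statement's English description precedes it below -/
import Mathlib

section
/- Let (R, m) be a Noetherian local ring of dimension d such that its completion R̂ is unmixed. If the socle of H_m^d(R) is one-dimensional over R/m, then R is quasi-Gorenstein. Conversely, if R is quasi-Gorenstein then R̂ is unmixed and dim_{R/m} Soc(H_m^d(R)) = 1. -/
open CategoryTheory IsLocalRing Pointwise

noncomputable section

/-- `E` is an injective hull of `S ⧸ J` over `S`. -/
def IsInjHull (S : Type) [CommRing S] (J : Ideal S) (E : Type) [AddCommGroup E]
    [Module S E] : Prop :=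
  Module.Injective S E ∧
    ∃ f : (S ⧸ J) →ₗ[S] E, Function.Injective f ∧
      ∀ N : Submodule S E, N ≠ ⊥ → N ⊓ LinearMap.range f ≠ ⊥

/-- Local cohomology `H^i_J(M)`. -/
abbrev LC (S : Type) [CommRing S] (J : Ideal S) (i : ℕ) (M : ModuleCat S) : ModuleCat S :=
  (localCohomology J i).obj M

/-- Krull dimension of a module (dimension of its support). -/
def mdim (S : Type) [CommRing S] (M : Type) [AddCommGroup M] [Module S M] : WithBot ℕ∞ :=
  Order.krullDim (Module.support S M)

/-- Depth/grade of an ideal `J` on `M`: supremum of lengths of `M`-regular sequences in `J`. -/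
def gradeI (S : Type) [CommRing S] (J : Ideal S) (M : Type) [AddCommGroup M]
    [Module S M] : ℕ∞ :=
  sSup {n : ℕ∞ | ∃ rs : List S, (rs.length : ℕ∞) = n ∧ (∀ r ∈ rs, r ∈ J) ∧
    RingTheory.Sequence.IsRegular M rs}

/-- The local "height" of `M` at a prime `p`, i.e. `dim_{S_p} M_p`. -/
def htM (S : Type) [CommRing S] (M : Type) [AddCommGroup M] [Module S M]
    (p : PrimeSpectrum S) : WithBot ℕ∞ :=
  mdim (Localization.AtPrime p.asIdeal) (LocalizedModule p.asIdeal.primeCompl M)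

/-- `ht_M(a) = inf { dim_{S_p} M_p : p ⊇ a, p ∈ Supp M }`. -/
def htI (S : Type) [CommRing S] (M : Type) [AddCommGroup M] [Module S M]
    (a : Ideal S) : WithBot ℕ∞ :=
  sInf {d | ∃ p ∈ Module.support S M, a ≤ p.asIdeal ∧ d = htM S M p}

/-- Serre's condition `S_n` for the module `M`. -/
def Serre (S : Type) [CommRing S] (n : ℕ) (M : Type) [AddCommGroup M] [Module S M] : Prop :=
  ∀ (p : Ideal S) [p.IsPrime],
    min (n : WithBot ℕ∞)
        (mdim (Localization.AtPrime p) (LocalizedModule p.primeCompl M)) ≤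
      (gradeI (Localization.AtPrime p) (IsLocalRing.maximalIdeal (Localization.AtPrime p))
        (LocalizedModule p.primeCompl M) : ℕ∞)

/-- Attached primes of `M` (Macdonald): primes of the form `Ann(M ⧸ N)`. -/
def attachedPrimes (S : Type) [CommRing S] (M : Type) [AddCommGroup M] [Module S M] :
    Set (Ideal S) :=
  {p | p.IsPrime ∧ ∃ N : Submodule S M, p = Module.annihilator S (M ⧸ N)}

/-- `ω` is a canonical module of the `d`-dimensional module `M` over `(S, J)`:
its "Matlis dual" `Hom_S(ω, E)` is isomorphic to `H^d_J(M)`. -/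
def IsCanonicalModule (S : Type) [CommRing S] (J : Ideal S) (d : ℕ)
    (M ω : ModuleCat S) : Prop :=
  Module.Finite S ω ∧ ∃ E : ModuleCat S, IsInjHull S J ↥E ∧
    Nonempty ((↥ω →ₗ[S] ↥E) ≃ₗ[S] ↥(LC S J d M))

/-- `(S, J)` is quasi-Gorenstein: `H^d_J(S)` is an injective hull of `S ⧸ J`, `d = dim S`. -/
def IsQuasiGorensteinAt (S : Type) [CommRing S] (J : Ideal S) : Prop :=
  ∃ d : ℕ, ringKrullDim S = (d : WithBot ℕ∞) ∧
    ∃ E : ModuleCat S, IsInjHull S J ↥E ∧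
      Nonempty (↥(LC S J d (ModuleCat.of S S)) ≃ₗ[S] ↥E)

/-- Totally reflexive modules. -/
def TotallyReflexive (S : Type) [CommRing S] (M : ModuleCat S) : Prop :=
  Module.Finite S ↥M ∧ Module.IsReflexive S ↥M ∧
    ∀ i : ℕ, 0 < i →
      Subsingleton ↥(((Ext S (ModuleCat S) i).obj (Opposite.op M)).obj (ModuleCat.of S S)) ∧
      Subsingleton ↥(((Ext S (ModuleCat S) i).obj
        (Opposite.op (ModuleCat.of S (Module.Dual S ↥M)))).obj (ModuleCat.of S S))

/-- `G`-dimension at most `n`. -/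
def GdimLE (S : Type) [CommRing S] : ℕ → ModuleCat S → Prop
  | 0, M => TotallyReflexive S M
  | n + 1, M => ∃ (G : ModuleCat S) (f : ↥G →ₗ[S] ↥M), Function.Surjective f ∧
      TotallyReflexive S G ∧ GdimLE S n (ModuleCat.of S (LinearMap.ker f))

/-- Injective dimension at most `n`. -/
def InjDimLE (S : Type) [CommRing S] : ℕ → ModuleCat S → Prop
  | 0, M => Module.Injective S ↥M
  | n + 1, M => ∃ (E : ModuleCat S) (f : ↥M →ₗ[S] ↥E), Function.Injective f ∧
      Module.Injective S ↥E ∧ InjDimLE S n (ModuleCat.of S (↥E ⧸ LinearMap.range f))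

/-- Injective dimension, as an element of `ℕ∞`. -/
def injDim (S : Type) [CommRing S] (M : ModuleCat S) : ℕ∞ :=
  sInf {n : ℕ∞ | ∃ k : ℕ, (k : ℕ∞) = n ∧ InjDimLE S k M}

/-- Minimal number of generators. -/
def genNumber (S : Type) [CommRing S] (M : Type) [AddCommGroup M] [Module S M] : ℕ∞ :=
  sInf {n : ℕ∞ | ∃ s : Finset M, (s.card : ℕ∞) = n ∧ Submodule.span S (↑s : Set M) = ⊤}

/-- The socle `0 :_M J`. -/
def socle (S : Type) [CommRing S] (J : Ideal S) (M : Type) [AddCommGroup M] [Module S M] :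
    Submodule S M :=
  ⨅ r ∈ J, LinearMap.ker (LinearMap.lsmul S M r)

/-- Limit closure of the sequence `x` on `M`. -/
def limClo (S : Type) [CommRing S] {v : ℕ} (x : Fin v → S) (M : Type) [AddCommGroup M]
    [Module S M] : Submodule S M :=
  ⨆ t : ℕ, (Ideal.span (Set.range fun i => x i ^ (t + 1)) • (⊤ : Submodule S M)).comap
      (LinearMap.lsmul S M ((∏ i, x i) ^ t))

end

/-- Krull dimension of a ring, valued in `WithBot ℕ∞`. -/
noncomputable def rdim (S : Type) [CommRing S] : WithBot ℕ∞ :=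
  Order.krullDim (PrimeSpectrum S)

section TorsionCohomology

open Abelian (Ext)

variable {R : Type} [CommRing R] (J : Ideal R)

/-- The projection `R ⧸ J ^ n ⟶ R ⧸ J ^ m` for `m ≤ n`. -/
noncomputable def powQuotMap {m n : ℕ} (h : m ≤ n) :
    ModuleCat.of R (R ⧸ J ^ n) ⟶ ModuleCat.of R (R ⧸ J ^ m) :=
  ModuleCat.ofHom (Submodule.factor (Ideal.pow_le_pow_right h))

lemma powQuotMap_self (n : ℕ) : powQuotMap J (le_refl n) = 𝟙 _ := by
  ext
  rfl

lemma powQuotMap_comp {l m n : ℕ} (h : l ≤ m) (h' : m ≤ n) :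
    powQuotMap J h' ≫ powQuotMap J h = powQuotMap J (h.trans h') := by
  ext
  rfl

/-- The transition maps of the system `Ext^i(R ⧸ J ^ n, M)`. -/
noncomputable def extTransition (i : ℕ) (M : ModuleCat.{0} R) (m n : ℕ) (h : m ≤ n) :
    Ext (ModuleCat.of R (R ⧸ J ^ m)) M i →ₗ[R] Ext (ModuleCat.of R (R ⧸ J ^ n)) M i where
  toFun x := (Ext.mk₀ (powQuotMap J h)).comp x (zero_add i)
  map_add' _ _ := Ext.comp_add _ _ _ _
  map_smul' _ _ := Ext.comp_smul _ _ _ _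

instance extTransition_directedSystem (i : ℕ) (M : ModuleCat.{0} R) :
    DirectedSystem (fun n : ℕ => Ext (ModuleCat.of R (R ⧸ J ^ n)) M i)
      (extTransition J i M · · ·) where
  map_self n x := by
    change (Ext.mk₀ (powQuotMap J (le_refl n))).comp x (zero_add i) = x
    rw [powQuotMap_self, Ext.mk₀_id_comp]
  map_map l m n h h' x := by
    change (Ext.mk₀ (powQuotMap J h')).comp ((Ext.mk₀ (powQuotMap J h)).comp x (zero_add i))
      (zero_add i) = (Ext.mk₀ (powQuotMap J _)).comp x (zero_add i)
    rw [Ext.mk₀_comp_mk₀_assoc, powQuotMap_comp]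

/-- The colimit of the modules `Ext^i(R ⧸ J ^ n, M)`. -/
noncomputable def TCoh (i : ℕ) (M : Type) [AddCommGroup M] [Module R M] : Type :=
  Module.DirectLimit (fun n : ℕ => Ext (ModuleCat.of R (R ⧸ J ^ n)) (ModuleCat.of R M) i)
    (extTransition J i (ModuleCat.of R M))

namespace TCoh

section
variable (i : ℕ) (M : Type) [AddCommGroup M] [Module R M]

noncomputable instance : AddCommGroup (TCoh J i M) :=
  inferInstanceAs (AddCommGroup (Module.DirectLimit _ (extTransition J i (ModuleCat.of R M))))

noncomputable instance : Module R (TCoh J i M) :=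
  inferInstanceAs (Module R (Module.DirectLimit _ (extTransition J i (ModuleCat.of R M))))

/-- The structure map of the colimit. -/
noncomputable def of (n : ℕ) :
    Ext (ModuleCat.of R (R ⧸ J ^ n)) (ModuleCat.of R M) i →ₗ[R] TCoh J i M :=
  Module.DirectLimit.of R ℕ _ (extTransition J i (ModuleCat.of R M)) n

variable {J} {i} {M}

lemma of_transition {m n : ℕ} (h : m ≤ n)
    (x : Ext (ModuleCat.of R (R ⧸ J ^ m)) (ModuleCat.of R M) i) :
    of J i M n (extTransition J i _ m n h x) = of J i M m x :=
  Module.DirectLimit.of_f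

lemma exists_of (z : TCoh J i M) : ∃ n x, of J i M n x = z :=
  Module.DirectLimit.exists_of z

lemma of_eq_zero {n : ℕ} {x : Ext (ModuleCat.of R (R ⧸ J ^ n)) (ModuleCat.of R M) i}
    (h : of J i M n x = 0) : ∃ m, ∃ hm : n ≤ m, extTransition J i _ n m hm x = 0 :=
  Module.DirectLimit.of.zero_exact h

/-- The universal property of the colimit. -/
noncomputable def lift {P : Type} [AddCommGroup P] [Module R P]
    (g : ∀ n, Ext (ModuleCat.of R (R ⧸ J ^ n)) (ModuleCat.of R M) i →ₗ[R] P)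
    (hg : ∀ m n h x, g n (extTransition J i _ m n h x) = g m x) : TCoh J i M →ₗ[R] P :=
  Module.DirectLimit.lift R ℕ _ _ g hg

lemma lift_of {P : Type} [AddCommGroup P] [Module R P]
    (g : ∀ n, Ext (ModuleCat.of R (R ⧸ J ^ n)) (ModuleCat.of R M) i →ₗ[R] P)
    (hg : ∀ m n h x, g n (extTransition J i _ m n h x) = g m x) (n : ℕ) (x) :
    lift g hg (of J i M n x) = g n x :=
  Module.DirectLimit.lift_of _ _ _

lemma pow_smul_of {n : ℕ} {r : R} (hr : r ∈ J ^ n)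
    (x : Ext (ModuleCat.of R (R ⧸ J ^ n)) (ModuleCat.of R M) i) : r • x = 0 := by
  have h1 : r • x = (r • Ext.mk₀ (𝟙 (ModuleCat.of R (R ⧸ J ^ n)))).comp x (zero_add i) := by
    rw [Ext.smul_comp, Ext.mk₀_id_comp]
  have h2 : r • 𝟙 (ModuleCat.of R (R ⧸ J ^ n)) = 0 := by
    ext
    change r • (Submodule.Quotient.mk (1 : R) : R ⧸ J ^ n) = 0
    rw [← Submodule.Quotient.mk_smul, Submodule.Quotient.mk_eq_zero]
    simpa using hr
  rw [h1, ← Ext.mk₀_smul, h2, Ext.mk₀_zero, Ext.zero_comp]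

lemma exists_pow_smul_eq_zero (z : TCoh J i M) : ∃ n, ∀ r ∈ J ^ n, r • z = 0 := by
  obtain ⟨n, x, rfl⟩ := exists_of z
  refine ⟨n, fun r hr => ?_⟩
  rw [← map_smul, pow_smul_of hr, map_zero]

end

section map
variable {M N P : Type} [AddCommGroup M] [Module R M] [AddCommGroup N] [Module R N]
  [AddCommGroup P] [Module R P]

/-- Postcomposition with a linear map, as a linear map of `Ext` modules. -/
noncomputable def extPost (X : ModuleCat.{0} R) (i : ℕ) (f : M →ₗ[R] N) :
    Ext X (ModuleCat.of R M) i →ₗ[R] Ext X (ModuleCat.of R N) i where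
  toFun x := x.comp (Ext.mk₀ (ModuleCat.ofHom f)) (add_zero i)
  map_add' _ _ := Ext.add_comp _ _ _ _
  map_smul' _ _ := Ext.smul_comp _ _ _ _

lemma extPost_transition (i : ℕ) (f : M →ₗ[R] N) (m n : ℕ) (h : m ≤ n) (x) :
    extPost _ i f (extTransition J i _ m n h x) = extTransition J i _ m n h (extPost _ i f x) :=
  Ext.comp_assoc _ _ _ (zero_add i) (add_zero i) (by omega)

lemma extPost_comp (X : ModuleCat.{0} R) (i : ℕ) (f : M →ₗ[R] N) (g : N →ₗ[R] P) (x) :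
    extPost X i (g ∘ₗ f) x = extPost X i g (extPost X i f x) := by
  change x.comp (Ext.mk₀ (ModuleCat.ofHom f ≫ ModuleCat.ofHom g)) (add_zero i) =
    (x.comp (Ext.mk₀ _) (add_zero i)).comp (Ext.mk₀ _) (add_zero i)
  rw [Ext.comp_assoc_of_third_deg_zero, Ext.mk₀_comp_mk₀]

lemma extPost_id (X : ModuleCat.{0} R) (i : ℕ) (x) :
    extPost X i (LinearMap.id : M →ₗ[R] M) x = x :=
  Ext.comp_mk₀_id x

lemma extPost_smul_id (X : ModuleCat.{0} R) (i : ℕ) (r : R) (x) :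
    extPost X i (r • LinearMap.id : M →ₗ[R] M) x = r • x := by
  change x.comp (Ext.mk₀ (r • 𝟙 (ModuleCat.of R M))) (add_zero i) = _
  rw [Ext.mk₀_smul, Ext.comp_smul, Ext.comp_mk₀_id]

lemma extPost_zero (X : ModuleCat.{0} R) (i : ℕ) (x) :
    extPost X i (0 : M →ₗ[R] N) x = 0 := by
  change x.comp (Ext.mk₀ (0 : ModuleCat.of R M ⟶ ModuleCat.of R N)) (add_zero i) = _
  rw [Ext.mk₀_zero, Ext.comp_zero]

/-- Functoriality of the colimit. -/
noncomputable def map (i : ℕ) (f : M →ₗ[R] N) : TCoh J i M →ₗ[R] TCoh J i N :=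
  lift (fun n => of J i N n ∘ₗ extPost _ i f) fun m n h x => by
    simp only [LinearMap.comp_apply]
    rw [extPost_transition, of_transition]

lemma map_of (i : ℕ) (f : M →ₗ[R] N) (n : ℕ) (x) :
    map J i f (of J i M n x) = of J i N n (extPost _ i f x) :=
  lift_of ..

variable {J}

lemma map_comp (i : ℕ) (f : M →ₗ[R] N) (g : N →ₗ[R] P) (z : TCoh J i M) :
    map J i (g ∘ₗ f) z = map J i g (map J i f z) := by
  obtain ⟨n, x, rfl⟩ := exists_of z
  simp only [map_of]
  rw [extPost_comp]

lemma map_id (i : ℕ) (z : TCoh J i M) : map J i LinearMap.id z = z := by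
  obtain ⟨n, x, rfl⟩ := exists_of z
  rw [map_of, extPost_id]

lemma map_smul_id (i : ℕ) (r : R) (z : TCoh J i M) :
    map J i (r • LinearMap.id) z = r • z := by
  obtain ⟨n, x, rfl⟩ := exists_of z
  rw [map_of, extPost_smul_id, map_smul]

lemma map_zero_apply (i : ℕ) (z : TCoh J i M) : map J i (0 : M →ₗ[R] N) z = 0 := by
  obtain ⟨n, x, rfl⟩ := exists_of z
  rw [map_of]
  rw [extPost_zero, map_zero]

/-- Isomorphic modules have isomorphic cohomology. -/
noncomputable def congr (i : ℕ) (e : M ≃ₗ[R] N) : TCoh J i M ≃ₗ[R] TCoh J i N :=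
  LinearEquiv.ofLinearMap (map J i e) (map J i e.symm)
    (by ext z; simp [← map_comp, map_id]) (by ext z; simp [← map_comp, map_id])

/-- The long exact sequence. -/
theorem exists_connecting (f : M →ₗ[R] N) (g : N →ₗ[R] P) (hf : Function.Injective f)
    (hg : Function.Surjective g) (hfg : Function.Exact f g) :
    ∃ δ : ∀ i, TCoh J i P →ₗ[R] TCoh J (i + 1) M,
      (∀ i, Function.Exact (map J i f) (map J i g)) ∧
      (∀ i, Function.Exact (map J i g) (δ i)) ∧
      (∀ i, Function.Exact (δ i) (map J (i + 1) f)) := by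
  let S : ShortComplex (ModuleCat.{0} R) := ShortComplex.mk (ModuleCat.ofHom f) (ModuleCat.ofHom g)
    (by ext x; exact hfg.apply_apply_eq_zero x)
  have hS : S.ShortExact :=
    { exact := (ShortComplex.ShortExact.moduleCat_exact_iff_function_exact S).2 hfg
      mono_f := (ModuleCat.mono_iff_injective _).2 hf
      epi_g := (ModuleCat.epi_iff_surjective _).2 hg }
  let D (X : ModuleCat.{0} R) (i : ℕ) : Ext X (ModuleCat.of R P) i →ₗ[R]
      Ext X (ModuleCat.of R M) (i + 1) :=
    { toFun := fun x => x.comp hS.extClass rfl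
      map_add' := fun x y => Ext.add_comp _ _ _ _
      map_smul' := fun r x => Ext.smul_comp _ _ _ _ }
  have hD (i m n : ℕ) (h : m ≤ n) (x) : D _ i (extTransition J i _ m n h x) =
      extTransition J (i + 1) _ m n h (D _ i x) := Ext.comp_assoc _ _ _ (zero_add i) rfl (by omega)
  let δ (i : ℕ) : TCoh J i P →ₗ[R] TCoh J (i + 1) M :=
    lift (fun n => of J (i + 1) M n ∘ₗ D _ i) fun m n h x => by
      simp only [LinearMap.comp_apply]
      rw [hD, of_transition]
  have hδ (i n : ℕ) (x) : δ i (of J i P n x) = of J (i + 1) M n (D _ i x) := lift_of ..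
  refine ⟨δ, fun i => fun z => ⟨fun hz => ?_, ?_⟩, fun i => fun z => ⟨fun hz => ?_, ?_⟩,
    fun i => fun z => ⟨fun hz => ?_, ?_⟩⟩
  · obtain ⟨n, x, rfl⟩ := exists_of z
    rw [map_of] at hz
    obtain ⟨m, hm, h⟩ := of_eq_zero hz
    rw [← extPost_transition] at h
    obtain ⟨y, hy⟩ := Ext.covariant_sequence_exact₂ _ hS _ h
    refine ⟨of J i M m y, ?_⟩
    rw [map_of, ← of_transition hm x]
    exact congrArg _ hy
  · rintro ⟨y, rfl⟩
    rw [← map_comp, hfg.linearMap_comp_eq_zero, map_zero_apply]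
  · obtain ⟨n, x, rfl⟩ := exists_of z
    rw [hδ] at hz
    obtain ⟨m, hm, h⟩ := of_eq_zero hz
    rw [← hD] at h
    obtain ⟨y, hy⟩ := Ext.covariant_sequence_exact₃ _ hS _ rfl h
    refine ⟨of J i N m y, ?_⟩
    rw [map_of, ← of_transition hm x]
    exact congrArg _ hy
  · rintro ⟨y, rfl⟩
    obtain ⟨n, x, rfl⟩ := exists_of y
    rw [map_of, hδ]
    have : D _ i (extPost _ i g x) = 0 := by
      change (x.comp (Ext.mk₀ S.g) (add_zero i)).comp hS.extClass rfl = 0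
      rw [Ext.comp_assoc_of_second_deg_zero, hS.comp_extClass, Ext.comp_zero]
    rw [this, map_zero]
  · obtain ⟨n, x, rfl⟩ := exists_of z
    rw [map_of] at hz
    obtain ⟨m, hm, h⟩ := of_eq_zero hz
    rw [← extPost_transition] at h
    obtain ⟨y, hy⟩ := Ext.covariant_sequence_exact₁ _ hS _ h rfl
    refine ⟨of J i P m y, ?_⟩
    rw [hδ, ← of_transition hm x]
    exact congrArg _ hy
  · rintro ⟨y, rfl⟩
    obtain ⟨n, x, rfl⟩ := exists_of y
    rw [hδ, map_of]
    have : extPost _ (i + 1) f (D _ i x) = 0 := by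
      change (x.comp hS.extClass rfl).comp (Ext.mk₀ S.f) (add_zero (i + 1)) = 0
      rw [Ext.comp_assoc_of_third_deg_zero, hS.extClass_comp, Ext.comp_zero]
    rw [this, map_zero]

lemma eq_zero_of_injective (hM : Module.Injective R M) (i : ℕ) (z : TCoh J (i + 1) M) :
    z = 0 := by
  obtain ⟨n, x, rfl⟩ := exists_of z
  have : Injective (ModuleCat.of R M) := (Module.injective_iff_injective_object R M).1 hM
  rw [Ext.eq_zero_of_injective x, map_zero]

end map

end TCoh

end TorsionCohomology

section PowerTorsion

variable {R : Type} [CommRing R] (J : Ideal R) (M : Type) [AddCommGroup M] [Module R M]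

/-- The submodule of elements killed by a power of `J`. -/
def powTorsion : Submodule R M where
  carrier := {m | ∃ n, ∀ r ∈ J ^ n, r • m = 0}
  zero_mem' := ⟨0, fun r _ => smul_zero r⟩
  add_mem' := by
    rintro a b ⟨k, ha⟩ ⟨l, hb⟩
    refine ⟨max k l, fun r hr => ?_⟩
    rw [smul_add, ha r (Ideal.pow_le_pow_right (le_max_left k l) hr),
      hb r (Ideal.pow_le_pow_right (le_max_right k l) hr), add_zero]
  smul_mem' := by
    rintro c a ⟨k, ha⟩
    exact ⟨k, fun r hr => by rw [smul_comm, ha r hr, smul_zero]⟩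

variable {J M}

lemma mem_powTorsion {m : M} : m ∈ powTorsion J M ↔ ∃ n, ∀ r ∈ J ^ n, r • m = 0 := Iff.rfl

lemma mem_powTorsion_span_singleton {x : R} {m : M} :
    m ∈ powTorsion (Ideal.span {x}) M ↔ ∃ n, x ^ n • m = 0 := by
  simp only [mem_powTorsion, Ideal.span_singleton_pow, Ideal.mem_span_singleton']
  refine exists_congr fun n => ⟨fun h => h _ ⟨1, one_mul _⟩, ?_⟩
  rintro h r ⟨a, rfl⟩
  rw [mul_smul, h, smul_zero]

end PowerTorsion

namespace TCoh

open Abelian (Ext)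

variable {R : Type} [CommRing R] {J : Ideal R}
  {M N P : Type} [AddCommGroup M] [Module R M] [AddCommGroup N] [Module R N]
  [AddCommGroup P] [Module R P]

/-- Evaluation at `1` on `Ext^0(R ⧸ J ^ n, M)`. -/
noncomputable def extEval (J : Ideal R) (M : Type) [AddCommGroup M] [Module R M] (n : ℕ) :
    Ext (ModuleCat.of R (R ⧸ J ^ n)) (ModuleCat.of R M) 0 →ₗ[R] M where
  toFun x := (Ext.linearEquiv₀ (R := R) x).hom (Submodule.Quotient.mk 1)
  map_add' x y := by rw [map_add]; rfl
  map_smul' r x := by rw [map_smul]; rfl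

lemma extEval_mk₀ (n : ℕ) (f : ModuleCat.of R (R ⧸ J ^ n) ⟶ ModuleCat.of R M) :
    extEval J M n (Ext.mk₀ f) = f.hom (Submodule.Quotient.mk 1) := by
  have : Ext.linearEquiv₀ (R := R) (Ext.mk₀ f) = f :=
    (Ext.linearEquiv₀ (R := R)).apply_symm_apply f
  change (Ext.linearEquiv₀ (R := R) (Ext.mk₀ f)).hom _ = _
  rw [this]

lemma extEval_injective (n : ℕ) : Function.Injective (extEval J M n) := by
  rw [injective_iff_map_eq_zero]
  intro x hx
  obtain ⟨f, rfl⟩ := (Ext.mk₀_bijective _ _).2 x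
  rw [extEval_mk₀] at hx
  have : f = 0 := by
    ext
    exact hx
  rw [this, Ext.mk₀_zero]

variable (J M) in
/-- The identification of `TCoh J 0 M` with a submodule of `M`. -/
noncomputable def eval : TCoh J 0 M →ₗ[R] M :=
  lift (extEval J M) fun m n h x => by
    obtain ⟨f, rfl⟩ := (Ext.mk₀_bijective _ _).2 x
    change extEval J M n ((Ext.mk₀ _).comp (Ext.mk₀ f) (zero_add 0)) = _
    rw [Ext.mk₀_comp_mk₀, extEval_mk₀, extEval_mk₀]
    rfl

lemma eval_of (n : ℕ) (x) : eval J M (of J 0 M n x) = extEval J M n x := lift_of ..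

lemma eval_injective : Function.Injective (eval J M) := by
  rw [injective_iff_map_eq_zero]
  intro z hz
  obtain ⟨n, x, rfl⟩ := exists_of z
  rw [eval_of] at hz
  rw [extEval_injective n (hz.trans (map_zero _).symm), map_zero]

lemma range_eval : LinearMap.range (eval J M) = powTorsion J M := by
  apply le_antisymm
  · rintro _ ⟨z, rfl⟩
    obtain ⟨n, hn⟩ := exists_pow_smul_eq_zero z
    exact ⟨n, fun r hr => by rw [← map_smul, hn r hr, map_zero]⟩
  · rintro m ⟨n, hn⟩
    let f : (R ⧸ J ^ n) →ₗ[R] M := Submodule.liftQ _ (LinearMap.toSpanSingleton R M m) hn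
    refine ⟨of J 0 M n (Ext.mk₀ (ModuleCat.ofHom f)), ?_⟩
    rw [eval_of, extEval_mk₀]
    change f (Submodule.Quotient.mk 1) = m
    exact one_smul R m

lemma eval_map (f : M →ₗ[R] N) (z : TCoh J 0 M) : eval J N (map J 0 f z) = f (eval J M z) := by
  obtain ⟨n, x, rfl⟩ := exists_of z
  obtain ⟨g, rfl⟩ := (Ext.mk₀_bijective _ _).2 x
  rw [map_of, eval_of, eval_of]
  change extEval J N n ((Ext.mk₀ g).comp (Ext.mk₀ _) (zero_add 0)) = _
  rw [Ext.mk₀_comp_mk₀, extEval_mk₀, extEval_mk₀]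
  rfl

variable (J M) in
/-- `TCoh J 0 M` is the `J`-power torsion of `M`. -/
noncomputable def equivPowTorsion : TCoh J 0 M ≃ₗ[R] powTorsion J M :=
  (LinearEquiv.ofInjective _ eval_injective).trans (LinearEquiv.ofEq _ _ range_eval)

lemma equivPowTorsion_apply (z : TCoh J 0 M) :
    (equivPowTorsion J M z : M) = eval J M z := rfl

lemma exists_eval_eq (h : powTorsion J M = ⊤) (m : M) : ∃ z, eval J M z = m :=
  LinearMap.mem_range.1 (by rw [range_eval, h]; trivial)

/-- If some element of `J` acts bijectively on `M`, the cohomology vanishes. -/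
lemma eq_zero_of_bijective {x : R} (hx : x ∈ J) (h : Function.Bijective fun m : M => x • m)
    (i : ℕ) (z : TCoh J i M) : z = 0 := by
  let e : M ≃ₗ[R] M := LinearEquiv.ofBijective (x • LinearMap.id) h
  have hinj (w : TCoh J i M) (hw : x • w = 0) : w = 0 := by
    rw [← map_smul_id] at hw
    rw [← map_id i w, show (LinearMap.id : M →ₗ[R] M) = e.symm.toLinearMap ∘ₗ e.toLinearMap by
      ext; simp, map_comp, show (e.toLinearMap : M →ₗ[R] M) = x • LinearMap.id from rfl, hw,
      map_zero]
  obtain ⟨n, hn⟩ := exists_pow_smul_eq_zero z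
  have hz := hn (x ^ n) (Ideal.pow_mem_pow hx n)
  clear hn
  induction n with
  | zero => simpa using hz
  | succ n ih =>
    rw [pow_succ', mul_smul] at hz
    exact ih (hinj _ hz)

end TCoh

section PowerTorsion

variable {R : Type} [CommRing R]

lemma exists_injective_embedding (M : Type) [AddCommGroup M] [Module R M] :
    ∃ (I : Type) (_ : AddCommGroup I) (_ : Module R I) (f : M →ₗ[R] I),
      Function.Injective f ∧ Module.Injective R I :=
  ⟨Injective.under (C := ModuleCat.{0} R) (ModuleCat.of R M), inferInstance, inferInstance,
    (Injective.ι (C := ModuleCat.{0} R) (ModuleCat.of R M)).hom,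
    (ModuleCat.mono_iff_injective _).1 inferInstance,
    (Module.injective_iff_injective_object R _).2
      (inferInstanceAs (Injective (Injective.under (C := ModuleCat.{0} R) (ModuleCat.of R M))))⟩

/-- A finitely generated submodule of power torsion elements is killed by a power. -/
lemma exists_pow_smul_eq_zero_of_fg {J : Ideal R} {M : Type} [AddCommGroup M] [Module R M]
    {N : Submodule R M} (hN : N.FG) (h : N ≤ powTorsion J M) :
    ∃ n, ∀ r ∈ J ^ n, ∀ m ∈ N, r • m = 0 := by
  induction N, hN using Submodule.fg_induction with
  | singleton m =>
    obtain ⟨n, hn⟩ := h (Submodule.mem_span_singleton_self m)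
    refine ⟨n, fun r hr m' hm' => ?_⟩
    obtain ⟨a, rfl⟩ := Submodule.mem_span_singleton.1 hm'
    rw [smul_comm, hn r hr, smul_zero]
  | sup N₁ N₂ _ _ h₁ h₂ =>
    obtain ⟨k, hk⟩ := h₁ (le_sup_left.trans h)
    obtain ⟨l, hl⟩ := h₂ (le_sup_right.trans h)
    refine ⟨max k l, fun r hr m hm => ?_⟩
    obtain ⟨a, ha, b, hb, rfl⟩ := Submodule.mem_sup.1 hm
    rw [smul_add, hk r (Ideal.pow_le_pow_right (le_max_left k l) hr) a ha,
      hl r (Ideal.pow_le_pow_right (le_max_right k l) hr) b hb, add_zero]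

lemma powTorsion_powTorsion (J : Ideal R) (M : Type) [AddCommGroup M] [Module R M] :
    powTorsion J (powTorsion J M) = ⊤ := by
  rw [eq_top_iff]
  rintro ⟨m, n, hn⟩ -
  exact ⟨n, fun r hr => Subtype.ext (hn r hr)⟩

lemma powTorsion_eq_top_of_surjective {J : Ideal R} {M N : Type} [AddCommGroup M] [Module R M]
    [AddCommGroup N] [Module R N] {f : M →ₗ[R] N} (hf : Function.Surjective f)
    (h : powTorsion J M = ⊤) : powTorsion J N = ⊤ := by
  rw [eq_top_iff]
  rintro n -
  obtain ⟨m, rfl⟩ := hf n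
  obtain ⟨k, hk⟩ := h.ge (Submodule.mem_top (x := m))
  exact ⟨k, fun r hr => by rw [← map_smul, hk r hr, map_zero]⟩

lemma exists_pow_inf_le [IsNoetherianRing R] (J 𝔞 : Ideal R) (k : ℕ) :
    ∃ l, J ^ l ⊓ 𝔞 ≤ J ^ k * 𝔞 := by
  obtain ⟨c, hc⟩ := J.exists_pow_inf_eq_pow_smul (M := R) 𝔞
  refine ⟨k + c, ?_⟩
  have := hc (k + c) (Nat.le_add_left _ _)
  simp only [smul_eq_mul, Ideal.mul_top, Nat.add_sub_cancel] at this
  rw [this]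
  exact Ideal.mul_mono_right inf_le_right

lemma comap_pow_le_ker {J 𝔞 : Ideal R} {H : Type} [AddCommGroup H]
    [Module R H] {f : 𝔞 →ₗ[R] H} {c k : ℕ} (hc : J ^ c ⊓ 𝔞 ≤ J ^ k * 𝔞)
    (hk : ∀ r ∈ J ^ k, ∀ m ∈ LinearMap.range f, r • m = 0) :
    Submodule.comap 𝔞.subtype (J ^ c) ≤ LinearMap.ker f := by
  have key : (J ^ k • ⊤ : Submodule R 𝔞) ≤ LinearMap.ker f := by
    rw [Submodule.smul_le]
    intro r hr a _
    rw [LinearMap.mem_ker, map_smul, hk r hr _ ⟨a, rfl⟩]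
  intro a ha
  apply key
  have h1 : (a : R) ∈ J ^ k * 𝔞 := hc ⟨ha, a.2⟩
  have h2 : (J ^ k • ⊤ : Submodule R 𝔞).map (Submodule.subtype 𝔞) = J ^ k * 𝔞 := by
    rw [Submodule.map_smul'', Submodule.map_top, Submodule.range_subtype, smul_eq_mul]
  rw [← h2] at h1
  obtain ⟨b, hb, hab⟩ := h1
  rwa [← Subtype.ext hab]

/-- Power torsion submodules of injective modules over Noetherian rings are injective. -/
theorem powTorsion_injective [IsNoetherianRing R] (J : Ideal R) {I : Type} [AddCommGroup I]
    [Module R I] (hI : Module.Injective R I) : Module.Injective R (powTorsion J I) := by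
  apply Module.Baer.injective
  intro 𝔞 f
  obtain ⟨k, hk⟩ := exists_pow_smul_eq_zero_of_fg (N := LinearMap.range f) (J := J)
    (by rw [LinearMap.range_eq_map]; exact (IsNoetherian.noetherian _).map f)
    (le_top.trans (powTorsion_powTorsion J I).ge)
  obtain ⟨l, hl⟩ := exists_pow_inf_le J 𝔞 k
  have hf : Submodule.comap (Submodule.subtype 𝔞) (J ^ l) ≤ LinearMap.ker f :=
    comap_pow_le_ker hl hk
  obtain ⟨g, hg⟩ := hI.out
    (Submodule.mapQ (Submodule.comap 𝔞.subtype (J ^ l)) (J ^ l) 𝔞.subtype le_rfl)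
    (by
      rw [← LinearMap.ker_eq_bot, Submodule.ker_mapQ, ← LinearMap.le_ker_iff_map,
        Submodule.ker_mkQ])
    ((powTorsion J I).subtype ∘ₗ Submodule.liftQ _ f hf)
  have hgr (y : R ⧸ J ^ l) : g y ∈ powTorsion J I := by
    obtain ⟨y, rfl⟩ := Submodule.Quotient.mk_surjective _ y
    refine ⟨l, fun r hr => ?_⟩
    rw [← map_smul, ← Submodule.Quotient.mk_smul, smul_eq_mul,
      (Submodule.Quotient.mk_eq_zero (J ^ l)).2 (Ideal.mul_mem_right y _ hr), map_zero]
  refine ⟨(LinearMap.codRestrict _ g hgr) ∘ₗ (J ^ l).mkQ, fun a ha => ?_⟩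
  apply Subtype.ext
  exact hg (Submodule.Quotient.mk ⟨a, ha⟩)

/-- A power torsion module embeds into a power torsion injective module. -/
lemma exists_torsion_injective_embedding [IsNoetherianRing R] {J : Ideal R} {M : Type}
    [AddCommGroup M] [Module R M] (hM : powTorsion J M = ⊤) :
    ∃ (I : Type) (_ : AddCommGroup I) (_ : Module R I) (f : M →ₗ[R] I),
      Function.Injective f ∧ Module.Injective R I ∧ powTorsion J I = ⊤ := by
  obtain ⟨I, _, _, f, hf, hI⟩ := exists_injective_embedding (R := R) M
  have hr (m : M) : f m ∈ powTorsion J I := by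
    obtain ⟨k, hk⟩ := hM.ge (Submodule.mem_top (x := m))
    exact ⟨k, fun r hr => by rw [← map_smul, hk r hr, map_zero]⟩
  exact ⟨powTorsion J I, inferInstance, inferInstance, f.codRestrict _ hr,
    fun a b h => hf (congrArg Subtype.val h), powTorsion_injective J hI, powTorsion_powTorsion J I⟩

lemma powTorsion_sup (J K : Ideal R) (M : Type) [AddCommGroup M] [Module R M] :
    powTorsion (J ⊔ K) M = powTorsion J M ⊓ powTorsion K M := by
  apply le_antisymm
  · rintro m ⟨n, hn⟩
    exact ⟨⟨n, fun r hr => hn r (Ideal.pow_right_mono le_sup_left n hr)⟩,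
      ⟨n, fun r hr => hn r (Ideal.pow_right_mono le_sup_right n hr)⟩⟩
  · rintro m ⟨⟨k, hk⟩, ⟨l, hl⟩⟩
    refine ⟨k + l, fun r hr => ?_⟩
    obtain ⟨a, ha, b, hb, rfl⟩ :=
      Submodule.mem_sup.1 (Ideal.sup_pow_add_le_pow_sup_pow hr)
    rw [add_smul, hk a ha, hl b hb, add_zero]

end PowerTorsion

namespace TCoh

variable {R : Type} [CommRing R]

/-- Power torsion modules are acyclic. -/
theorem eq_zero_of_powTorsion_eq_top [IsNoetherianRing R] {J : Ideal R} (i : ℕ) {M : Type}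
    [AddCommGroup M] [Module R M] (hM : powTorsion J M = ⊤) (z : TCoh J (i + 1) M) : z = 0 := by
  induction i generalizing M with
  | zero =>
    obtain ⟨I, _, _, f, hf, hI, hIt⟩ := exists_torsion_injective_embedding hM
    obtain ⟨δ, h₁, h₂, h₃⟩ := exists_connecting (J := J) f (LinearMap.range f).mkQ hf
      (Submodule.mkQ_surjective _) (LinearMap.exact_map_mkQ_range f)
    obtain ⟨w, rfl⟩ := (h₃ 0 z).1 (eq_zero_of_injective hI 0 _)
    obtain ⟨y, hy⟩ := Submodule.mkQ_surjective _ (eval J _ w)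
    obtain ⟨v, rfl⟩ := exists_eval_eq hIt y
    rw [← eval_map] at hy
    rw [← eval_injective hy]
    exact (h₂ 0 _).2 ⟨v, rfl⟩
  | succ i ih =>
    obtain ⟨I, _, _, f, hf, hI, hIt⟩ := exists_torsion_injective_embedding hM
    obtain ⟨δ, h₁, h₂, h₃⟩ := exists_connecting (J := J) f (LinearMap.range f).mkQ hf
      (Submodule.mkQ_surjective _) (LinearMap.exact_map_mkQ_range f)
    obtain ⟨w, rfl⟩ := (h₃ (i + 1) z).1 (eq_zero_of_injective hI _ _)
    rw [ih (powTorsion_eq_top_of_surjective (Submodule.mkQ_surjective _) hIt) w, map_zero]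

lemma nonempty_equiv_zero {J J' : Ideal R} {M : Type} [AddCommGroup M] [Module R M]
    (h : powTorsion J M = powTorsion J' M) :
    ∃ e : TCoh J 0 M ≃ₗ[R] TCoh J' 0 M, ∀ z, eval J' M (e z) = eval J M z := by
  refine ⟨(equivPowTorsion J M).trans ((LinearEquiv.ofEq _ _ h).trans (equivPowTorsion J' M).symm),
    fun z => ?_⟩
  rw [← equivPowTorsion_apply]
  simp [equivPowTorsion_apply]

/-- On `x`-power torsion modules, the cohomology for `J ⊔ (x)` and for `J` agree. -/
theorem nonempty_equiv_of_torsion [IsNoetherianRing R] {J J' : Ideal R} {x : R}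
    (hJ : J = J' ⊔ Ideal.span {x}) (i : ℕ) {M : Type} [AddCommGroup M] [Module R M]
    (hM : powTorsion (Ideal.span {x}) M = ⊤) :
    Nonempty (TCoh J i M ≃ₗ[R] TCoh J' i M) := by
  have h0 {N : Type} [AddCommGroup N] [Module R N] (hN : powTorsion (Ideal.span {x}) N = ⊤) :
      powTorsion J N = powTorsion J' N := by
    rw [hJ, powTorsion_sup, hN, inf_top_eq]
  induction i generalizing M with
  | zero => exact ⟨(nonempty_equiv_zero (h0 hM)).choose⟩
  | succ i ih =>
    obtain ⟨I, _, _, f, hf, hI, hIt⟩ := exists_torsion_injective_embedding hM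
    obtain ⟨δ, h₁, h₂, h₃⟩ := exists_connecting (J := J) f (LinearMap.range f).mkQ hf
      (Submodule.mkQ_surjective _) (LinearMap.exact_map_mkQ_range f)
    obtain ⟨δ', h₁', h₂', h₃'⟩ := exists_connecting (J := J') f (LinearMap.range f).mkQ hf
      (Submodule.mkQ_surjective _) (LinearMap.exact_map_mkQ_range f)
    have hC := powTorsion_eq_top_of_surjective (Submodule.mkQ_surjective (LinearMap.range f)) hIt
    have hδ : Function.Surjective (δ i) := fun z => (h₃ i z).1 (eq_zero_of_injective hI _ _)
    have hδ' : Function.Surjective (δ' i) := fun z => (h₃' i z).1 (eq_zero_of_injective hI _ _)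
    cases i with
    | zero =>
      obtain ⟨e, he⟩ := nonempty_equiv_zero (h0 hC)
      obtain ⟨e', he'⟩ := nonempty_equiv_zero (h0 hIt)
      have hee (z) : e (map J 0 (LinearMap.range f).mkQ z) =
          map J' 0 (LinearMap.range f).mkQ (e' z) := by
        apply eval_injective
        rw [he, eval_map, eval_map, he']
      refine ⟨((δ 0).quotKerEquivOfSurjective hδ).symm.trans
        ((Submodule.Quotient.equiv _ _ e ?_).trans
        ((δ' 0).quotKerEquivOfSurjective hδ'))⟩
      ext z
      simp only [Submodule.mem_map, LinearMap.mem_ker]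
      constructor
      · rintro ⟨w, hw, rfl⟩
        obtain ⟨v, rfl⟩ := (h₂ 0 w).1 hw
        exact (h₂' 0 _).2 ⟨e' v, (hee v).symm⟩
      · intro hz
        obtain ⟨v, rfl⟩ := (h₂' 0 z).1 hz
        refine ⟨map J 0 (LinearMap.range f).mkQ (e'.symm v), (h₂ 0 _).2 ⟨_, rfl⟩, ?_⟩
        change e _ = _
        rw [hee, LinearEquiv.apply_symm_apply]
    | succ i =>
      have hinj : Function.Injective (δ (i + 1)) := by
        rw [injective_iff_map_eq_zero]
        intro z hz
        obtain ⟨w, rfl⟩ := (h₂ _ z).1 hz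
        rw [eq_zero_of_injective hI i w, map_zero]
      have hinj' : Function.Injective (δ' (i + 1)) := by
        rw [injective_iff_map_eq_zero]
        intro z hz
        obtain ⟨w, rfl⟩ := (h₂' _ z).1 hz
        rw [eq_zero_of_injective hI i w, map_zero]
      obtain ⟨e⟩ := ih hC
      exact ⟨(LinearEquiv.ofBijective _ ⟨hinj, hδ⟩).symm.trans
        (e.trans (LinearEquiv.ofBijective _ ⟨hinj', hδ'⟩))⟩

end TCoh

section PowSpan

variable {R : Type} [CommRing R]

/-- The submodule `(x₁ ^ n, …, xₛ ^ n) M` for a list `x₁, …, xₛ`. -/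
def powSpan (M : Type) [AddCommGroup M] [Module R M] : List R → ℕ → Submodule R M
  | [], _ => ⊥
  | x :: l, n => LinearMap.range (LinearMap.lsmul R M (x ^ n)) ⊔ powSpan M l n

variable {M N : Type} [AddCommGroup M] [Module R M] [AddCommGroup N] [Module R N]

lemma mem_powSpan_cons {x : R} {l : List R} {n : ℕ} {m : M} :
    m ∈ powSpan M (x :: l) n ↔ ∃ a, ∃ b ∈ powSpan M l n, x ^ n • a + b = m := by
  rw [powSpan, Submodule.mem_sup]
  constructor
  · rintro ⟨_, ⟨a, rfl⟩, b, hb, rfl⟩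
    exact ⟨a, b, hb, rfl⟩
  · rintro ⟨a, b, hb, rfl⟩
    exact ⟨_, ⟨a, rfl⟩, b, hb, rfl⟩

lemma map_mem_powSpan (f : M →ₗ[R] N) {l : List R} {n : ℕ} {m : M} (hm : m ∈ powSpan M l n) :
    f m ∈ powSpan N l n := by
  induction l generalizing m with
  | nil =>
    rw [powSpan, Submodule.mem_bot] at hm
    rw [hm, map_zero]
    exact zero_mem _
  | cons x l ih =>
    obtain ⟨a, b, hb, rfl⟩ := mem_powSpan_cons.1 hm
    rw [map_add, map_smul]
    exact mem_powSpan_cons.2 ⟨f a, f b, ih hb, rfl⟩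

lemma exists_of_mem_powSpan {f : M →ₗ[R] N} (hf : Function.Surjective f) {l : List R} {n : ℕ}
    {y : N} (hy : y ∈ powSpan N l n) : ∃ m ∈ powSpan M l n, f m = y := by
  induction l generalizing y with
  | nil =>
    rw [powSpan, Submodule.mem_bot] at hy
    exact ⟨0, zero_mem _, by rw [map_zero, hy]⟩
  | cons x l ih =>
    obtain ⟨a, b, hb, rfl⟩ := mem_powSpan_cons.1 hy
    obtain ⟨b', hb', rfl⟩ := ih hb
    obtain ⟨a', rfl⟩ := hf a
    exact ⟨_, mem_powSpan_cons.2 ⟨a', b', hb', rfl⟩, by simp⟩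

lemma prod_pow_smul_mem_powSpan {l : List R} {n : ℕ} (k : ℕ) {m : M} (hm : m ∈ powSpan M l n) :
    l.prod ^ k • m ∈ powSpan M l (n + k) := by
  induction l generalizing m with
  | nil =>
    rw [powSpan, Submodule.mem_bot] at hm
    rw [hm, smul_zero]
    exact zero_mem _
  | cons x l ih =>
    obtain ⟨a, b, hb, rfl⟩ := mem_powSpan_cons.1 hm
    refine mem_powSpan_cons.2 ⟨l.prod ^ k • a, x ^ k • l.prod ^ k • b,
      Submodule.smul_mem _ _ (ih hb), ?_⟩
    simp only [List.prod_cons, mul_pow, smul_add, smul_smul, pow_add]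
    congr 2
    ring

/-- A module `H` is presented as the union of the images of maps `e n : M → H`, where the kernel
of `e n` is the limit closure of `(x₁ ^ n, …, xₛ ^ n) M`. -/
structure LimitPresentation (l : List R) (M H : Type) [AddCommGroup M] [Module R M]
    [AddCommGroup H] [Module R H] where
  /-- the structure maps -/
  e : ℕ → M →ₗ[R] H
  step : ∀ n m, e (n + 1) (l.prod • m) = e n m
  surj : ∀ h, ∃ n m, e n m = h
  eq_zero_iff : ∀ n m, e n m = 0 ↔ ∃ t, l.prod ^ t • m ∈ powSpan M l (n + t)

namespace LimitPresentation

variable {l : List R} {H H' : Type} [AddCommGroup H] [Module R H] [AddCommGroup H'] [Module R H']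

lemma step_pow (E : LimitPresentation l M H) (n k : ℕ) (m : M) :
    E.e (n + k) (l.prod ^ k • m) = E.e n m := by
  induction k with
  | zero => simp
  | succ k ih => rw [pow_succ', mul_smul, ← add_assoc, E.step, ih]

/-- Transport along a linear equivalence. -/
def congr (E : LimitPresentation l M H) (f : H ≃ₗ[R] H') : LimitPresentation l M H' where
  e n := f.toLinearMap ∘ₗ E.e n
  step n m := congrArg f (E.step n m)
  surj h := by
    obtain ⟨n, m, hm⟩ := E.surj (f.symm h)
    exact ⟨n, m, by simp [hm]⟩
  eq_zero_iff n m := by simp [E.eq_zero_iff]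

/-- A limit presentation over `N` gives one over `M` if `M → N` is surjective with kernel
consisting of power torsion elements. -/
def comap (E : LimitPresentation l N H) (f : M →ₗ[R] N) (hf : Function.Surjective f)
    (hker : ∀ m, f m = 0 → ∃ k, l.prod ^ k • m = 0) : LimitPresentation l M H where
  e n := E.e n ∘ₗ f
  step n m := by
    rw [LinearMap.comp_apply, LinearMap.comp_apply, map_smul, E.step]
  surj h := by
    obtain ⟨n, m, hm⟩ := E.surj h
    obtain ⟨m, rfl⟩ := hf m
    exact ⟨n, m, hm⟩
  eq_zero_iff n m := by
    rw [LinearMap.comp_apply, E.eq_zero_iff]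
    constructor
    · rintro ⟨t, ht⟩
      obtain ⟨p, hp, hpt⟩ := exists_of_mem_powSpan hf ht
      obtain ⟨k, hk⟩ := hker (l.prod ^ t • m - p) (by rw [map_sub, map_smul, hpt, sub_self])
      refine ⟨t + k, ?_⟩
      rw [smul_sub, sub_eq_zero, ← mul_smul, ← pow_add, add_comm k] at hk
      rw [hk, ← add_assoc]
      exact prod_pow_smul_mem_powSpan k hp
    · rintro ⟨t, ht⟩
      refine ⟨t, ?_⟩
      rw [← map_smul]
      exact map_mem_powSpan f ht

end LimitPresentation

/-- The cokernel of the localization map `M → M_x`. -/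
abbrev LocCoker (x : R) (M : Type) [AddCommGroup M] [Module R M] : Type :=
  LocalizedModule (Submonoid.powers x) M ⧸
    LinearMap.range (LocalizedModule.mkLinearMap (Submonoid.powers x) M)

namespace LocCoker

/-- The class of the fraction `m / x ^ n`. -/
noncomputable def frac (x : R) (M : Type) [AddCommGroup M] [Module R M] (n : ℕ) :
    M →ₗ[R] LocCoker x M :=
  Submodule.mkQ _ ∘ₗ
    { toFun := fun m => LocalizedModule.mk m (⟨x ^ n, n, rfl⟩ : Submonoid.powers x)
      map_add' := fun a b => by
        rw [LocalizedModule.mk_add_mk, ← smul_add, LocalizedModule.mk_cancel_common_left]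
      map_smul' := fun r a => by
        rw [RingHom.id_apply, LocalizedModule.smul'_mk] }

variable {x : R}

lemma frac_pow_smul (n k : ℕ) (m : M) : frac x M (n + k) (x ^ k • m) = frac x M n m := by
  refine congrArg (Submodule.mkQ _) ?_
  change LocalizedModule.mk _ _ = LocalizedModule.mk _ _
  rw [LocalizedModule.mk_eq]
  refine ⟨1, ?_⟩
  simp only [one_smul, Submonoid.smul_def, smul_smul]
  congr 1
  ring

lemma pow_smul_frac (n k : ℕ) (m : M) : x ^ k • frac x M (n + k) m = frac x M n m := by
  rw [← map_smul, frac_pow_smul]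

lemma exists_frac (κ : LocCoker x M) : ∃ n m, frac x M n m = κ := by
  obtain ⟨κ, rfl⟩ := Submodule.mkQ_surjective _ κ
  induction κ using LocalizedModule.induction_on with
  | h m s =>
    obtain ⟨_, n, rfl⟩ := s
    exact ⟨n, m, rfl⟩

lemma frac_eq_zero_iff (n : ℕ) (m : M) :
    frac x M n m = 0 ↔ ∃ k a, x ^ k • m = x ^ (n + k) • a := by
  change Submodule.Quotient.mk _ = (0 : LocCoker x M) ↔ _
  rw [Submodule.Quotient.mk_eq_zero]
  constructor
  · rintro ⟨a, ha⟩
    change LocalizedModule.mk a 1 = LocalizedModule.mk m _ at ha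
    rw [LocalizedModule.mk_eq] at ha
    obtain ⟨⟨_, k, rfl⟩, hk⟩ := ha
    refine ⟨k, a, ?_⟩
    simp only [one_smul, Submonoid.smul_def, smul_smul] at hk
    rw [add_comm, pow_add, hk]
  · rintro ⟨k, a, h⟩
    refine ⟨a, ?_⟩
    change LocalizedModule.mk a 1 = LocalizedModule.mk m _
    rw [LocalizedModule.mk_eq]
    refine ⟨⟨x ^ k, k, rfl⟩, ?_⟩
    simp only [one_smul, Submonoid.smul_def, smul_smul]
    rw [h, add_comm, pow_add]

lemma powTorsion_eq_top (x : R) (M : Type) [AddCommGroup M] [Module R M] :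
    powTorsion (Ideal.span {x}) (LocCoker x M) = ⊤ := by
  rw [eq_top_iff]
  rintro κ -
  obtain ⟨n, m, rfl⟩ := exists_frac κ
  rw [mem_powTorsion_span_singleton]
  refine ⟨n, ?_⟩
  have := pow_smul_frac (x := x) 0 n m
  rw [zero_add] at this
  rw [this, frac_eq_zero_iff]
  exact ⟨0, m, by simp⟩

lemma smul_bijective (x : R) (M : Type) [AddCommGroup M] [Module R M] :
    Function.Bijective fun m : LocalizedModule (Submonoid.powers x) M => x • m := by
  have := IsLocalizedModule.map_units (LocalizedModule.mkLinearMap (Submonoid.powers x) M)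
    (⟨x, 1, pow_one x⟩ : Submonoid.powers x)
  exact (Module.End.isUnit_iff _).1 this

/-- Fractions with simultaneous denominators. -/
lemma exists_powSpan_frac {l : List R} {n : ℕ} {κ : LocCoker x M}
    (h : κ ∈ powSpan (LocCoker x M) l n) :
    ∃ k, ∀ u, k ≤ u → ∃ b ∈ powSpan M l n, frac x M u b = κ := by
  induction l generalizing κ with
  | nil =>
    rw [powSpan, Submodule.mem_bot] at h
    exact ⟨0, fun u _ => ⟨0, zero_mem _, by rw [h, map_zero]⟩⟩
  | cons y l ih =>
    obtain ⟨α, β, hβ, rfl⟩ := mem_powSpan_cons.1 h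
    obtain ⟨k, hk⟩ := ih hβ
    obtain ⟨v, a, rfl⟩ := exists_frac α
    refine ⟨max k v, fun u hu => ?_⟩
    obtain ⟨b, hb, rfl⟩ := hk u ((le_max_left _ _).trans hu)
    refine ⟨y ^ n • x ^ (u - v) • a + b, mem_powSpan_cons.2 ⟨_, b, hb, rfl⟩, ?_⟩
    rw [map_add, map_smul]
    have := frac_pow_smul (x := x) v (u - v) a
    rw [Nat.add_sub_cancel' ((le_max_right _ _).trans hu)] at this
    rw [this]

end LocCoker

/-- Passing from `M_x / M` and `l` to `M` and `x :: l`. -/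
noncomputable def LimitPresentation.cons {x : R} {l : List R} {H : Type} [AddCommGroup H]
    [Module R H] (E : LimitPresentation l (LocCoker x M) H) :
    LimitPresentation (x :: l) M H where
  e n := E.e n ∘ₗ LocCoker.frac x M n
  step n m := by
    rw [LinearMap.comp_apply, LinearMap.comp_apply, List.prod_cons, mul_comm, mul_smul, map_smul,
      E.step]
    congr 1
    simpa using LocCoker.frac_pow_smul (x := x) n 1 m
  surj h := by
    obtain ⟨n, κ, rfl⟩ := E.surj h
    obtain ⟨k, m, rfl⟩ := LocCoker.exists_frac κ
    refine ⟨n + k, x ^ n • l.prod ^ k • m, ?_⟩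
    rw [LinearMap.comp_apply, add_comm n k, LocCoker.frac_pow_smul, map_smul, add_comm k n,
      E.step_pow]
  eq_zero_iff n m := by
    rw [LinearMap.comp_apply, E.eq_zero_iff]
    constructor
    · rintro ⟨t, ht⟩
      obtain ⟨k, hk⟩ := LocCoker.exists_powSpan_frac ht
      obtain ⟨b, hb, hbm⟩ := hk (n + k) (Nat.le_add_left _ _)
      rw [← map_smul, ← LocCoker.frac_pow_smul n k, eq_comm, ← sub_eq_zero, ← map_sub,
        LocCoker.frac_eq_zero_iff] at hbm
      obtain ⟨v, a, hva⟩ := hbm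
      have key : x ^ (t + k + v) • l.prod ^ (t + k + v) • m ∈
          powSpan M (x :: l) (n + (t + k + v)) := by
        refine mem_powSpan_cons.2 ⟨l.prod ^ (k + v) • a,
          x ^ (t + v) • l.prod ^ (k + v) • b, Submodule.smul_mem _ _ ?_, ?_⟩
        · have := prod_pow_smul_mem_powSpan (k + v) hb
          rwa [add_assoc, ← add_assoc t] at this
        · rw [smul_sub, sub_eq_iff_eq_add] at hva
          have h2 := congrArg (fun z => x ^ t • l.prod ^ (k + v) • z) hva
          simp only [smul_add, smul_smul] at h2 ⊢
          convert h2.symm using 2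
          all_goals ring_nf
      refine ⟨t + k + v, ?_⟩
      rwa [List.prod_cons, mul_pow, mul_smul]
    · rintro ⟨t, ht⟩
      refine ⟨t, ?_⟩
      obtain ⟨a, b, hb, hab⟩ := mem_powSpan_cons.1 ht
      rw [← map_smul, ← LocCoker.frac_pow_smul n t, smul_smul, ← mul_pow, ← List.prod_cons, ← hab,
        map_add, (LocCoker.frac_eq_zero_iff _ _).2 ⟨0, a, by simp⟩, zero_add]
      exact map_mem_powSpan _ hb

end PowSpan

namespace TCoh

variable {R : Type} [CommRing R] {J : Ideal R} {M N P : Type} [AddCommGroup M] [Module R M]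
  [AddCommGroup N] [Module R N] [AddCommGroup P] [Module R P]

lemma nonempty_equiv_succ (f : M →ₗ[R] N) (g : N →ₗ[R] P) (hf : Function.Injective f)
    (hg : Function.Surjective g) (hfg : Function.Exact f g) (i : ℕ)
    (h0 : ∀ z : TCoh J i N, z = 0) (h1 : ∀ z : TCoh J (i + 1) N, z = 0) :
    Nonempty (TCoh J i P ≃ₗ[R] TCoh J (i + 1) M) := by
  obtain ⟨δ, h₁, h₂, h₃⟩ := exists_connecting (J := J) f g hf hg hfg
  refine ⟨LinearEquiv.ofBijective (δ i) ⟨(injective_iff_map_eq_zero _).2 fun z hz => ?_,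
    fun z => (h₃ i z).1 (h1 _)⟩⟩
  obtain ⟨w, rfl⟩ := (h₂ i z).1 hz
  rw [h0 w, map_zero]

lemma map_injective_of_exact (f : M →ₗ[R] N) (g : N →ₗ[R] P) (hf : Function.Injective f)
    (hg : Function.Surjective g) (hfg : Function.Exact f g) (i : ℕ)
    (h0 : ∀ z : TCoh J i M, z = 0) : Function.Injective (map J i g) := by
  obtain ⟨δ, h₁, h₂, h₃⟩ := exists_connecting (J := J) f g hf hg hfg
  refine (injective_iff_map_eq_zero _).2 fun z hz => ?_
  obtain ⟨w, rfl⟩ := (h₁ i z).1 hz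
  rw [h0 w, map_zero]

lemma map_bijective_of_exact (f : M →ₗ[R] N) (g : N →ₗ[R] P) (hf : Function.Injective f)
    (hg : Function.Surjective g) (hfg : Function.Exact f g) (i : ℕ)
    (h0 : ∀ z : TCoh J i M, z = 0) (h1 : ∀ z : TCoh J (i + 1) M, z = 0) :
    Function.Bijective (map J i g) := by
  refine ⟨map_injective_of_exact f g hf hg hfg i h0, ?_⟩
  obtain ⟨δ, h₁, h₂, h₃⟩ := exists_connecting (J := J) f g hf hg hfg
  exact fun z => (h₂ i z).1 (h1 _)

end TCoh

section Torsion

variable {R : Type} [CommRing R]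

lemma powTorsion_self (J : Ideal R) (M : Type) [AddCommGroup M] [Module R M] (N : Submodule R M)
    (h : N ≤ powTorsion J M) : powTorsion J N = ⊤ := by
  rw [eq_top_iff]
  rintro ⟨m, hm⟩ -
  obtain ⟨k, hk⟩ := h hm
  exact ⟨k, fun r hr => Subtype.ext (hk r hr)⟩

/-- Modulo its `x`-power torsion, a module embeds in its localization at `x`. -/
lemma mkLinearMap_quotient_injective (x : R) (M : Type) [AddCommGroup M] [Module R M] :
    Function.Injective (LocalizedModule.mkLinearMap (Submonoid.powers x)
      (M ⧸ powTorsion (Ideal.span {x}) M)) := by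
  refine (injective_iff_map_eq_zero _).2 fun z hz => ?_
  obtain ⟨m, rfl⟩ := Submodule.mkQ_surjective _ z
  rw [LocalizedModule.mkLinearMap_apply, ← LocalizedModule.zero_mk 1, LocalizedModule.mk_eq] at hz
  obtain ⟨⟨_, n, rfl⟩, hn⟩ := hz
  simp only [one_smul, Submonoid.smul_def, smul_zero] at hn
  rw [← map_smul, Submodule.mkQ_apply, Submodule.Quotient.mk_eq_zero,
    mem_powTorsion_span_singleton] at hn
  obtain ⟨k, hk⟩ := hn
  rw [Submodule.mkQ_apply, Submodule.Quotient.mk_eq_zero, mem_powTorsion_span_singleton]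
  exact ⟨k + n, by rw [pow_add, mul_smul, hk]⟩

end Torsion

namespace TCoh

variable {R : Type} [CommRing R]

lemma nonempty_equiv_locCoker {J : Ideal R} {x : R} (hx : x ∈ J) (i : ℕ) {N : Type}
    [AddCommGroup N] [Module R N]
    (hN : Function.Injective (LocalizedModule.mkLinearMap (Submonoid.powers x) N)) :
    Nonempty (TCoh J i (LocCoker x N) ≃ₗ[R] TCoh J (i + 1) N) :=
  nonempty_equiv_succ _ (Submodule.mkQ _) hN (Submodule.mkQ_surjective _)
    (LinearMap.exact_map_mkQ_range _) i
    (eq_zero_of_bijective hx (LocCoker.smul_bijective x N) i)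
    (eq_zero_of_bijective hx (LocCoker.smul_bijective x N) (i + 1))

variable [IsNoetherianRing R]

theorem eq_zero_and_nonempty_limitPresentation (l : List R) (M : Type) [AddCommGroup M]
    [Module R M] :
    (∀ i, l.length < i → ∀ z : TCoh (Ideal.ofList l) i M, z = 0) ∧
      Nonempty (LimitPresentation l M (TCoh (Ideal.ofList l) l.length M)) := by
  induction l generalizing M with
  | nil =>
    have hM : powTorsion (Ideal.ofList ([] : List R)) M = ⊤ := by
      rw [eq_top_iff, Ideal.ofList_nil]
      refine fun m _ => ⟨1, fun r hr => ?_⟩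
      rw [pow_one, Ideal.mem_bot] at hr
      rw [hr, zero_smul]
    refine ⟨fun i hi z => ?_, ⟨?_⟩⟩
    · obtain ⟨i, rfl⟩ := Nat.exists_eq_add_one.2 hi
      exact eq_zero_of_powTorsion_eq_top i hM z
    · have E : LimitPresentation ([] : List R) M M :=
        { e := fun _ => LinearMap.id
          step := fun _ m => by simp
          surj := fun m => ⟨0, m, rfl⟩
          eq_zero_iff := fun n m => by simp [powSpan] }
      exact E.congr (LinearEquiv.ofBijective (eval _ M)
        ⟨eval_injective, exists_eval_eq hM⟩).symm
  | cons x l ih =>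
    have hJ : Ideal.ofList (x :: l) = Ideal.ofList l ⊔ Ideal.span {x} := by
      rw [Ideal.ofList_cons, sup_comm]
    have hx : x ∈ Ideal.ofList (x :: l) := hJ ▸
      Ideal.mem_sup_right (Ideal.mem_span_singleton_self x)
    generalize hJ' : Ideal.ofList (x :: l) = J at *
    let Γ := powTorsion (Ideal.span {x}) M
    have hΓ : powTorsion (Ideal.span {x}) Γ = ⊤ := powTorsion_self _ _ _ le_rfl
    have hΓ0 (i : ℕ) (hi : l.length < i) (z : TCoh J i Γ) : z = 0 := by
      obtain ⟨e⟩ := nonempty_equiv_of_torsion hJ i hΓ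
      exact e.injective (((ih Γ).1 i hi _).trans (map_zero e).symm)
    have hinj := mkLinearMap_quotient_injective x M
    have hC := LocCoker.powTorsion_eq_top x (M ⧸ Γ)
    have hexact : Function.Exact Γ.subtype Γ.mkQ := LinearMap.exact_subtype_mkQ _
    refine ⟨fun i hi z => ?_, ?_⟩
    · rw [List.length_cons] at hi
      obtain ⟨i, rfl⟩ := Nat.exists_eq_add_one.2 (Nat.zero_lt_of_lt hi)
      refine map_injective_of_exact Γ.subtype Γ.mkQ (Submodule.subtype_injective _)
        (Submodule.mkQ_surjective _) hexact (i + 1) (hΓ0 _ (by lia)) ?_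
      rw [map_zero]
      obtain ⟨e⟩ := nonempty_equiv_locCoker hx i hinj
      obtain ⟨e'⟩ := nonempty_equiv_of_torsion hJ i hC
      refine (e'.symm.trans e).symm.injective ?_
      rw [map_zero]
      exact (ih _).1 i (by lia) _
    · obtain ⟨e⟩ := nonempty_equiv_locCoker hx l.length hinj
      obtain ⟨e'⟩ := nonempty_equiv_of_torsion hJ l.length hC
      obtain ⟨E⟩ := (ih (LocCoker x (M ⧸ Γ))).2
      have e'' : TCoh J (l.length + 1) M ≃ₗ[R] TCoh J (l.length + 1) (M ⧸ Γ) :=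
        LinearEquiv.ofBijective _ (map_bijective_of_exact Γ.subtype Γ.mkQ
          (Submodule.subtype_injective _) (Submodule.mkQ_surjective _) hexact (l.length + 1)
          (hΓ0 _ (by lia)) (hΓ0 _ (by lia)))
      refine ⟨((E.congr ((e'.symm.trans e).trans e''.symm)).cons).comap Γ.mkQ
        (Submodule.mkQ_surjective _) fun m hm => ?_⟩
      rw [Submodule.mkQ_apply, Submodule.Quotient.mk_eq_zero, mem_powTorsion_span_singleton] at hm
      obtain ⟨k, hk⟩ := hm
      exact ⟨k, by rw [List.prod_cons, mul_pow, mul_comm, mul_smul, hk, smul_zero]⟩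

end TCoh

section ExtComparison

open Abelian Opposite

lemma homologyUnop_hom_naturality {V ι : Type*} [Category* V] [Preadditive V]
    [CategoryWithHomology V] {c : ComplexShape ι} {K K' : HomologicalComplex Vᵒᵖ c} (ψ : K' ⟶ K) (i : ι) :
    HomologicalComplex.homologyMap ((HomologicalComplex.unopFunctor V c).map ψ.op) i ≫
      (HomologicalComplex.homologyUnop K' i).hom =
    (HomologicalComplex.homologyUnop K i).hom ≫ (HomologicalComplex.homologyMap ψ i).unop := by
  apply Quiver.Hom.op_inj
  exact (HomologicalComplex.homologyOp_hom_naturality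
    ((HomologicalComplex.unopFunctor V c).map ψ.op) i).symm

variable {R : Type} [CommRing R] {X X' : ModuleCat.{0} R} (P : ProjectiveResolution X)
  (P' : ProjectiveResolution X') (Y : ModuleCat.{0} R) (n : ℕ)

lemma extMk_eq_zero_iff_zero {f : P.complex.X 0 ⟶ Y} (hf : P.complex.d 1 0 ≫ f = 0) :
    P.extMk f 1 rfl hf = 0 ↔ f = 0 := by
  constructor
  · intro h
    simp only [← P.extEquivCohomologyClass.apply_eq_iff_eq,
      ProjectiveResolution.extEquivCohomologyClass_extMk,
      ProjectiveResolution.extEquivCohomologyClass_zero,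
      CochainComplex.HomComplex.CohomologyClass.mk_eq_zero_iff] at h
    rw [CochainComplex.HomComplex.Cocycle.toSingleMk_mem_coboundaries_iff _ _ _ _ _ 1
      (by lia)] at h
    obtain ⟨g, hg⟩ := h
    rw [(P.cochainComplex.isZero_of_isStrictlyLE 0 1).eq_of_src g 0, Limits.comp_zero] at hg
    exact (cancel_epi _).1 (hg.symm.trans Limits.comp_zero.symm)
  · rintro rfl
    exact P.extMk_zero _ _

/-- The cocycle underlying a cycle. -/
noncomputable def cyclesHom :
    (P.complex.linearYonedaObj R Y).cycles n →ₗ[R] (P.complex.X n ⟶ Y) :=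
  ((P.complex.linearYonedaObj R Y).iCycles n).hom

variable {P Y n} in
lemma d_comp_cyclesHom (z : (P.complex.linearYonedaObj R Y).cycles n) :
    P.complex.d (n + 1) n ≫ cyclesHom P Y n z = 0 :=
  ConcreteCategory.congr_hom ((P.complex.linearYonedaObj R Y).iCycles_d n (n + 1)) z

variable {P Y n} in
lemma exists_cyclesHom_eq {f : P.complex.X n ⟶ Y} (hf : P.complex.d (n + 1) n ≫ f = 0) :
    ∃ z, cyclesHom P Y n z = f := by
  let L := P.complex.linearYonedaObj R Y
  let k : ModuleCat.of R R ⟶ L.X n :=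
    ModuleCat.ofHom (LinearMap.toSpanSingleton R (P.complex.X n ⟶ Y) f)
  have hk : k ≫ L.d n (n + 1) = 0 := by
    ext
    change P.complex.d (n + 1) n ≫ ((1 : R) • f) = 0
    rw [one_smul, hf]
  refine ⟨L.liftCycles k (n + 1) (by simp) hk (1 : R), ?_⟩
  refine (ConcreteCategory.congr_hom (L.liftCycles_i k (n + 1) (by simp) hk) (1 : R)).trans ?_
  exact one_smul R f

variable {P Y n} in
lemma homologyπ_eq_zero_iff (z : (P.complex.linearYonedaObj R Y).cycles n) :
    (P.complex.linearYonedaObj R Y).homologyπ n z = 0 ↔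
      P.extMk (cyclesHom P Y n z) (n + 1) rfl (d_comp_cyclesHom z) = 0 := by
  let L := P.complex.linearYonedaObj R Y
  have hinj : Function.Injective (cyclesHom P Y n) :=
    (ModuleCat.mono_iff_injective (L.iCycles n)).1 inferInstance
  cases n with
  | zero =>
    rw [extMk_eq_zero_iff_zero]
    have : IsIso (L.homologyπ 0) := L.isIso_homologyπ 0 0 (by simp) (L.shape 0 0 (by simp))
    have hinj' : Function.Injective (L.homologyπ 0) :=
      (ModuleCat.mono_iff_injective (L.homologyπ 0)).1 inferInstance
    exact (map_eq_zero_iff _ hinj').trans (map_eq_zero_iff _ hinj).symm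
  | succ p =>
    rw [P.extMk_eq_zero_iff _ _ _ _ p rfl]
    have hex : (ShortComplex.mk (L.toCycles p (p + 1)) (L.homologyπ (p + 1)) (by simp)).Exact :=
      ShortComplex.exact_of_g_is_cokernel _ (L.homologyIsCokernel p (p + 1) (by simp))
    have hi (g : P.complex.X p ⟶ Y) :
        cyclesHom P Y (p + 1) (L.toCycles p (p + 1) g) = P.complex.d (p + 1) p ≫ g :=
      ConcreteCategory.congr_hom (L.toCycles_i p (p + 1)) g
    rw [ShortComplex.moduleCat_exact_iff] at hex
    constructor
    · intro h
      obtain ⟨g, rfl⟩ := hex z h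
      exact ⟨g, (hi g).symm⟩
    · rintro ⟨g, hg⟩
      have : z = L.toCycles p (p + 1) g := hinj (hg.symm.trans (hi g).symm)
      rw [this]
      exact ConcreteCategory.congr_hom (L.toCycles_comp_homologyπ p (p + 1)) g

/-- The class in `Ext` of a cocycle. -/
noncomputable def cyclesToExt :
    (P.complex.linearYonedaObj R Y).cycles n →ₗ[R] Abelian.Ext X Y n where
  toFun z := P.extMk (cyclesHom P Y n z) (n + 1) rfl (d_comp_cyclesHom z)
  map_add' z w := by
    rw [ProjectiveResolution.add_extMk]
    congr 1
    exact map_add _ _ _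
  map_smul' r z := by
    rw [RingHom.id_apply, Ext.smul_eq_comp_mk₀, ProjectiveResolution.extMk_comp_mk₀]
    congr 1
    rw [map_smul]
    simp

lemma cyclesToExt_apply (z) : cyclesToExt P Y n z =
    P.extMk (cyclesHom P Y n z) (n + 1) rfl (d_comp_cyclesHom z) := rfl

lemma cyclesToExt_surjective : Function.Surjective (cyclesToExt P Y n) := by
  intro α
  obtain ⟨f, hf, rfl⟩ := P.extMk_surjective α (n + 1) rfl
  obtain ⟨z, rfl⟩ := exists_cyclesHom_eq hf
  exact ⟨z, rfl⟩

/-- The comparison between the two versions of `Ext`. -/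
lemma exists_homology_equiv :
    ∃ e : (P.complex.linearYonedaObj R Y).homology n ≃ₗ[R] Abelian.Ext X Y n,
    ∀ z, e ((P.complex.linearYonedaObj R Y).homologyπ n z) = cyclesToExt P Y n z := by
  have hπ : Function.Surjective ((P.complex.linearYonedaObj R Y).homologyπ n).hom :=
    (ModuleCat.epi_iff_surjective _).1 inferInstance
  have hker : LinearMap.ker ((P.complex.linearYonedaObj R Y).homologyπ n).hom =
      LinearMap.ker (cyclesToExt P Y n) := by
    ext z
    exact homologyπ_eq_zero_iff z
  refine ⟨(LinearMap.quotKerEquivOfSurjective _ hπ).symm.trans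
    ((Submodule.quotEquivOfEq _ _ hker).trans
      (LinearMap.quotKerEquivOfSurjective _ (cyclesToExt_surjective P Y n))), fun z => ?_⟩
  have : (LinearMap.quotKerEquivOfSurjective _ hπ).symm
      ((P.complex.linearYonedaObj R Y).homologyπ n z) = Submodule.Quotient.mk z := by
    rw [LinearEquiv.symm_apply_eq]
    rfl
  rw [LinearEquiv.trans_apply, this]
  rfl

variable {P P' Y n} in
lemma ext_map_isoExt_inv {φ : X' ⟶ X} (ψ : P'.complex ⟶ P.complex)
    (comm : ψ.f 0 ≫ P.π.f 0 = P'.π.f 0 ≫ φ) :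
    ∃ ψ' : P.complex.linearYonedaObj R Y ⟶ P'.complex.linearYonedaObj R Y,
      (∀ n (f : P.complex.X n ⟶ Y), ψ'.f n f = ψ.f n ≫ f) ∧
      (P.isoExt n Y).inv ≫ ((_root_.Ext R (ModuleCat.{0} R) n).map φ.op).app Y =
        HomologicalComplex.homologyMap ψ' n ≫ (P'.isoExt n Y).inv := by
  let F := ((linearYoneda R (ModuleCat.{0} R)).obj Y).rightOp
  refine ⟨(HomologicalComplex.unopFunctor _ _).map
    ((F.mapHomologicalComplex _).map ψ).op, fun n f => rfl, ?_⟩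
  have h1 := homologyUnop_hom_naturality ((F.mapHomologicalComplex _).map ψ) n
  have h2 := congrArg Quiver.Hom.unop
    (ProjectiveResolution.isoLeftDerivedObj_hom_naturality φ P' P ψ comm F n)
  change (HomologicalComplex.homologyUnop _ _).hom ≫ (P.isoLeftDerivedObj F n).hom.unop ≫
    ((F.leftDerived n).map φ).unop =
    HomologicalComplex.homologyMap _ n ≫ (HomologicalComplex.homologyUnop _ _).hom ≫
      (P'.isoLeftDerivedObj F n).hom.unop
  refine (congrArg (fun t => (HomologicalComplex.homologyUnop _ _).hom ≫ t) h2).trans ?_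
  exact (Category.assoc _ _ _).symm.trans ((congrArg
    (fun t => t ≫ (P'.isoLeftDerivedObj F n).hom.unop) h1).symm.trans (Category.assoc _ _ _))

variable (X) in
/-- The two versions of `Ext` agree. -/
noncomputable def extEquivExt :
    ((_root_.Ext R (ModuleCat.{0} R) n).obj (op X)).obj Y ≃ₗ[R] Abelian.Ext X Y n :=
  ((projectiveResolution X).isoExt n Y).toLinearEquiv.trans
    (exists_homology_equiv (projectiveResolution X) Y n).choose

variable {Y n} in
lemma extEquivExt_naturality (φ : X' ⟶ X)
    (z : ((_root_.Ext R (ModuleCat.{0} R) n).obj (op X)).obj Y) :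
    extEquivExt X' Y n (((_root_.Ext R (ModuleCat.{0} R) n).map φ.op).app Y z) =
      (Abelian.Ext.mk₀ φ).comp (extEquivExt X Y n z) (zero_add n) := by
  let P := projectiveResolution X
  let P' := projectiveResolution X'
  obtain ⟨w, rfl⟩ := ((projectiveResolution X).isoExt n Y).toLinearEquiv.symm.surjective z
  obtain ⟨c, rfl⟩ := (ModuleCat.epi_iff_surjective
    ((P.complex.linearYonedaObj R Y).homologyπ n)).1 inferInstance w
  obtain ⟨ψ', hψ', hmap⟩ := ext_map_isoExt_inv (Y := Y) (n := n)
    (ProjectiveResolution.lift φ P' P) (ProjectiveResolution.lift_commutes_zero φ P' P)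
  have hmap' := ConcreteCategory.congr_hom hmap ((P.complex.linearYonedaObj R Y).homologyπ n c)
  have h1 : extEquivExt X Y n (((projectiveResolution X).isoExt n Y).toLinearEquiv.symm
      ((P.complex.linearYonedaObj R Y).homologyπ n c)) = cyclesToExt P Y n c := by
    rw [extEquivExt, LinearEquiv.trans_apply, LinearEquiv.apply_symm_apply]
    exact (exists_homology_equiv (projectiveResolution X) Y n).choose_spec c
  rw [h1]
  have h2 : extEquivExt X' Y n ((P'.isoExt n Y).inv (HomologicalComplex.homologyMap ψ' n
      ((P.complex.linearYonedaObj R Y).homologyπ n c))) =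
      cyclesToExt P' Y n (HomologicalComplex.cyclesMap ψ' n c) := by
    rw [extEquivExt, LinearEquiv.trans_apply]
    refine Eq.trans ?_ ((exists_homology_equiv P' Y n).choose_spec _)
    congr 1
    refine ((P'.isoExt n Y).toLinearEquiv.apply_symm_apply _).trans ?_
    exact ConcreteCategory.congr_hom (HomologicalComplex.homologyπ_naturality ψ' n) c
  refine (congrArg (extEquivExt X' Y n) hmap').trans (h2.trans ?_)
  rw [cyclesToExt_apply, cyclesToExt_apply]
  let Φ : ProjectiveResolution.Hom P' P φ :=
    { hom := ProjectiveResolution.lift φ P' P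
      hom_f_zero_comp_π_f_zero := by
        rw [ProjectiveResolution.lift_commutes_zero]
        simp }
  rw [ProjectiveResolution.mk₀_comp_extMk _ _ _ _ Φ]
  congr 1
  refine Eq.trans ?_ (hψ' n _)
  exact ConcreteCategory.congr_hom (HomologicalComplex.cyclesMap_i ψ' n) c

end ExtComparison

section LocalCohomologyComparison

open Opposite Limits

variable {R : Type} [CommRing R]

lemma extEquivExt_symm_transition (J : Ideal R) (i : ℕ) (M : ModuleCat.{0} R) {m n : ℕ} (h : m ≤ n)
    (x : Abelian.Ext (ModuleCat.of R (R ⧸ J ^ m)) M i) :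
    (extEquivExt _ M i).symm (extTransition J i M m n h x) =
      ((_root_.Ext R (ModuleCat.{0} R) i).map (powQuotMap J h).op).app M
        ((extEquivExt _ M i).symm x) := by
  rw [LinearEquiv.symm_apply_eq, extEquivExt_naturality, LinearEquiv.apply_symm_apply]
  rfl

theorem nonempty_equiv_LC (J : Ideal R) (i : ℕ) (M : Type) [AddCommGroup M] [Module R M] :
    Nonempty (TCoh J i M ≃ₗ[R] LC R J i (ModuleCat.of R M)) := by
  let D := localCohomology.diagram (localCohomology.idealPowersDiagram J) i
  let c := ((evaluation (ModuleCat.{0} R) (ModuleCat.{0} R)).obj (ModuleCat.of R M)).mapCocone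
    (colimit.cocone D)
  let hc : IsColimit c := isColimitOfPreserves
    ((evaluation (ModuleCat.{0} R) (ModuleCat.{0} R)).obj (ModuleCat.of R M)) (colimit.isColimit D)
  let ι (n : ℕ) : ((_root_.Ext R (ModuleCat.{0} R) i).obj
      (op (ModuleCat.of R (R ⧸ J ^ n)))).obj (ModuleCat.of R M) →ₗ[R]
      LC R J i (ModuleCat.of R M) := (c.ι.app (op (op n))).hom
  have hι {m n : ℕ} (h : m ≤ n) (z) : ι n (((_root_.Ext R (ModuleCat.{0} R) i).map
      (powQuotMap J h).op).app (ModuleCat.of R M) z) = ι m z :=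
    ConcreteCategory.congr_hom (c.w (homOfLE h).op.op) z
  let Λ : TCoh J i M →ₗ[R] LC R J i (ModuleCat.of R M) :=
    TCoh.lift (fun n => ι n ∘ₗ (extEquivExt _ _ i).symm.toLinearMap) fun m n h x => by
      change ι n ((extEquivExt _ _ i).symm (extTransition J i _ m n h x)) = _
      rw [extEquivExt_symm_transition, hι]
      rfl
  have hΛ (n x) : Λ (TCoh.of J i M n x) = ι n ((extEquivExt _ _ i).symm x) := TCoh.lift_of _ _ _ _
  refine ⟨LinearEquiv.ofBijective Λ ⟨(injective_iff_map_eq_zero _).2 fun z hz => ?_, fun h => ?_⟩⟩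
  · obtain ⟨n, x, rfl⟩ := TCoh.exists_of z
    rw [hΛ] at hz
    obtain ⟨⟨⟨k⟩⟩, f, g, hfg⟩ := (Concrete.isColimit_rep_eq_iff_exists _ hc _ 0).1
      (hz.trans (map_zero (ι n)).symm)
    have hk : n ≤ k := leOfHom f.unop.unop
    rw [← TCoh.of_transition hk]
    convert map_zero (TCoh.of J i M k)
    apply (extEquivExt _ _ i).symm.injective
    rw [extEquivExt_symm_transition, map_zero]
    exact hfg.trans (map_zero _)
  · obtain ⟨⟨⟨n⟩⟩, y, rfl⟩ := Concrete.isColimit_exists_rep _ hc h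
    refine ⟨TCoh.of J i M n (extEquivExt _ _ i y), ?_⟩
    rw [hΛ]
    exact congrArg (ι n) ((extEquivExt _ _ i).symm_apply_apply y)

theorem nonempty_limitPresentation_LC [IsNoetherianRing R] (J : Ideal R) (l : List R)
    (h : (Ideal.ofList l).radical = J.radical) (M : Type) [AddCommGroup M] [Module R M] :
    Nonempty (LimitPresentation l M (LC R J l.length (ModuleCat.of R M))) := by
  obtain ⟨E⟩ := (TCoh.eq_zero_and_nonempty_limitPresentation l M).2
  obtain ⟨e⟩ := nonempty_equiv_LC (Ideal.ofList l) l.length M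
  exact ⟨E.congr (e.trans ((localCohomology.isoOfSameRadical h l.length).app
    (ModuleCat.of R M)).toLinearEquiv)⟩

end LocalCohomologyComparison

section Artinian

variable {R : Type} [CommRing R]

/-- A module on which `x` acts locally nilpotently is Artinian if the kernel of `x` is. -/
theorem isArtinian_of_ker_smul (x : R) (A : Type) [AddCommGroup A] [Module R A]
    (hx : ∀ a : A, ∃ n, x ^ n • a = 0) [IsArtinian R (LinearMap.ker (LinearMap.lsmul R A x))] :
    IsArtinian R A := by
  rw [← monotone_stabilizes_iff_artinian]
  intro f
  let C : ℕ → Submodule R A := fun n => OrderDual.ofDual (f n)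
  have hC : Antitone C := fun a b h => f.monotone h
  let B : ℕ → ℕ → Submodule R (LinearMap.ker (LinearMap.lsmul R A x)) := fun j n =>
    ((C n).map (LinearMap.lsmul R A (x ^ j))).comap (Submodule.subtype _)
  have mem_B : ∀ j n k, k ∈ B j n ↔ ∃ a ∈ C n, x ^ j • a = k := fun j n k => by
    simp [B, Submodule.mem_map]
  have hB : ∀ j j' n n', j ≤ j' → n ≤ n' → B j' n' ≤ B j n := by
    intro j j' n n' hj hn k hk
    obtain ⟨a, ha, h⟩ := (mem_B _ _ _).1 hk
    refine (mem_B _ _ _).2 ⟨x ^ (j' - j) • a, (C n).smul_mem _ (hC hn ha), ?_⟩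
    rw [smul_smul, ← pow_add, Nat.add_sub_cancel' hj, h]
  have stab : ∀ j, ∃ n, ∀ m, n ≤ m → B j n ≤ B j m := fun j => by
    obtain ⟨n, hn⟩ := IsArtinian.monotone_stabilizes
      (⟨fun n => OrderDual.toDual (B j n), fun a b h => hB _ _ _ _ le_rfl h⟩ :
        ℕ →o (Submodule R _)ᵒᵈ)
    exact ⟨n, fun m hm => (congrArg OrderDual.ofDual (hn m hm)).le⟩
  obtain ⟨N, hN⟩ := IsArtinian.monotone_stabilizes
    (⟨fun n => OrderDual.toDual (B n n), fun a b h => hB _ _ _ _ h h⟩ : ℕ →o (Submodule R _)ᵒᵈ)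
  choose s hs using stab
  let n₂ := N + ∑ j ∈ Finset.range N, s j
  have key : ∀ j m, n₂ ≤ m → B j n₂ ≤ B j m := by
    intro j m hm
    by_cases hj : j < N
    · have h1 : s j ≤ n₂ :=
        (Finset.single_le_sum (fun _ _ => Nat.zero_le _) (Finset.mem_range.2 hj)).trans
          (Nat.le_add_left _ _)
      exact (hB j j _ _ le_rfl h1).trans (hs j m (h1.trans hm))
    · push Not at hj
      have h2 : N ≤ n₂ := Nat.le_add_right _ _
      have h3 : B N N ≤ B (max j m) (max j m) :=
        (
          congrArg OrderDual.ofDual (hN (max j m) (hj.trans (le_max_left _ _)))).le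
      exact (hB _ _ _ _ hj h2).trans (h3.trans (hB _ _ _ _ (le_max_left _ _) (le_max_right _ _)))
  refine ⟨n₂, fun m hm => le_antisymm (f.monotone hm) ?_⟩
  have : ∀ j, ∀ a ∈ C n₂, x ^ j • a = 0 → a ∈ C m := by
    intro j
    induction j with
    | zero => intro a _ h; rw [pow_zero, one_smul] at h; rw [h]; exact zero_mem _
    | succ j ih =>
      intro a ha h
      have hk : x ^ j • a ∈ LinearMap.ker (LinearMap.lsmul R A x) := by
        rw [LinearMap.mem_ker, LinearMap.lsmul_apply, smul_smul, ← pow_succ', h]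
      obtain ⟨b, hb, h'⟩ := (mem_B _ _ _).1 (key j m hm ((mem_B j n₂ ⟨_, hk⟩).2 ⟨a, ha, rfl⟩))
      have := ih (a - b) ((C n₂).sub_mem ha (hC hm hb)) (by rw [smul_sub, h', sub_self])
      simpa using (C m).add_mem this hb
  intro a ha
  obtain ⟨j, hj⟩ := hx a
  exact this j a ha hj

variable [IsNoetherianRing R]

theorem TCoh.isArtinian_of_support (J : Ideal R) (M : Type) [AddCommGroup M] [Module R M]
    [Module.Finite R M] : (∀ p : PrimeSpectrum R, p ∈ Module.support R M →
    ∀ i, IsArtinian R (TCoh J i (R ⧸ p.asIdeal))) → ∀ i, IsArtinian R (TCoh J i M) := by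
  induction ‹Module.Finite R M› using
    IsNoetherianRing.induction_on_isQuotientEquivQuotientPrime R with
  | subsingleton N =>
    intro _ i
    have : Subsingleton (TCoh J i N) := ⟨fun a b => by
      have h : (LinearMap.id : N →ₗ[R] N) = 0 := Subsingleton.elim _ _
      rw [← TCoh.map_id i a, ← TCoh.map_id i b, h, TCoh.map_zero_apply, TCoh.map_zero_apply]⟩
    infer_instance
  | quotient N p f =>
    intro h i
    have := h p (by
      rw [f.support_eq, Module.support_eq_zeroLocus, Ideal.annihilator_quotient]
      exact Set.Subset.refl (p.asIdeal : Set R)) i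
    exact isArtinian_of_injective (TCoh.congr (J := J) i f).toLinearMap
      (TCoh.congr (J := J) i f).injective
  | exact N₁ N₂ N₃ f g hf hg hfg h₁ h₃ =>
    intro h i
    rw [Module.support_of_exact hfg hf hg] at h
    obtain ⟨δ, e₁, e₂, e₃⟩ := TCoh.exists_connecting (J := J) f g hf hg hfg
    have := h₁ (fun p hp => h p (Or.inl hp)) i
    have := h₃ (fun p hp => h p (Or.inr hp)) i
    exact isArtinian_of_range_eq_ker (TCoh.map J i f) (TCoh.map J i g)
      (LinearMap.exact_iff.1 (e₁ i)).symm

theorem TCoh.isArtinian_quotient_prime (J : Ideal R) (p : PrimeSpectrum R)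
    (h : ∀ q : PrimeSpectrum R, p ≤ q → J ≤ q.asIdeal → q.asIdeal.IsMaximal) :
    ∀ i, IsArtinian R (TCoh J i (R ⧸ p.asIdeal)) := by
  have wf : WellFoundedGT (PrimeSpectrum R) :=
    StrictMono.wellFoundedGT (f := PrimeSpectrum.asIdeal) fun _ _ h => h
  induction p using WellFoundedGT.induction with
  | ind p ih =>
    by_cases hJ : J ≤ p.asIdeal
    · have := h p le_rfl hJ
      have tors : powTorsion J (R ⧸ p.asIdeal) = ⊤ := by
        rw [eq_top_iff]
        rintro z -
        refine ⟨1, fun r hr => ?_⟩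
        obtain ⟨z, rfl⟩ := Ideal.Quotient.mk_surjective z
        rw [pow_one] at hr
        rw [← Ideal.Quotient.mk_eq_mk, ← Submodule.Quotient.mk_smul, Submodule.Quotient.mk_eq_zero]
        exact p.asIdeal.mul_mem_right _ (hJ hr)
      have : IsSimpleModule R (R ⧸ p.asIdeal) := by
        rw [isSimpleModule_iff_isCoatom]; exact Ideal.isMaximal_def.1 this
      rintro (_ | i)
      · exact isArtinian_of_injective (TCoh.eval J (R ⧸ p.asIdeal)) TCoh.eval_injective
      · have : Subsingleton (TCoh J (i + 1) (R ⧸ p.asIdeal)) :=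
          ⟨fun a b => by rw [TCoh.eq_zero_of_powTorsion_eq_top i tors a,
            TCoh.eq_zero_of_powTorsion_eq_top i tors b]⟩
        infer_instance
    · obtain ⟨x, hxJ, hxp⟩ := SetLike.not_le_iff_exists.1 hJ
      have hinj : Function.Injective
          (x • LinearMap.id : (R ⧸ p.asIdeal) →ₗ[R] (R ⧸ p.asIdeal)) := by
        refine (injective_iff_map_eq_zero _).2 fun z hz => ?_
        obtain ⟨z, rfl⟩ := Ideal.Quotient.mk_surjective z
        simp only [LinearMap.smul_apply, LinearMap.id_apply] at hz
        rw [← Ideal.Quotient.mk_eq_mk, ← Submodule.Quotient.mk_smul, Submodule.Quotient.mk_eq_zero]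
          at hz
        exact Ideal.Quotient.eq_zero_iff_mem.2 ((p.2.mem_or_mem hz).resolve_left hxp)
      set φ := (x • LinearMap.id : (R ⧸ p.asIdeal) →ₗ[R] (R ⧸ p.asIdeal)) with hφ
      have hC : ∀ i, IsArtinian R (TCoh J i ((R ⧸ p.asIdeal) ⧸ LinearMap.range φ)) := by
        refine TCoh.isArtinian_of_support J _ fun q hq => ?_
        have h1 : p ≤ q := by
          have := Module.support_subset_of_surjective (LinearMap.range φ).mkQ
            (Submodule.mkQ_surjective _) hq
          rw [Module.support_eq_zeroLocus, Ideal.annihilator_quotient] at this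
          exact this
        have h2 : x ∈ q.asIdeal := by
          rw [Module.mem_support_iff_exists_annihilator] at hq
          obtain ⟨m, hm⟩ := hq
          apply hm
          rw [Submodule.mem_annihilator_span_singleton]
          obtain ⟨m, rfl⟩ := Submodule.mkQ_surjective _ m
          rw [← map_smul, Submodule.mkQ_apply, Submodule.Quotient.mk_eq_zero]
          exact ⟨m, rfl⟩
        have h3 : p < q := lt_of_le_of_ne h1 fun h => hxp (h ▸ h2)
        exact ih q h3 fun q' hq' => h q' (h1.trans hq')
      obtain ⟨δ, e₁, e₂, e₃⟩ := TCoh.exists_connecting (J := J) φ (LinearMap.range φ).mkQ hinj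
        (Submodule.mkQ_surjective _) (LinearMap.exact_map_mkQ_range φ)
      intro i
      have htors : ∀ z : TCoh J i (R ⧸ p.asIdeal), ∃ n, x ^ n • z = 0 := fun z => by
        obtain ⟨n, hn⟩ := TCoh.exists_pow_smul_eq_zero z
        exact ⟨n, hn _ (Ideal.pow_mem_pow hxJ n)⟩
      have hker : IsArtinian R
          (LinearMap.ker (LinearMap.lsmul R (TCoh J i (R ⧸ p.asIdeal)) x)) := by
        rcases i with _ | i
        · have : Subsingleton (LinearMap.ker (LinearMap.lsmul R (TCoh J 0 (R ⧸ p.asIdeal)) x)) := by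
            have : ∀ z ∈ LinearMap.ker (LinearMap.lsmul R (TCoh J 0 (R ⧸ p.asIdeal)) x), z = 0 := by
              intro z hz
              apply TCoh.eval_injective
              apply hinj
              rw [map_zero, hφ, LinearMap.smul_apply, LinearMap.id_apply, ← map_smul]
              rw [LinearMap.mem_ker, LinearMap.lsmul_apply] at hz
              rw [hz, map_zero, map_zero]
            exact ⟨fun a b => Subtype.ext (by rw [this _ a.2, this _ b.2])⟩
          infer_instance
        · have := hC i
          have : IsArtinian R (LinearMap.range (δ i)) :=
            isArtinian_of_surjective _ (δ i).rangeRestrict (δ i).surjective_rangeRestrict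
          refine isArtinian_of_le (t := LinearMap.range (δ i)) fun z hz => ?_
          refine (e₃ i z).1 ?_
          rw [hφ, TCoh.map_smul_id]
          simpa using hz
      exact isArtinian_of_ker_smul x _ htors

/-- Torsion cohomology of a finite module supported, along `J`, at maximal ideals is Artinian. -/
theorem TCoh.isArtinian (J : Ideal R) (M : Type) [AddCommGroup M] [Module R M] [Module.Finite R M]
    (h : ∀ q ∈ Module.support R M, J ≤ q.asIdeal → q.asIdeal.IsMaximal) (i : ℕ) :
    IsArtinian R (TCoh J i M) :=
  TCoh.isArtinian_of_support J M (fun p hp => TCoh.isArtinian_quotient_prime J p fun q hq =>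
    h q (Module.mem_support_mono hq hp)) i

end Artinian

section Dimension

variable {R : Type} [CommRing R]

lemma ringKrullDim_quotient_le_sup_span_singleton_add_one [IsNoetherianRing R] [IsLocalRing R]
    (I : Ideal R) {x : R} (hx : x ∈ maximalIdeal R) :
    ringKrullDim (R ⧸ I) ≤ ringKrullDim (R ⧸ (I ⊔ Ideal.span {x})) + 1 := by
  have h := ringKrullDim_le_ringKrullDim_quotient_add_card (R := R ⧸ I) {Ideal.Quotient.mk I x} (by
    rw [Finset.coe_singleton, Set.singleton_subset_iff]
    rcases subsingleton_or_nontrivial (R ⧸ I) with hI | hI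
    · rw [Subsingleton.elim (Ideal.Quotient.mk I x) 0]; exact zero_mem _
    · have : IsLocalRing (R ⧸ I) := .of_surjective' _ Ideal.Quotient.mk_surjective
      rw [IsLocalRing.ringJacobson_eq_maximalIdeal]
      have : IsLocalHom (Ideal.Quotient.mk I) :=
        (Ideal.Quotient.mk_surjective (I := I)).isLocalHom
      exact map_mem_nonunits_iff (Ideal.Quotient.mk I) x |>.2 hx)
  rw [Finset.coe_singleton, Finset.card_singleton] at h
  have e : (R ⧸ I) ⧸ Ideal.span {Ideal.Quotient.mk I x} ≃+* R ⧸ (I ⊔ Ideal.span {x}) :=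
    (Ideal.quotEquivOfEq (by rw [Ideal.map_span, Set.image_singleton])).trans
      (DoubleQuot.quotQuotEquivQuotSup I (Ideal.span {x}))
  rw [ringKrullDim_eq_of_ringEquiv e] at h
  exact_mod_cast h

lemma ringKrullDim_quotient_le_length [IsNoetherianRing R] [IsLocalRing R] (l : List R)
    (hl : ∀ x ∈ l, x ∈ maximalIdeal R) (I : Ideal R)
    (h : ∀ q : PrimeSpectrum R, I ≤ q.asIdeal → Ideal.ofList l ≤ q.asIdeal → q.asIdeal.IsMaximal) :
    ringKrullDim (R ⧸ I) ≤ l.length := by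
  induction l generalizing I with
  | nil =>
    have : Ring.KrullDimLE 0 (R ⧸ I) := by
      rw [Ideal.krullDimLE_zero_quotient_iff_forall_minimalPrimes_isMaximal]
      intro q hq
      exact h ⟨q, hq.1.1⟩ hq.1.2 (by simp)
    exact Order.KrullDimLE.krullDim_le
  | cons x l ih =>
    refine (ringKrullDim_quotient_le_sup_span_singleton_add_one I (hl x (by simp))).trans ?_
    have := ih (fun y hy => hl y (by simp [hy])) (I ⊔ Ideal.span {x}) fun q h1 h2 =>
      h q (le_sup_left.trans h1) (by
        rw [Ideal.ofList_cons]; exact sup_le (le_sup_right.trans h1) h2)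
    rw [List.length_cons]
    push_cast
    gcongr

lemma ringKrullDim_quotient_lt_of_forall_isPrime (I : Ideal R) (d : ℕ) (hd : d ≠ 0)
    (h : ∀ P : PrimeSpectrum R, I ≤ P.asIdeal → ringKrullDim (R ⧸ P.asIdeal) < d) :
    ringKrullDim (R ⧸ I) < d := by
  obtain ⟨d, rfl⟩ := Nat.exists_eq_succ_of_ne_zero hd
  have le_of_lt : ∀ a : WithBot ℕ∞, a < (d + 1 : ℕ) ↔ a ≤ d := by
    intro a
    induction a with
    | bot => simp
    | coe a =>
      induction a with
      | top =>
        simp only [WithBot.coe_top]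
        constructor
        · intro h; exact absurd h (by simp)
        · intro h
          have : ((⊤ : ℕ∞) : WithBot ℕ∞) ≤ ((d : ℕ∞) : WithBot ℕ∞) := h
          rw [WithBot.coe_le_coe] at this
          simp at this
      | coe a => norm_cast; exact Nat.lt_succ_iff
  rw [le_of_lt, ringKrullDim_quotient]
  refine iSup_le fun s => ?_
  have := h s.head.1 s.head.2
  rw [le_of_lt, ringKrullDim_quotient] at this
  refine le_trans ?_ this
  exact le_iSup (fun p : LTSeries (PrimeSpectrum.zeroLocus (s.head.1.asIdeal : Set R)) =>
    ((p.length : ℕ∞) : WithBot ℕ∞))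
      ⟨s.length, fun i => ⟨(s i).1, s.monotone (Fin.zero_le i)⟩, s.step⟩

end Dimension

theorem TCoh.isArtinian_powTorsion {R : Type} [CommRing R] [IsNoetherianRing R] (x : R)
    (J' J : Ideal R) (hJ : J = J' ⊔ Ideal.span {x}) (M : Type) [AddCommGroup M] [Module R M]
    (hM : Function.Injective (LocalizedModule.mkLinearMap (Submonoid.powers x) M))
    (h : ∀ i, IsArtinian R (TCoh J i M)) (i : ℕ) :
    IsArtinian R (powTorsion (Ideal.span {x}) (TCoh J' i M)) := by
  have hxJ : x ∈ J := hJ ▸ Ideal.mem_sup_right (Ideal.mem_span_singleton_self x)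
  have hbij : ∀ i n, Function.Injective
      fun z : TCoh J' i (LocalizedModule (Submonoid.powers x) M) => x ^ n • z := by
    intro i n z w hzw
    induction n with
    | zero => simpa using hzw
    | succ n ih =>
      refine ih ?_
      simp only [pow_succ', mul_smul] at hzw
      let e := LinearEquiv.ofBijective (x • LinearMap.id :
        LocalizedModule (Submonoid.powers x) M →ₗ[R] _) (LocCoker.smul_bijective x M)
      apply (TCoh.congr (J := J') i e).injective
      have : ∀ z, TCoh.congr (J := J') i e z = x • z := fun z => TCoh.map_smul_id i x z
      rw [this, this]
      exact hzw
  have hzero : ∀ i, ∀ z ∈ powTorsion (Ideal.span {x}) (TCoh J' i M),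
      TCoh.map J' i (LocalizedModule.mkLinearMap (Submonoid.powers x) M) z = 0 := by
    intro i z hz
    obtain ⟨n, hn⟩ := mem_powTorsion_span_singleton.1 hz
    apply hbij i n
    simp only
    rw [← map_smul, hn, map_zero, smul_zero]
  rcases i with _ | i
  · have : Subsingleton (powTorsion (Ideal.span {x}) (TCoh J' 0 M)) := by
      have : ∀ z ∈ powTorsion (Ideal.span {x}) (TCoh J' 0 M), z = 0 := by
        intro z hz
        apply TCoh.eval_injective
        apply hM
        rw [← TCoh.eval_map, hzero 0 z hz, map_zero, map_zero, map_zero]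
      exact ⟨fun a b => Subtype.ext (by rw [this _ a.2, this _ b.2])⟩
    infer_instance
  · obtain ⟨δ, e₁, e₂, e₃⟩ := TCoh.exists_connecting (J := J')
      (LocalizedModule.mkLinearMap (Submonoid.powers x) M) (Submodule.mkQ _) hM
      (Submodule.mkQ_surjective _) (LinearMap.exact_map_mkQ_range _)
    obtain ⟨a⟩ := TCoh.nonempty_equiv_of_torsion hJ i (LocCoker.powTorsion_eq_top x M)
    obtain ⟨b⟩ := TCoh.nonempty_equiv_locCoker hxJ i hM
    have := h (i + 1)
    have h1 : IsArtinian R (TCoh J' i (LocCoker x M)) :=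
      isArtinian_of_surjective _ (b.symm.trans a).toLinearMap (b.symm.trans a).surjective
    have : IsArtinian R (LinearMap.range (δ i)) :=
      isArtinian_of_surjective (TCoh J' i (LocCoker x M)) (δ i).rangeRestrict
        (δ i).surjective_rangeRestrict
    exact isArtinian_of_le (t := LinearMap.range (δ i)) fun z hz => (e₃ i z).1 (hzero _ z hz)

section KeyTheorem

variable {R : Type} [CommRing R]

/-- `a` lies in all limit closures of the powers of the sequence `l` in `M`. -/
def InLimits {M : Type} [AddCommGroup M] [Module R M] (l : List R) (a : M) : Prop :=
  ∀ n, ∃ t, l.prod ^ t • a ∈ powSpan M l (n + t)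

lemma InLimits.map {M N : Type} [AddCommGroup M] [Module R M] [AddCommGroup N] [Module R N]
    {l : List R} {a : M} (h : InLimits l a) (f : M →ₗ[R] N) : InLimits l (f a) := fun n => by
  obtain ⟨t, ht⟩ := h n
  exact ⟨t, by rw [← map_smul]; exact map_mem_powSpan f ht⟩

/-- If the `x`-power torsion of the limit `G` of the tail is Artinian, then some multiple
`x ^ c • a` of an element in all limit closures is, modulo each power of `x`, in all limit
closures of the tail. -/
lemma InLimits.exists_pow_smul {M : Type} [AddCommGroup M] [Module R M] {x : R} {l : List R}
    {a : M} (ha : InLimits (x :: l) a) {G : Type} [AddCommGroup G] [Module R G]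
    (E : LimitPresentation l M G) [IsArtinian R (powTorsion (Ideal.span {x}) G)] :
    ∃ c, ∀ n, InLimits l ((LinearMap.range (LinearMap.lsmul R M (x ^ n))).mkQ (x ^ c • a)) := by
  set G₀ := powTorsion (Ideal.span {x}) G with hG₀
  obtain ⟨c, hc⟩ := IsArtinian.monotone_stabilizes
    (⟨fun n => OrderDual.toDual (LinearMap.range (LinearMap.lsmul R G₀ (x ^ n))), fun i j h => by
      rintro _ ⟨z, rfl⟩
      refine ⟨x ^ (j - i) • z, ?_⟩
      simp only [LinearMap.lsmul_apply]
      rw [smul_smul, ← pow_add, Nat.add_sub_cancel' h]⟩ : ℕ →o (Submodule R G₀)ᵒᵈ)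
  have hA : ∀ n, ∃ g₀ ∈ G₀, ∃ g, E.e n a = g₀ + x ^ n • g := by
    intro n
    obtain ⟨t, ht⟩ := ha n
    obtain ⟨m, w, hw, h⟩ := mem_powSpan_cons.1 ht
    refine ⟨E.e n a - x ^ n • E.e (n + t) m, ?_, E.e (n + t) m, by abel⟩
    rw [hG₀, mem_powTorsion_span_singleton]
    refine ⟨t, ?_⟩
    have h1 : E.e (n + t) w = 0 := (E.eq_zero_iff _ _).2 ⟨0, by simpa using hw⟩
    have h2 := congrArg (E.e (n + t)) h
    rw [map_add, h1, add_zero, map_smul, List.prod_cons, mul_pow, mul_smul, map_smul,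
      E.step_pow] at h2
    rw [smul_sub, ← h2, smul_smul, ← pow_add, add_comm t n, sub_self]
  have hB : ∀ k n, ∃ g₀ ∈ G₀, ∃ g, E.e k a = g₀ + x ^ n • g := by
    intro k n
    rcases le_total n k with h | h
    · obtain ⟨g₀, h0, g, hg⟩ := hA k
      refine ⟨g₀, h0, x ^ (k - n) • g, ?_⟩
      rw [smul_smul, ← pow_add, Nat.add_sub_cancel' h, hg]
    · obtain ⟨g₀, h0, g, hg⟩ := hA n
      refine ⟨l.prod ^ (n - k) • g₀, G₀.smul_mem _ h0, l.prod ^ (n - k) • g, ?_⟩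
      rw [smul_comm (x ^ n), ← smul_add, ← hg, ← map_smul]
      conv_rhs => rw [← Nat.add_sub_cancel' h]
      rw [Nat.add_sub_cancel_left, E.step_pow]
  have hC : ∀ k n, ∃ g, E.e k (x ^ c • a) = x ^ n • g := by
    intro k n
    obtain ⟨g₀, h0, g, hg⟩ := hB k n
    have h1 : x ^ c • (⟨g₀, h0⟩ : G₀) ∈ LinearMap.range (LinearMap.lsmul R G₀ (x ^ (n + c))) := by
      have := congrArg OrderDual.ofDual (hc (n + c) (Nat.le_add_left _ _))
      exact this.le ⟨_, rfl⟩
    obtain ⟨y, hy⟩ := h1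
    have hy := congrArg Subtype.val hy
    simp only [LinearMap.lsmul_apply, Submodule.coe_smul] at hy
    refine ⟨x ^ c • (y : G) + x ^ c • g, ?_⟩
    rw [map_smul, hg, smul_add, ← hy, smul_add, smul_comm (x ^ c) (x ^ n) g, pow_add, mul_smul]
  refine ⟨c, fun n k => ?_⟩
  obtain ⟨g, hg⟩ := hC k n
  obtain ⟨s, m, rfl⟩ := E.surj g
  rw [← E.step_pow s k, add_comm s k, ← E.step_pow k s, ← map_smul, ← sub_eq_zero, ← map_sub,
    E.eq_zero_iff] at hg
  obtain ⟨t, ht⟩ := hg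
  refine ⟨s + t, ?_⟩
  have := map_mem_powSpan (LinearMap.range (LinearMap.lsmul R M (x ^ n))).mkQ ht
  have h0 : (LinearMap.range (LinearMap.lsmul R M (x ^ n))).mkQ (x ^ n • l.prod ^ k • m) = 0 := by
    rw [Submodule.mkQ_apply, Submodule.Quotient.mk_eq_zero]
    exact ⟨_, rfl⟩
  rw [map_smul, map_sub, h0, sub_zero, map_smul, smul_smul, ← pow_add, add_assoc] at this
  rwa [add_comm t s] at this

variable [IsNoetherianRing R] [IsLocalRing R]

/-- Elements in all limit closures of the powers of a multiplicity sequence of length `d` generate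
submodules of dimension less than `d`. -/
theorem ringKrullDim_lt_of_inLimits (l : List R) (hl : ∀ x ∈ l, x ∈ maximalIdeal R) (M : Type)
    [AddCommGroup M] [Module R M] [Module.Finite R M]
    (hM : ∀ q ∈ Module.support R M, Ideal.ofList l ≤ q.asIdeal → q.asIdeal.IsMaximal)
    (a : M) (ha : InLimits l a) (P : PrimeSpectrum R)
    (hP : ∀ r : R, r • a = 0 → r ∈ P.asIdeal) :
    ringKrullDim (R ⧸ P.asIdeal) < l.length := by
  induction l generalizing M a P with
  | nil =>
    obtain ⟨t, ht⟩ := ha 0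
    have : a = 0 := by simpa [powSpan] using ht
    exact absurd (hP 1 (by simp [this])) (fun h => P.2.ne_top ((Ideal.eq_top_iff_one _).2 h))
  | cons x l ih =>
    have hsupp : ∀ (N : Type) [AddCommGroup N] [Module R N] [Module.Finite R N] (b : N)
        (Q : PrimeSpectrum R), (∀ r : R, r • b = 0 → r ∈ Q.asIdeal) → Q ∈ Module.support R N := by
      intro N _ _ _ b Q h
      rw [Module.mem_support_iff_exists_annihilator]
      exact ⟨b, fun r hr => h r (by simpa using hr)⟩
    have hxP : x ∈ P.asIdeal → ringKrullDim (R ⧸ P.asIdeal) < (x :: l).length := by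
      intro hx
      refine (ringKrullDim_quotient_le_length l (fun y hy => hl y (by simp [hy])) P.asIdeal
        fun q h1 h2 => hM q (Module.mem_support_mono h1 (hsupp M a P hP)) ?_).trans_lt ?_
      · rw [Ideal.ofList_cons, sup_le_iff, Ideal.span_singleton_le_iff_mem]
        exact ⟨h1 hx, h2⟩
      · rw [List.length_cons]; exact_mod_cast Nat.lt_succ_self _
    by_cases hx : x ∈ P.asIdeal
    · exact hxP hx
    set M' := M ⧸ powTorsion (Ideal.span {x}) M with hM'
    set a' : M' := (powTorsion (Ideal.span {x}) M).mkQ a with ha'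
    have hinl : InLimits (x :: l) a' := ha.map _
    have hM'supp : ∀ q ∈ Module.support R M', Ideal.ofList (x :: l) ≤ q.asIdeal →
        q.asIdeal.IsMaximal := fun q hq =>
      hM q (Module.support_subset_of_surjective _ (Submodule.mkQ_surjective _) hq)
    have hart := TCoh.isArtinian_powTorsion x (Ideal.ofList l) (Ideal.ofList (x :: l))
      (by rw [Ideal.ofList_cons, sup_comm]) M' (mkLinearMap_quotient_injective x M)
      (TCoh.isArtinian _ M' hM'supp) l.length
    obtain ⟨-, ⟨E⟩⟩ := TCoh.eq_zero_and_nonempty_limitPresentation l M'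
    obtain ⟨c, hc⟩ := hinl.exists_pow_smul E
    have hPb : ∀ r : R, r • x ^ c • a' = 0 → r ∈ P.asIdeal := by
      intro r hr
      rw [ha', ← map_smul, ← map_smul, Submodule.mkQ_apply, Submodule.Quotient.mk_eq_zero,
        mem_powTorsion_span_singleton] at hr
      obtain ⟨k, hk⟩ := hr
      rw [smul_smul, smul_smul] at hk
      have := hP _ hk
      rw [P.2.mul_mem_iff_mem_or_mem, P.2.mul_mem_iff_mem_or_mem] at this
      rcases this with (h | h) | h
      · exact absurd (P.2.mem_of_pow_mem _ h) hx
      · exact h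
      · exact absurd (P.2.mem_of_pow_mem _ h) hx
    obtain ⟨k, hk⟩ := Ideal.exists_pow_inf_eq_pow_smul (Ideal.span {x})
      (Submodule.span R {x ^ c • a'})
    have hAR := hk (k + 1) (Nat.le_succ k)
    have hQ : ∀ Q : PrimeSpectrum R, P.asIdeal ⊔ Ideal.span {x} ≤ Q.asIdeal →
        ringKrullDim (R ⧸ Q.asIdeal) < l.length := by
      intro Q hQ
      refine ih (fun y hy => hl y (by simp [hy]))
        (M' ⧸ LinearMap.range (LinearMap.lsmul R M' (x ^ (k + 1)))) ?_ _ (hc (k + 1)) Q ?_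
      · intro q hq hlq
        refine hM'supp q (Module.support_subset_of_surjective _ (Submodule.mkQ_surjective _) hq) ?_
        rw [Ideal.ofList_cons, sup_le_iff, Ideal.span_singleton_le_iff_mem]
        refine ⟨q.2.mem_of_pow_mem (k + 1) ?_, hlq⟩
        rw [Module.mem_support_iff_exists_annihilator] at hq
        obtain ⟨m, hm⟩ := hq
        apply hm
        rw [Submodule.mem_annihilator_span_singleton]
        obtain ⟨m, rfl⟩ := Submodule.mkQ_surjective _ m
        rw [← map_smul, Submodule.mkQ_apply, Submodule.Quotient.mk_eq_zero]
        exact ⟨m, rfl⟩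
      · intro r hr
        rw [← map_smul, Submodule.mkQ_apply, Submodule.Quotient.mk_eq_zero] at hr
        obtain ⟨m, hm⟩ := hr
        have h1 : r • x ^ c • a' ∈ (Ideal.span {x} ^ (k + 1) • ⊤ : Submodule R M') ⊓
            Submodule.span R {x ^ c • a'} := by
          refine ⟨?_, Submodule.smul_mem _ _ (Submodule.mem_span_singleton_self _)⟩
          rw [← hm, Ideal.span_singleton_pow]
          exact Submodule.smul_mem_smul (Ideal.mem_span_singleton_self _) trivial
        rw [hAR, Nat.add_sub_cancel_left, pow_one] at h1
        have h2 := Submodule.smul_mono (le_refl (Ideal.span {x})) inf_le_right h1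
        rw [Submodule.ideal_span_singleton_smul] at h2
        obtain ⟨z, hz, hz'⟩ := Submodule.mem_smul_pointwise_iff_exists _ _ _ |>.1 h2
        obtain ⟨s, rfl⟩ := Submodule.mem_span_singleton.1 hz
        have h3 : r - x * s ∈ P.asIdeal := hPb _ (by rw [sub_smul, mul_smul, hz', sub_self])
        have h4 := Q.asIdeal.add_mem (hQ (Ideal.mem_sup_left h3))
          (Q.asIdeal.mul_mem_right s (hQ (Ideal.mem_sup_right (Ideal.mem_span_singleton_self x))))
        simpa using h4
    rcases Nat.eq_zero_or_pos l.length with h0 | hpos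
    · have hle : P.asIdeal ⊔ Ideal.span {x} ≤ maximalIdeal R :=
        sup_le (le_maximalIdeal P.2.ne_top)
          ((Ideal.span_singleton_le_iff_mem _).2 (hl x (by simp)))
      have := hQ ⟨maximalIdeal R, inferInstance⟩ hle
      rw [h0] at this
      have h0 : (0 : WithBot ℕ∞) ≤ ringKrullDim (R ⧸ maximalIdeal R) :=
        ringKrullDim_nonneg_of_nontrivial
      exact absurd this (not_lt.2 h0)
    · have h1 := ringKrullDim_quotient_lt_of_forall_isPrime _ l.length hpos.ne' hQ
      refine (ringKrullDim_quotient_le_sup_span_singleton_add_one P.asIdeal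
        (hl x (by simp))).trans_lt ?_
      rw [List.length_cons, Nat.cast_add, Nat.cast_one]
      generalize ringKrullDim (R ⧸ (P.asIdeal ⊔ Ideal.span {x})) = u at h1
      induction u with
      | bot => exact WithBot.bot_lt_coe _
      | coe u =>
        have : u ≠ ⊤ := by rintro rfl; simp at h1
        lift u to ℕ using this
        norm_cast at h1 ⊢
        omega

end KeyTheorem

section CompletionNoetherian

lemma AdicCompletion.apply_sub_apply_mem {A : Type} [CommRing A] {K : Ideal A}
    (f : AdicCompletion.AdicCauchySequence K A) {m n : ℕ} (h : m ≤ n) : f m - f n ∈ K ^ m := by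
  have := f.2 h
  rw [SModEq.sub_mem] at this
  simpa using this

theorem AdicCompletion.exists_surjective_of_surjective {A R : Type} [CommRing A] [CommRing R]
    (K : Ideal A) (I : Ideal R) (φ : A →+* R) (hφ : Function.Surjective φ) (hI : K.map φ = I) :
    ∃ Φ : AdicCompletion K A →+* AdicCompletion I R, Function.Surjective Φ := by
  have hpow : ∀ n, (K ^ n).map φ = I ^ n := fun n => by rw [Ideal.map_pow, hI]
  let f : ∀ n, AdicCompletion K A →+* R ⧸ I ^ n := fun n =>
    (Ideal.quotientMap (I ^ n) φ (Ideal.map_le_iff_le_comap.1 (hpow n).le)).comp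
      (AdicCompletion.evalₐ K n : AdicCompletion K A →+* A ⧸ K ^ n)
  have hf_mk : ∀ n (a : AdicCompletion.AdicCauchySequence K A),
      f n (AdicCompletion.mk K A a) = Ideal.Quotient.mk (I ^ n) (φ (a n)) := by
    intro n a
    simp only [f, RingHom.comp_apply, RingHom.coe_coe]
    rw [AdicCompletion.evalₐ_mk, Ideal.quotientMap_mk]
  have hf : ∀ {m n : ℕ} (hle : m ≤ n), (Ideal.Quotient.factorPow I hle).comp (f n) = f m := by
    intro m n hle
    ext x
    induction x using AdicCompletion.induction_on with
    | _ a =>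
    rw [RingHom.comp_apply, hf_mk, hf_mk]
    change Ideal.Quotient.mk (I ^ m) (φ (a n)) = _
    rw [eq_comm, Ideal.Quotient.mk_eq_mk_iff_sub_mem, ← map_sub, ← hpow]
    exact Ideal.mem_map_of_mem _ (AdicCompletion.apply_sub_apply_mem a hle)
  refine ⟨AdicCompletion.liftRingHom I f hf, fun y => ?_⟩
  induction y using AdicCompletion.induction_on with
  | _ r =>
  have hstep : ∀ n (a : {a : A // φ a = r n}), ∃ b : {b : A // φ b = r (n + 1)},
      (a : A) - b ∈ K ^ n := by
    rintro n ⟨a, ha⟩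
    have := AdicCompletion.apply_sub_apply_mem r (Nat.le_succ n)
    rw [← hpow, Ideal.mem_map_iff_of_surjective _ hφ] at this
    obtain ⟨k, hk, h⟩ := this
    exact ⟨⟨a - k, by rw [map_sub, ha, h, sub_sub_cancel]⟩, by simpa using hk⟩
  choose step hs using hstep
  obtain ⟨a₀, h₀⟩ := hφ (r 0)
  let a : ∀ n, {a : A // φ a = r n} := fun n => Nat.rec ⟨a₀, h₀⟩ step n
  refine ⟨AdicCompletion.mk K A (AdicCompletion.AdicCauchySequence.mk K A (fun n => (a n).1)
    fun n => ?_), ?_⟩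
  · rw [SModEq.sub_mem, smul_eq_mul, Ideal.mul_top]
    exact hs n (a n)
  · refine AdicCompletion.ext_evalₐ fun n => ?_
    rw [AdicCompletion.evalₐ_liftRingHom, hf_mk, AdicCompletion.evalₐ_mk]
    exact congrArg _ (a n).2

theorem AdicCompletion.isNoetherianRing_self {R : Type} [CommRing R] [IsNoetherianRing R]
    (I : Ideal R) : IsNoetherianRing (AdicCompletion I R) := by
  obtain ⟨s, hs⟩ := IsNoetherian.noetherian I
  let φ : MvPolynomial s R →+* R := (MvPolynomial.aeval (fun i : s => (i : R))).toRingHom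
  have hφ : Function.Surjective φ := fun r => ⟨MvPolynomial.C r, by simp [φ]⟩
  have hI : (MvPolynomial.idealOfVars s R).map φ = I := by
    rw [MvPolynomial.idealOfVars, Ideal.map_span, ← hs]
    congr 1
    ext x
    simp [φ]
  obtain ⟨Φ, hΦ⟩ := AdicCompletion.exists_surjective_of_surjective _ I φ hφ hI
  have := isNoetherianRing_of_ringEquiv _ (MvPowerSeries.toAdicCompletionAlgEquiv s R).toRingEquiv
  exact isNoetherianRing_of_surjective _ _ Φ hΦ

end CompletionNoetherian

section SystemOfParameters

theorem exists_systemOfParameters (R : Type) [CommRing R] [IsNoetherianRing R] [IsLocalRing R]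
    {d : ℕ} (hd : ringKrullDim R = (d : WithBot ℕ∞)) :
    ∃ l : List R, l.length = d ∧ (Ideal.ofList l).radical = maximalIdeal R := by
  obtain ⟨s, hs, hcard⟩ := (maximalIdeal R).exists_finset_card_eq_height_of_isNoetherianRing
  refine ⟨s.toList, ?_, ?_⟩
  · rw [Finset.length_toList]
    have := maximalIdeal_height_eq_ringKrullDim (R := R)
    rw [hd, ← hcard] at this
    exact_mod_cast this
  · have h : Ideal.ofList s.toList = Ideal.span (s : Set R) := by
      rw [Ideal.ofList]
      congr 1
      ext
      simp
    rw [h, ← Ideal.sInf_minimalPrimes]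
    refine le_antisymm (sInf_le hs) (le_sInf fun q hq => ?_)
    exact hs.2 ⟨hq.1.1, hq.1.2⟩ (le_maximalIdeal hq.1.1.ne_top)

variable {R : Type} [CommRing R]

lemma isMaximal_of_ofList_le [IsLocalRing R] {l : List R}
    (h : (Ideal.ofList l).radical = maximalIdeal R) (q : PrimeSpectrum R)
    (hq : Ideal.ofList l ≤ q.asIdeal) : q.asIdeal.IsMaximal := by
  have : maximalIdeal R ≤ q.asIdeal := h ▸ q.2.isRadical.radical_le_iff.2 hq
  rw [← (maximalIdeal.isMaximal R).eq_of_le q.2.ne_top this]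
  exact maximalIdeal.isMaximal R

lemma mem_maximalIdeal_of_mem [IsLocalRing R] {l : List R}
    (h : (Ideal.ofList l).radical = maximalIdeal R) : ∀ x ∈ l, x ∈ maximalIdeal R := fun _ hx =>
  h ▸ Ideal.le_radical (Ideal.subset_span hx)

lemma radical_ofList_map [IsLocalRing R] [IsNoetherianRing R] {S : Type} [CommRing S]
    [IsLocalRing S] {l : List R} (h : (Ideal.ofList l).radical = maximalIdeal R) (φ : R →+* S)
    (hφ : (maximalIdeal R).map φ = maximalIdeal S) :
    (Ideal.ofList (l.map φ)).radical = maximalIdeal S := by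
  rw [← Ideal.map_ofList]
  refine le_antisymm ?_ ?_
  · rw [(maximalIdeal.isMaximal S).isPrime.isRadical.radical_le_iff, ← hφ, ← h]
    exact Ideal.map_mono Ideal.le_radical
  · rw [← hφ, ← h]
    exact Ideal.map_radical_le φ

lemma pow_mem_powSpan {x : R} {l : List R} (hx : x ∈ l) (n : ℕ) : x ^ n ∈ powSpan R l n := by
  induction l with
  | nil => simp at hx
  | cons y l ih =>
    rcases List.mem_cons.1 hx with rfl | hx
    · exact mem_powSpan_cons.2 ⟨1, 0, zero_mem _, by simp⟩
    · exact mem_powSpan_cons.2 ⟨0, _, ih hx, by simp⟩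

lemma exists_maximalIdeal_pow_le_powSpan [IsLocalRing R] [IsNoetherianRing R] {l : List R}
    (h : (Ideal.ofList l).radical = maximalIdeal R) (n : ℕ) :
    ∃ N, maximalIdeal R ^ N ≤ powSpan R l n := by
  have hle : maximalIdeal R ≤ Ideal.radical (powSpan R l n) := by
    rw [← h, Ideal.radical_le_radical_iff, Ideal.ofList, Ideal.span_le]
    exact fun x hx => ⟨n, pow_mem_powSpan hx n⟩
  exact Ideal.exists_pow_le_of_le_radical_of_fg hle (IsNoetherian.noetherian _)

lemma mem_powSpan_map {A : Type} [CommRing A] [Algebra R A] {M : Type} [AddCommGroup M]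
    [Module R M] [Module A M] [IsScalarTower R A M] {l : List R} {n : ℕ} {m : M} :
    m ∈ powSpan M (l.map (algebraMap R A)) n ↔ m ∈ powSpan M l n := by
  induction l generalizing m with
  | nil => simp [powSpan]
  | cons x l ih =>
    rw [List.map_cons, mem_powSpan_cons, mem_powSpan_cons]
    simp only [ih, ← map_pow, algebraMap_smul]

lemma inLimits_map_iff {A : Type} [CommRing A] [Algebra R A] {M : Type} [AddCommGroup M]
    [Module R M] [Module A M] [IsScalarTower R A M] {l : List R} {m : M} :
    InLimits (l.map (algebraMap R A)) m ↔ InLimits l m := by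
  simp only [InLimits, mem_powSpan_map, ← map_list_prod, ← map_pow, algebraMap_smul]

/-- If a Noetherian local ring has dimension smaller than the number of elements of a list
generating an ideal primary to the maximal ideal, then `1` lies in all limit closures. -/
theorem inLimits_one_of_ringKrullDim_lt [IsLocalRing R] [IsNoetherianRing R] {l : List R}
    (h : (Ideal.ofList l).radical = maximalIdeal R) (hl : ringKrullDim R < l.length) :
    InLimits l (1 : R) := by
  obtain ⟨e, he⟩ : ∃ e : ℕ, ringKrullDim R = (e : WithBot ℕ∞) := by
    have h1 := ringKrullDim_ne_top (R := R)
    have h2 := ringKrullDim_ne_bot (R := R)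
    generalize ringKrullDim R = x at *
    induction x with
    | bot => exact absurd rfl h2
    | coe x =>
      induction x with
      | top => exact absurd rfl h1
      | coe x => exact ⟨x, rfl⟩
  obtain ⟨l', rfl, hl'⟩ := exists_systemOfParameters R he
  rw [he] at hl
  have hlt : l'.length < l.length := by exact_mod_cast hl
  have h0 := (TCoh.eq_zero_and_nonempty_limitPresentation l' R).1 _ hlt
  obtain ⟨u⟩ := nonempty_equiv_LC (Ideal.ofList l') l.length R
  obtain ⟨E⟩ := nonempty_limitPresentation_LC (Ideal.ofList l') l (h.trans hl'.symm) R
  intro n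
  rw [← E.eq_zero_iff]
  obtain ⟨z, hz⟩ := u.surjective (E.e n 1)
  rw [← hz, h0 z, map_zero]

end SystemOfParameters

section LimitClosures

variable {R : Type} [CommRing R]

namespace LimitPresentation

variable {l : List R} {H : Type} [AddCommGroup H] [Module R H] (E : LimitPresentation l R H)

lemma e_apply (n : ℕ) (r : R) : E.e n r = r • E.e n 1 := by
  rw [← map_smul, smul_eq_mul, mul_one]

lemma ker_antitone : Antitone fun n => LinearMap.ker (E.e n) :=
  antitone_nat_of_succ_le fun n r hr => by
    rw [LinearMap.mem_ker] at hr ⊢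
    rw [← E.step n, map_smul, hr, smul_zero]

lemma span_monotone : Monotone fun n => R ∙ E.e n (1 : R) :=
  monotone_nat_of_le_succ fun n => by
    rw [Submodule.span_singleton_le_iff_mem, ← E.step n, map_smul]
    exact Submodule.mem_span_singleton.2 ⟨_, rfl⟩

lemma exists_le_span_of_fg {N : Submodule R H} (hN : N.FG) : ∃ n, N ≤ R ∙ E.e n (1 : R) := by
  induction N, hN using Submodule.fg_induction with
  | singleton m =>
    obtain ⟨n, r, rfl⟩ := E.surj m
    refine ⟨n, ?_⟩
    rw [Submodule.span_singleton_le_iff_mem, E.e_apply n r]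
    exact Submodule.mem_span_singleton.2 ⟨_, rfl⟩
  | sup N₁ N₂ _ _ h₁ h₂ =>
    obtain ⟨a, ha⟩ := h₁
    obtain ⟨b, hb⟩ := h₂
    exact ⟨max a b, sup_le (ha.trans (E.span_monotone (le_max_left a b)))
      (hb.trans (E.span_monotone (le_max_right a b)))⟩

lemma powSpan_le_ker (n : ℕ) : powSpan R l n ≤ LinearMap.ker (E.e n) := fun r hr =>
  LinearMap.mem_ker.2 ((E.eq_zero_iff n r).2 ⟨0, by simpa using hr⟩)

lemma powTorsion_eq_top (E : LimitPresentation l R H) [IsLocalRing R] [IsNoetherianRing R]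
    (h : (Ideal.ofList l).radical = maximalIdeal R) : powTorsion (maximalIdeal R) H = ⊤ := by
  rw [eq_top_iff]
  rintro z -
  obtain ⟨n, r, rfl⟩ := E.surj z
  obtain ⟨N, hN⟩ := exists_maximalIdeal_pow_le_powSpan h n
  refine ⟨N, fun s hs => ?_⟩
  rw [E.e_apply, smul_comm, ← E.e_apply, LinearMap.mem_ker.1 (E.powSpan_le_ker n (hN hs)),
    smul_zero]

end LimitPresentation

end LimitClosures

section CompletionSequences

variable {R : Type} [CommRing R]

lemma isArtinian_quotient_of_pow_le [IsNoetherianRing R] {J I : Ideal R} [J.IsMaximal] {N : ℕ}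
    (h : J ^ N ≤ I) : IsArtinian R (R ⧸ I) := by
  have := TCoh.isArtinian J (R ⧸ I) (fun q _ hq => by
    rwa [← ‹J.IsMaximal›.eq_of_le q.2.ne_top hq]) 0
  have htop : powTorsion J (R ⧸ I) = ⊤ := by
    rw [eq_top_iff]
    rintro y -
    obtain ⟨y, rfl⟩ := Submodule.Quotient.mk_surjective _ y
    refine ⟨N, fun r hr => ?_⟩
    rw [← Submodule.Quotient.mk_smul, smul_eq_mul,
      (Submodule.Quotient.mk_eq_zero I).2 (Ideal.mul_mem_right y _ (h hr))]
  exact isArtinian_of_linearEquiv ((TCoh.equivPowTorsion J (R ⧸ I)).trans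
    ((LinearEquiv.ofEq _ _ htop).trans Submodule.topEquiv))

lemma exists_le_sup_of_antitone [IsNoetherianRing R] {J : Ideal R} [J.IsMaximal] {q : ℕ → Ideal R}
    (hq : Antitone q) (j : ℕ) : ∃ ν, ∀ n, q ν ≤ q n ⊔ J ^ j := by
  have := isArtinian_quotient_of_pow_le (le_refl (J ^ j))
  obtain ⟨ν, hν⟩ := IsArtinian.monotone_stabilizes
    (⟨fun n => OrderDual.toDual (Submodule.map (J ^ j).mkQ (q n)), fun a b h =>
      Submodule.map_mono (hq h)⟩ : ℕ →o (Submodule R (R ⧸ J ^ j))ᵒᵈ)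
  refine ⟨ν, fun n => ?_⟩
  rcases le_total n ν with h | h
  · exact (hq h).trans le_sup_left
  · have h1 : Submodule.map (J ^ j).mkQ (q ν) = Submodule.map (J ^ j).mkQ (q n) :=
      congrArg OrderDual.ofDual (hν n h)
    intro x hx
    have h2 : (J ^ j).mkQ x ∈ Submodule.map (J ^ j).mkQ (q n) := h1 ▸ Submodule.mem_map_of_mem hx
    obtain ⟨y, hy, hxy⟩ := h2
    rw [← sub_eq_zero, ← map_sub, ← LinearMap.mem_ker, Submodule.ker_mkQ] at hxy
    exact Submodule.mem_sup.2 ⟨y, hy, x - y, neg_sub y x ▸ neg_mem hxy, by abel⟩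

/-- A weak form of Chevalley's lemma: a decreasing sequence of ideals that does not converge to
zero in the adic topology contains a nonzero adic limit. -/
theorem exists_adicCauchySequence [IsNoetherianRing R] {J : Ideal R} [J.IsMaximal]
    {q : ℕ → Ideal R} (hq : Antitone q) (k : ℕ) (hk : ∀ n, ¬ q n ≤ J ^ k) :
    ∃ a : AdicCompletion.AdicCauchySequence J R, a k ∉ J ^ k ∧ ∀ n, ∀ j ≥ n, a j ∈ q n := by
  choose ν hν using exists_le_sup_of_antitone (J := J) hq
  let n : ℕ → ℕ := fun j => ∑ i ∈ Finset.range (j + 1), ν i + j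
  have hn : ∀ j, ν j ≤ n j := fun j =>
    (Finset.single_le_sum (f := ν) (fun _ _ => Nat.zero_le _)
      (Finset.self_mem_range_succ j)).trans (Nat.le_add_right _ _)
  obtain ⟨b₀, hb₀, hb₀'⟩ := Set.not_subset.1 (hk (n k))
  have hstep : ∀ i (b : {b : R // b ∈ q (n (k + i))}),
      ∃ c : {c : R // c ∈ q (n (k + (i + 1)))}, (b : R) - c ∈ J ^ (k + i) := by
    rintro i ⟨b, hb⟩
    obtain ⟨c, hc, e, he, rfl⟩ := Submodule.mem_sup.1 (hν (k + i) (n (k + (i + 1)))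
      (hq (hn (k + i)) hb))
    exact ⟨⟨c, hc⟩, by simpa using he⟩
  choose step hs using hstep
  let b : ∀ i, {b : R // b ∈ q (n (k + i))} := fun i => Nat.rec ⟨b₀, hb₀⟩ step i
  let a : AdicCompletion.AdicCauchySequence J R :=
    AdicCompletion.AdicCauchySequence.mk J R (fun i => (b i).1) fun i => by
      rw [SModEq.sub_mem, smul_eq_mul, Ideal.mul_top]
      exact Ideal.pow_le_pow_right (Nat.le_add_left _ _) (hs i (b i))
  have ha : ∀ i, a 0 - a i ∈ J ^ k := by
    intro i
    induction i with
    | zero => simp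
    | succ i ih =>
      rw [← sub_add_sub_cancel _ (a i)]
      exact add_mem ih (Ideal.pow_le_pow_right (Nat.le_add_right _ _) (hs i (b i)))
  refine ⟨a, fun h => hb₀' ?_, fun m j hj => hq ?_ (b j).2⟩
  · have := add_mem (ha k) h
    rwa [sub_add_cancel] at this
  · simp only [n]
    omega

lemma AdicCompletion.mk_ne_zero {J : Ideal R} {a : AdicCompletion.AdicCauchySequence J R} {k : ℕ}
    (h : a k ∉ J ^ k) : AdicCompletion.mk J R a ≠ 0 := fun h0 => h <| by
  have := congrArg (AdicCompletion.evalₐ J k) h0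
  rwa [AdicCompletion.evalₐ_mk, _root_.map_zero, Ideal.Quotient.eq_zero_iff_mem] at this

lemma AdicCompletion.exists_notMem_of_mk_ne_zero {J : Ideal R}
    {a : AdicCompletion.AdicCauchySequence J R} (h : AdicCompletion.mk J R a ≠ 0) :
    ∃ k, a k ∉ J ^ k := by
  by_contra! h'
  refine h (AdicCompletion.ext_evalₐ fun n => ?_)
  rw [AdicCompletion.evalₐ_mk, _root_.map_zero, Ideal.Quotient.eq_zero_iff_mem]
  exact h' n

lemma AdicCompletion.mk_sub_of_mem {J : Ideal R} (hJ : J.FG)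
    (a : AdicCompletion.AdicCauchySequence J R) (n : ℕ) :
    AdicCompletion.mk J R a - AdicCompletion.of J R (a n) ∈
      (J ^ n • ⊤ : Submodule R (AdicCompletion J R)) := by
  rw [AdicCompletion.pow_smul_top_eq_ker_eval hJ, LinearMap.mem_ker, map_sub, sub_eq_zero]
  rfl

variable [IsLocalRing R] [IsNoetherianRing R]

theorem inLimits_mk_iff {l : List R} (hl : (Ideal.ofList l).radical = maximalIdeal R)
    (a : AdicCompletion.AdicCauchySequence (maximalIdeal R) R) :
    InLimits l (AdicCompletion.mk (maximalIdeal R) R a) ↔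
      ∀ n, ∃ N, ∀ j ≥ N, ∃ t, l.prod ^ t • a j ∈ powSpan R l (n + t) := by
  have hJ : (maximalIdeal R).FG := IsNoetherian.noetherian _
  constructor
  · intro h n
    obtain ⟨t, ht⟩ := h n
    obtain ⟨N, hN⟩ := exists_maximalIdeal_pow_le_powSpan hl (n + t)
    refine ⟨N, fun j hj => ⟨t, ?_⟩⟩
    let K : Submodule R R := powSpan R l (n + t)
    have hle : maximalIdeal R ^ j ≤ K := (Ideal.pow_le_pow_right hj).trans hN
    have h1 := map_mem_powSpan ((Submodule.mapQ _ K LinearMap.id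
      (by simpa using hle)) ∘ₗ AdicCompletion.eval (maximalIdeal R) R j) ht
    have h2 : powSpan (R ⧸ K) l (n + t) = ⊥ := by
      rw [eq_bot_iff]
      intro y hy
      obtain ⟨m, hm, rfl⟩ := exists_of_mem_powSpan K.mkQ_surjective hy
      exact (Submodule.Quotient.mk_eq_zero K).2 hm
    rw [h2, Submodule.mem_bot, map_smul] at h1
    exact (Submodule.Quotient.mk_eq_zero K).1 h1
  · intro h n
    obtain ⟨N₀, h₀⟩ := h n
    obtain ⟨N, hN⟩ := exists_maximalIdeal_pow_le_powSpan hl n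
    obtain ⟨t, ht⟩ := h₀ (max N₀ N) (le_max_left _ _)
    refine ⟨t, ?_⟩
    set j := max N₀ N
    rw [← sub_add_cancel (AdicCompletion.mk (maximalIdeal R) R a)
      (AdicCompletion.of (maximalIdeal R) R (a j)), smul_add, ← map_smul]
    refine add_mem (prod_pow_smul_mem_powSpan t ?_) (map_mem_powSpan _ ht)
    have hle : (maximalIdeal R ^ j • ⊤ : Submodule R (AdicCompletion (maximalIdeal R) R)) ≤
        powSpan _ l n := by
      rw [Submodule.smul_le]
      intro r hr z _
      exact map_mem_powSpan (LinearMap.toSpanSingleton R _ z)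
        (hN (Ideal.pow_le_pow_right (le_max_right N₀ N) hr))
    exact hle (AdicCompletion.mk_sub_of_mem hJ a j)

end CompletionSequences

section FiniteLengthDuality

variable {R : Type} [CommRing R]

lemma mem_socle {J : Ideal R} {M : Type} [AddCommGroup M] [Module R M] {m : M} :
    m ∈ socle R J M ↔ ∀ r ∈ J, r • m = 0 := by
  simp [socle, Submodule.mem_iInf]

lemma genNumber_eq_one_iff (M : Type) [AddCommGroup M] [Module R M] :
    genNumber R M = 1 ↔ ∃ v : M, v ≠ 0 ∧ R ∙ v = ⊤ := by
  rw [genNumber]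
  set S := {n : ℕ∞ | ∃ s : Finset M, (s.card : ℕ∞) = n ∧ Submodule.span R (s : Set M) = ⊤} with hS
  have h0 : (0 : ℕ∞) ∈ S ↔ Subsingleton M := by
    constructor
    · rintro ⟨s, hs, hs'⟩
      have : s = ∅ := by simpa using hs
      rw [this, Finset.coe_empty, Submodule.span_empty] at hs'
      exact (Submodule.subsingleton_iff R).1 (subsingleton_of_bot_eq_top hs')
    · intro h
      exact ⟨∅, by simp, Subsingleton.elim _ _⟩
  constructor
  · intro h
    have hne : S.Nonempty := by
      by_contra hne
      rw [Set.not_nonempty_iff_eq_empty.1 hne, sInf_empty] at h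
      exact absurd h (by decide)
    obtain ⟨s, hs, hs'⟩ : (1 : ℕ∞) ∈ S := h ▸ csInf_mem hne
    obtain ⟨v, rfl⟩ := Finset.card_eq_one.1 (by exact_mod_cast hs : s.card = 1)
    rw [Finset.coe_singleton] at hs'
    refine ⟨v, ?_, hs'⟩
    rintro rfl
    rw [Submodule.span_zero_singleton] at hs'
    have : (0 : ℕ∞) ∈ S := h0.2 ((Submodule.subsingleton_iff R).1 (subsingleton_of_bot_eq_top hs'))
    have := sInf_le this
    rw [h] at this
    exact absurd this (by decide)
  · rintro ⟨v, hv, hv'⟩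
    refine le_antisymm (sInf_le ⟨{v}, by simp, by simpa using hv'⟩) (le_sInf fun n hn => ?_)
    rw [Order.one_le_iff_ne_zero]
    rintro rfl
    have := h0.1 hn
    exact hv (Subsingleton.elim _ _)

lemma length_ker_lcomp_le {B M Q : Type} [AddCommGroup B] [Module R B] [AddCommGroup M] [Module R M]
    [AddCommGroup Q] [Module R Q] (C : Type) [AddCommGroup C] [Module R C] {i : B →ₗ[R] M}
    {p : M →ₗ[R] Q} (hp : Function.Surjective p) (h : Function.Exact i p) :
    Module.length R (LinearMap.ker (LinearMap.lcomp R C i)) ≤ Module.length R (Q →ₗ[R] C) := by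
  refine Module.length_le_of_surjective
    ((LinearMap.lcomp R C p).codRestrict (LinearMap.ker (LinearMap.lcomp R C i)) fun φ => ?_)
    fun φ => ?_
  · ext x
    simp [h.apply_apply_eq_zero]
  · have hφ : LinearMap.ker p ≤ LinearMap.ker φ.1 := fun m hm => by
      obtain ⟨x, rfl⟩ := (h m).1 hm
      exact LinearMap.congr_fun φ.2 x
    refine ⟨(LinearMap.ker p).liftQ φ.1 hφ ∘ₗ (p.quotKerEquivOfSurjective hp).symm.toLinearMap,
      Subtype.ext (LinearMap.ext fun m => ?_)⟩
    have : (p.quotKerEquivOfSurjective hp).symm (p m) = (LinearMap.ker p).mkQ m := by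
      rw [LinearEquiv.symm_apply_eq]
      rfl
    change (LinearMap.ker p).liftQ φ.1 hφ ((p.quotKerEquivOfSurjective hp).symm (p m)) = φ.1 m
    rw [this]
    rfl

variable [IsLocalRing R]

lemma length_linearMap_le_one_of_isSimpleModule (S : Type) [AddCommGroup S] [Module R S]
    [IsSimpleModule R S] (C : Type) [AddCommGroup C] [Module R C]
    (hC : Module.length R (socle R (maximalIdeal R) C) ≤ 1) :
    Module.length R (S →ₗ[R] C) ≤ 1 := by
  have hann : Module.annihilator R S = maximalIdeal R :=
    eq_maximalIdeal IsSimpleModule.annihilator_isMaximal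
  have := IsSimpleModule.nontrivial R S
  obtain ⟨s, hs⟩ := exists_ne (0 : S)
  have hmem (φ : S →ₗ[R] C) : φ s ∈ socle R (maximalIdeal R) C := by
    rw [mem_socle]
    intro r hr
    rw [← map_smul, Module.mem_annihilator.1 (hann ▸ hr) s, map_zero]
  refine le_trans ?_ hC
  refine Module.length_le_of_injective
    ((LinearMap.applyₗ (R := R) (M₂ := C) s).codRestrict _ hmem) fun φ ψ h => ?_
  have h' : φ s = ψ s := congrArg Subtype.val h
  ext z
  obtain ⟨r, rfl⟩ := Submodule.mem_span_singleton.1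
    ((IsSimpleModule.span_singleton_eq_top R hs).ge (Submodule.mem_top (x := z)))
  rw [map_smul, map_smul, h']

theorem length_linearMap_le {M : Type} [AddCommGroup M] [Module R M] (hM : IsFiniteLength R M)
    (C : Type) [AddCommGroup C] [Module R C]
    (hC : Module.length R (socle R (maximalIdeal R) C) ≤ 1) :
    Module.length R (M →ₗ[R] C) ≤ Module.length R M := by
  induction hM with
  | @of_subsingleton M _ _ _ =>
    rw [Module.length_eq_zero_iff.2 ⟨fun f g => LinearMap.ext fun x => by
      rw [Subsingleton.elim x 0, map_zero, map_zero]⟩]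
    exact zero_le
  | @of_simple_quotient M _ _ N _ _ ih =>
    rw [Module.length_eq_add_of_exact N.subtype N.mkQ N.injective_subtype N.mkQ_surjective
      (LinearMap.exact_subtype_mkQ N), add_comm, Module.length_eq_one R (M ⧸ N)]
    let ρ : (M →ₗ[R] C) →ₗ[R] (N →ₗ[R] C) := LinearMap.lcomp R C N.subtype
    rw [Module.length_eq_add_of_exact (LinearMap.ker ρ).subtype ρ.rangeRestrict
      (LinearMap.ker ρ).injective_subtype ρ.surjective_rangeRestrict
      (by rw [LinearMap.exact_iff, Submodule.range_subtype, LinearMap.ker_rangeRestrict])]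
    refine add_le_add ?_ ((Module.length_le_of_injective _
      (LinearMap.range ρ).injective_subtype).trans ih)
    exact (length_ker_lcomp_le C N.mkQ_surjective (LinearMap.exact_subtype_mkQ N)).trans
      (length_linearMap_le_one_of_isSimpleModule (M ⧸ N) C hC)

theorem exists_linearMap_extension {M B : Type} [AddCommGroup M] [Module R M] [AddCommGroup B]
    [Module R B] (hM : IsFiniteLength R M) (C : Type) [AddCommGroup C] [Module R C]
    (hC : Module.length R (socle R (maximalIdeal R) C) ≤ 1)
    (hMC : Module.length R M ≤ Module.length R (M →ₗ[R] C)) (i : B →ₗ[R] M)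
    (hi : Function.Injective i) (f : B →ₗ[R] C) : ∃ g : M →ₗ[R] C, ∀ b, g (i b) = f b := by
  let ρ : (M →ₗ[R] C) →ₗ[R] (B →ₗ[R] C) := LinearMap.lcomp R C i
  have hB : IsFiniteLength R B := hM.of_injective hi
  have hQ : IsFiniteLength R (M ⧸ LinearMap.range i) :=
    hM.of_surjective (LinearMap.range i).mkQ_surjective
  have hDB := length_linearMap_le hB C hC
  have hDQ := length_linearMap_le hQ C hC
  have hDM := length_linearMap_le hM C hC
  have hfin : Module.length R M ≠ ⊤ := Module.length_ne_top_iff.2 hM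
  have hMeq := Module.length_eq_add_of_exact i (LinearMap.range i).mkQ hi
    (LinearMap.range i).mkQ_surjective (LinearMap.exact_map_mkQ_range i)
  have hDeq := Module.length_eq_add_of_exact (LinearMap.ker ρ).subtype ρ.rangeRestrict
      (LinearMap.ker ρ).injective_subtype ρ.surjective_rangeRestrict
      (by rw [LinearMap.exact_iff, Submodule.range_subtype, LinearMap.ker_rangeRestrict])
  have hker : Module.length R (LinearMap.ker ρ) ≤
      Module.length R ((M ⧸ LinearMap.range i) →ₗ[R] C) :=
    length_ker_lcomp_le C (LinearMap.range i).mkQ_surjective (LinearMap.exact_map_mkQ_range i)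
  have hDBfin : IsFiniteLength R (B →ₗ[R] C) := Module.length_ne_top_iff.1
    (ne_top_of_le_ne_top (Module.length_ne_top_iff.2 hB) hDB)
  obtain ⟨_, _⟩ := isFiniteLength_iff_isNoetherian_isArtinian.1 hDBfin
  have hrange : LinearMap.range ρ = ⊤ := by
    by_contra hne
    have hlt := Submodule.length_lt hne
    have hx : Module.length R (B →ₗ[R] C) ≠ ⊤ := Module.length_ne_top
    generalize Module.length R (B →ₗ[R] C) = DB at *
    generalize Module.length R (LinearMap.range ρ) = DR at *
    generalize Module.length R (LinearMap.ker ρ) = DK at *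
    generalize Module.length R ((M ⧸ LinearMap.range i) →ₗ[R] C) = DQ at *
    generalize Module.length R (M →ₗ[R] C) = DM at *
    generalize Module.length R M = m at *
    generalize Module.length R B = b at *
    generalize Module.length R (M ⧸ LinearMap.range i) = c at *
    have h1 : b + c ≤ c + DR := by
      rw [← hMeq]
      refine hMC.trans ?_
      rw [hDeq]
      gcongr
      exact hker.trans hDQ
    have hc : c ≠ ⊤ := fun h => hfin (by rw [hMeq, h, add_top])
    rw [add_comm, ENat.add_le_add_iff_left hc] at h1
    exact absurd (hlt.trans_le (hDB.trans h1)) (lt_irrefl _)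
  obtain ⟨g, hg⟩ := hrange.ge (Submodule.mem_top (x := f))
  exact ⟨g, fun b => LinearMap.congr_fun hg b⟩

end FiniteLengthDuality

section InjectiveHull

variable {R : Type} [CommRing R] [IsLocalRing R]

lemma length_socle_le_of_injective {C H : Type} [AddCommGroup C] [Module R C] [AddCommGroup H]
    [Module R H] (f : C →ₗ[R] H) (hf : Function.Injective f) :
    Module.length R (socle R (maximalIdeal R) C) ≤
      Module.length R (socle R (maximalIdeal R) H) := by
  refine Module.length_le_of_injective (f.restrict fun c hc => ?_) fun a b h => ?_
  · rw [mem_socle] at hc ⊢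
    intro r hr
    rw [← map_smul, hc r hr, map_zero]
  · exact Subtype.ext (hf (congrArg Subtype.val h))

/-- If the limit closures are cofinal with the powers of the maximal ideal and the socle is
simple, then the limit is injective. -/
theorem LimitPresentation.injective_of_socle [IsNoetherianRing R] {l : List R}
    (hl : (Ideal.ofList l).radical = maximalIdeal R) {H : Type} [AddCommGroup H] [Module R H]
    (E : LimitPresentation l R H)
    (hH : Module.length R (socle R (maximalIdeal R) H) ≤ 1)
    (hconv : ∀ k, ∃ n, LinearMap.ker (E.e n) ≤ maximalIdeal R ^ k) : Module.Injective R H := by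
  apply Module.Baer.injective
  intro 𝔞 f
  have hfg : (LinearMap.range f).FG := by
    rw [LinearMap.range_eq_map]
    exact (IsNoetherian.noetherian _).map f
  obtain ⟨k, hk⟩ := exists_pow_smul_eq_zero_of_fg hfg
    (le_top.trans (E.powTorsion_eq_top hl).ge)
  obtain ⟨c, hc⟩ := exists_pow_inf_le (maximalIdeal R) 𝔞 k
  obtain ⟨n₁, hn₁⟩ := E.exists_le_span_of_fg hfg
  obtain ⟨n₂, hn₂⟩ := hconv c
  obtain ⟨N, hN₁, hN₂⟩ : ∃ N, n₁ ≤ N ∧ n₂ ≤ N := ⟨max n₁ n₂, le_max_left _ _, le_max_right _ _⟩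
  set q : Submodule R R := LinearMap.ker (E.e N) with hq
  set C : Submodule R H := R ∙ E.e N (1 : R) with hC
  have hfC (a : 𝔞) : f a ∈ C := E.span_monotone hN₁ (hn₁ ⟨a, rfl⟩)
  have hf : Submodule.comap 𝔞.subtype q ≤ LinearMap.ker (f.codRestrict C hfC) := by
    rw [LinearMap.ker_codRestrict]
    exact (Submodule.comap_mono ((E.ker_antitone hN₂).trans (hn₂))).trans
      (comap_pow_le_ker hc hk)
  obtain ⟨s, hs⟩ := exists_maximalIdeal_pow_le_powSpan hl N
  have hart : IsArtinian R (R ⧸ q) :=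
    isArtinian_quotient_of_pow_le (J := maximalIdeal R) (hs.trans (E.powSpan_le_ker N))
  have hM : IsFiniteLength R (R ⧸ q) :=
    isFiniteLength_iff_isNoetherian_isArtinian.2 ⟨inferInstance, hart⟩
  let v : C := ⟨E.e N 1, Submodule.mem_span_singleton_self _⟩
  have hv (r : R) : r • v = 0 ↔ r ∈ q := by
    rw [hq, LinearMap.mem_ker, E.e_apply]
    exact Subtype.ext_iff
  let ι : (R ⧸ q) →ₗ[R] C := q.liftQ (LinearMap.toSpanSingleton R C v) fun r hr => (hv r).2 hr
  have hMC : Module.length R (R ⧸ q) ≤ Module.length R ((R ⧸ q) →ₗ[R] C) := by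
    refine Module.length_le_of_injective
      (q.liftQ (LinearMap.toSpanSingleton R ((R ⧸ q) →ₗ[R] C) ι) fun r hr => ?_) ?_
    · rw [LinearMap.mem_ker, LinearMap.toSpanSingleton_apply]
      ext
      change ((r • (1 : R) • v : C) : H) = 0
      rw [one_smul, (hv r).2 hr]
      rfl
    · rw [← LinearMap.ker_eq_bot]
      refine Submodule.ker_liftQ_eq_bot _ _ _ fun r hr => ?_
      rw [← hv]
      have h1 := LinearMap.congr_fun hr (Submodule.Quotient.mk 1)
      change r • (1 : R) • v = 0 at h1
      rwa [one_smul] at h1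
  obtain ⟨g, hg⟩ := exists_linearMap_extension hM C
    ((length_socle_le_of_injective C.subtype C.injective_subtype).trans hH) hMC
    (Submodule.mapQ (Submodule.comap 𝔞.subtype q) q 𝔞.subtype le_rfl)
    (by
      rw [← LinearMap.ker_eq_bot, Submodule.ker_mapQ, ← LinearMap.le_ker_iff_map,
        Submodule.ker_mkQ])
    (Submodule.liftQ _ (f.codRestrict C hfC) hf)
  exact ⟨C.subtype ∘ₗ g ∘ₗ q.mkQ, fun a ha =>
    congrArg Subtype.val (hg (Submodule.Quotient.mk ⟨a, ha⟩))⟩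

/-- An injective power torsion module with simple socle is an injective hull of the residue
field. -/
theorem isInjHull_of_socle {H : Type} [AddCommGroup H] [Module R H] (hH : Module.Injective R H)
    (ht : powTorsion (maximalIdeal R) H = ⊤) {v : H} (hv : v ≠ 0)
    (hs : socle R (maximalIdeal R) H = R ∙ v) : IsInjHull R (maximalIdeal R) H := by
  have hvm : maximalIdeal R ≤ LinearMap.ker (LinearMap.toSpanSingleton R H v) :=
    mem_socle.1 (hs ▸ Submodule.mem_span_singleton_self v)
  refine ⟨hH, Submodule.liftQ (maximalIdeal R) (LinearMap.toSpanSingleton R H v) hvm, ?_, ?_⟩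
  · rw [← LinearMap.ker_eq_bot]
    refine Submodule.ker_liftQ_eq_bot _ _ _ fun r hr => ?_
    by_contra hu
    exact hv ((((notMem_maximalIdeal (x := r)).1 hu).smul_eq_zero).1 hr)
  · intro N hN
    obtain ⟨h, hhN, hh0⟩ := Submodule.exists_mem_ne_zero_of_ne_bot hN
    rw [Submodule.range_liftQ, LinearMap.range_toSpanSingleton, ← hs]
    have hex : ∃ n, ∀ r ∈ maximalIdeal R ^ n, r • h = 0 := ht.ge (Submodule.mem_top (x := h))
    classical
    have hn := Nat.find_spec hex
    have hmin := fun m => Nat.find_min hex (m := m)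
    generalize Nat.find hex = n at hn hmin
    cases n with
    | zero => exact absurd (by simpa using hn 1 (by simp)) hh0
    | succ n =>
      obtain ⟨r, hr, hrh⟩ := by simpa using hmin n (Nat.lt_succ_self n)
      refine (Submodule.ne_bot_iff _).2 ⟨r • h, ⟨N.smul_mem r hhN, mem_socle.2 fun s hs => ?_⟩, hrh⟩
      rw [smul_smul]
      exact hn _ (by rw [pow_succ']; exact Ideal.mul_mem_mul hs hr)

/-- The socle of an injective hull of the residue field is cyclic and nonzero. -/
theorem IsInjHull.exists_socle_eq_span {E H : Type} [AddCommGroup E] [Module R E] [AddCommGroup H]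
    [Module R H] (hE : IsInjHull R (maximalIdeal R) E) (e : H ≃ₗ[R] E) :
    ∃ v : H, v ≠ 0 ∧ socle R (maximalIdeal R) H = R ∙ v := by
  obtain ⟨-, f, hf, hess⟩ := hE
  set k₁ : R ⧸ maximalIdeal R := Submodule.Quotient.mk 1 with hk₁
  have hk₁0 : k₁ ≠ 0 := fun h => (Ideal.ne_top_iff_one _).1 (maximalIdeal.isMaximal R).ne_top
    ((Submodule.Quotient.mk_eq_zero (maximalIdeal R)).1 h)
  have hgen (c : R ⧸ maximalIdeal R) : ∃ r : R, c = r • k₁ := by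
    obtain ⟨r, rfl⟩ := Submodule.Quotient.mk_surjective _ c
    exact ⟨r, by rw [hk₁, ← Submodule.Quotient.mk_smul, smul_eq_mul, mul_one]⟩
  refine ⟨e.symm (f k₁), fun h => hk₁0 (hf ?_), le_antisymm (fun z hz => ?_) ?_⟩
  · rw [map_zero, ← e.symm.map_eq_zero_iff, h]
  · by_cases hz0 : z = 0
    · rw [hz0]
      exact zero_mem _
    · have hne : R ∙ e z ≠ ⊥ := by
        rw [Ne, Submodule.span_singleton_eq_bot, e.map_eq_zero_iff]
        exact hz0
      obtain ⟨w, ⟨hw1, c, hc⟩, hw0⟩ := (Submodule.ne_bot_iff _).1 (hess _ hne)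
      obtain ⟨r, rfl⟩ := Submodule.mem_span_singleton.1 hw1
      have hru : IsUnit r := by
        rw [← notMem_maximalIdeal]
        intro hr
        rw [← map_smul, mem_socle.1 hz r hr, map_zero] at hw0
        exact hw0 rfl
      obtain ⟨s, rfl⟩ := hgen c
      obtain ⟨u, rfl⟩ := hru
      refine Submodule.mem_span_singleton.2 ⟨(↑u⁻¹ : R) * s, e.injective ?_⟩
      rw [map_smul, e.apply_symm_apply, mul_smul, ← map_smul f s, hc, smul_smul, Units.inv_mul,
        one_smul]
  · rw [Submodule.span_singleton_le_iff_mem, mem_socle]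
    intro r hr
    rw [← map_smul, ← map_smul, hk₁, ← Submodule.Quotient.mk_smul, smul_eq_mul, mul_one,
      (Submodule.Quotient.mk_eq_zero (maximalIdeal R)).2 hr, map_zero, map_zero]

/-- An injective hull of the residue field detects elements of quotients. -/
theorem IsInjHull.exists_smul_ne_zero {E : Type} [AddCommGroup E] [Module R E]
    (hE : IsInjHull R (maximalIdeal R) E) {I : Ideal R} {a : R} (ha : a ∉ I) :
    ∃ u : E, (∀ r ∈ I, r • u = 0) ∧ a • u ≠ 0 := by
  obtain ⟨hinj, f, hf, -⟩ := hE
  let φ : R →ₗ[R] R ⧸ I := LinearMap.toSpanSingleton R (R ⧸ I) (Submodule.Quotient.mk a)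
  have hφ (r : R) : φ r = Submodule.Quotient.mk (r * a) := rfl
  have hK : LinearMap.ker φ ≤ maximalIdeal R := by
    refine le_maximalIdeal fun h => ha ?_
    have : (1 : R) ∈ LinearMap.ker φ := h ▸ Submodule.mem_top
    rwa [LinearMap.mem_ker, hφ, one_mul, Submodule.Quotient.mk_eq_zero I] at this
  obtain ⟨g, hg⟩ := hinj.out ((LinearMap.ker φ).liftQ φ le_rfl)
    (LinearMap.ker_eq_bot.1 (Submodule.ker_liftQ_eq_bot _ _ _ le_rfl))
    ((LinearMap.ker φ).liftQ (f ∘ₗ (maximalIdeal R).mkQ) (by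
      rw [LinearMap.ker_comp, LinearMap.ker_eq_bot.2 hf, Submodule.comap_bot, Submodule.ker_mkQ]
      exact hK))
  refine ⟨g (Submodule.Quotient.mk 1), fun r hr => ?_, fun h => ?_⟩
  · rw [← map_smul, ← Submodule.Quotient.mk_smul, smul_eq_mul, mul_one,
      (Submodule.Quotient.mk_eq_zero I).2 hr, map_zero]
  · rw [← map_smul, ← Submodule.Quotient.mk_smul, smul_eq_mul, mul_one] at h
    have h1 := hg (Submodule.Quotient.mk 1)
    change g (φ 1) = f (Submodule.Quotient.mk 1) at h1
    rw [hφ, one_mul, h, ← map_zero f] at h1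
    exact (Ideal.ne_top_iff_one _).1 (maximalIdeal.isMaximal R).ne_top
      ((Submodule.Quotient.mk_eq_zero (maximalIdeal R)).1 (hf h1).symm)

end InjectiveHull

section QuasiGorenstein

variable {R : Type} [CommRing R] [IsLocalRing R]

lemma length_le_one_of_span_singleton {H : Type} [AddCommGroup H] [Module R H] {v : H}
    (hv : R ∙ v = ⊤) (h : ∀ r ∈ maximalIdeal R, r • v = 0) : Module.length R H ≤ 1 := by
  have h1 : maximalIdeal R ≤ LinearMap.ker (LinearMap.toSpanSingleton R H v) := h
  have hs : IsSimpleModule R (R ⧸ maximalIdeal R) :=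
    (isSimpleModule_iff_isCoatom).2 (maximalIdeal.isMaximal R).out
  rw [← (Module.length_eq_one_iff (M := R ⧸ maximalIdeal R)).2 hs]
  refine Module.length_le_of_surjective ((maximalIdeal R).liftQ _ h1) ?_
  rw [← LinearMap.range_eq_top, Submodule.range_liftQ, LinearMap.range_toSpanSingleton, hv]

variable [IsNoetherianRing R]

instance AdicCompletion.isNoetherianRing_maximalIdeal :
    IsNoetherianRing (AdicCompletion (maximalIdeal R) R) :=
  AdicCompletion.isNoetherianRing_self _

lemma radical_ofList_map_algebraMap_adicCompletion {l : List R}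
    (hl : (Ideal.ofList l).radical = maximalIdeal R) :
    (Ideal.ofList (l.map (algebraMap R (AdicCompletion (maximalIdeal R) R)))).radical =
      maximalIdeal (AdicCompletion (maximalIdeal R) R) :=
  radical_ofList_map hl _ AdicCompletion.maximalIdeal_eq_map.symm

/-- If the completion is unmixed, then no nonzero element of the completion lies in all limit
closures. -/
theorem eq_zero_of_inLimits_of_unmixed {l : List R}
    (hl : (Ideal.ofList l).radical = maximalIdeal R)
    (h : ∀ p ∈ associatedPrimes (AdicCompletion (maximalIdeal R) R)
      (AdicCompletion (maximalIdeal R) R),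
      ringKrullDim (AdicCompletion (maximalIdeal R) R ⧸ p) = (l.length : WithBot ℕ∞))
    {y : AdicCompletion (maximalIdeal R) R} (hy : InLimits l y) : y = 0 := by
  by_contra hy0
  obtain ⟨P, hP, hyP⟩ :=
    exists_le_isAssociatedPrime_of_isNoetherianRing (AdicCompletion (maximalIdeal R) R) y hy0
  have hl' := radical_ofList_map_algebraMap_adicCompletion hl
  have := ringKrullDim_lt_of_inLimits
    (l.map (algebraMap R (AdicCompletion (maximalIdeal R) R))) (mem_maximalIdeal_of_mem hl')
    (AdicCompletion (maximalIdeal R) R) (fun q _ hq => isMaximal_of_ofList_le hl' q hq) y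
    (inLimits_map_iff.2 hy) ⟨P, hP.isPrime⟩ fun r hr => hyP (by
      rw [Submodule.mem_colon_singleton, hr]
      exact zero_mem _)
  rw [List.length_map, h P hP] at this
  exact lt_irrefl _ this

/-- Chevalley's theorem for the limit closures of a ring with unmixed completion. -/
theorem LimitPresentation.exists_ker_le_of_unmixed {l : List R}
    (hl : (Ideal.ofList l).radical = maximalIdeal R)
    (h : ∀ p ∈ associatedPrimes (AdicCompletion (maximalIdeal R) R)
      (AdicCompletion (maximalIdeal R) R),
      ringKrullDim (AdicCompletion (maximalIdeal R) R ⧸ p) = (l.length : WithBot ℕ∞))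
    {H : Type} [AddCommGroup H] [Module R H] (E : LimitPresentation l R H) (k : ℕ) :
    ∃ n, LinearMap.ker (E.e n) ≤ maximalIdeal R ^ k := by
  by_contra! hk
  obtain ⟨a, hak, ha⟩ := exists_adicCauchySequence (J := maximalIdeal R)
    (q := fun n => LinearMap.ker (E.e n)) E.ker_antitone k hk
  refine AdicCompletion.mk_ne_zero hak (eq_zero_of_inLimits_of_unmixed hl h ?_)
  rw [inLimits_mk_iff hl]
  exact fun n => ⟨n, fun j hj => (E.eq_zero_iff n _).1 (ha n j hj)⟩

/-- If the top local cohomology is an injective hull of the residue field, then no nonzero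
element of the completion lies in all limit closures. -/
theorem LimitPresentation.eq_zero_of_inLimits {l : List R}
    (hl : (Ideal.ofList l).radical = maximalIdeal R) {H E' : Type} [AddCommGroup H] [Module R H]
    [AddCommGroup E'] [Module R E'] (E : LimitPresentation l R H)
    (hE : IsInjHull R (maximalIdeal R) E') (e : H ≃ₗ[R] E')
    {y : AdicCompletion (maximalIdeal R) R} (hy : InLimits l y) : y = 0 := by
  by_contra hy0
  obtain ⟨a, rfl⟩ := AdicCompletion.mk_surjective (maximalIdeal R) R y
  obtain ⟨k, hk⟩ := AdicCompletion.exists_notMem_of_mk_ne_zero hy0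
  obtain ⟨u, hu, hau⟩ := hE.exists_smul_ne_zero hk
  obtain ⟨n, r, hr⟩ := E.surj (e.symm u)
  obtain ⟨N, hN⟩ := (inLimits_mk_iff hl a).1 hy n
  obtain ⟨j, hjN, hjk⟩ : ∃ j, N ≤ j ∧ k ≤ j := ⟨max N k, le_max_left _ _, le_max_right _ _⟩
  have h1 : E.e n (a j) = 0 := (E.eq_zero_iff n _).2 (hN j hjN)
  have h2 : a j • u = a k • u := by
    rw [eq_comm, ← sub_eq_zero, ← sub_smul]
    exact hu _ (AdicCompletion.apply_sub_apply_mem a hjk)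
  apply hau
  rw [← h2, ← e.symm.map_eq_zero_iff, map_smul, ← hr, E.e_apply n r, smul_comm, ← E.e_apply n (a j),
    h1, smul_zero]

/-- If no nonzero element of the completion lies in all limit closures, then the completion is
unmixed. -/
theorem ringKrullDim_quotient_eq_of_inLimits {l : List R}
    (hl : (Ideal.ofList l).radical = maximalIdeal R)
    (h : ∀ y : AdicCompletion (maximalIdeal R) R, InLimits l y → y = 0)
    {P : Ideal (AdicCompletion (maximalIdeal R) R)}
    (hP : IsAssociatedPrime P (AdicCompletion (maximalIdeal R) R)) :
    ringKrullDim (AdicCompletion (maximalIdeal R) R ⧸ P) = (l.length : WithBot ℕ∞) := by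
  have hl' := radical_ofList_map_algebraMap_adicCompletion hl
  refine le_antisymm ?_ (le_of_not_gt fun hlt => ?_)
  · have := ringKrullDim_quotient_le_length
      (l.map (algebraMap R (AdicCompletion (maximalIdeal R) R))) (mem_maximalIdeal_of_mem hl') P
      fun q _ hq => isMaximal_of_ofList_le hl' q hq
    rwa [List.length_map] at this
  · have hPp := hP.isPrime
    have : IsLocalRing (AdicCompletion (maximalIdeal R) R ⧸ P) :=
      IsLocalRing.of_surjective' _ Ideal.Quotient.mk_surjective
    have hl'' := radical_ofList_map hl' (Ideal.Quotient.mk P)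
      (IsLocalRing.map_maximalIdeal_of_surjective _ Ideal.Quotient.mk_surjective)
    have h1 := inLimits_one_of_ringKrullDim_lt hl'' (by
      rwa [List.length_map, List.length_map])
    obtain ⟨-, f, hf⟩ := (isAssociatedPrime_iff_exists_injective_linearMap _ _).1 hP
    have h2 := h _ (inLimits_map_iff.1 ((inLimits_map_iff.1 h1).map f))
    exact one_ne_zero (hf (h2.trans (map_zero f).symm))

end QuasiGorenstein

theorem stmt17 (R : Type) [CommRing R] [IsNoetherianRing R] [IsLocalRing R]
    (d : ℕ) (hd : ringKrullDim R = (d : WithBot ℕ∞)) :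
    ((∀ p ∈ associatedPrimes (AdicCompletion (maximalIdeal R) R)
          (AdicCompletion (maximalIdeal R) R),
        ringKrullDim ((AdicCompletion (maximalIdeal R) R) ⧸ p) = (d : WithBot ℕ∞)) ∧
      genNumber R
        ↥(socle R (maximalIdeal R) ↥(LC R (maximalIdeal R) d (ModuleCat.of R R))) = 1) ↔
    IsQuasiGorensteinAt R (maximalIdeal R) := by
  obtain ⟨l, rfl, hl⟩ := exists_systemOfParameters R hd
  have hlJ : (Ideal.ofList l).radical = (maximalIdeal R).radical :=
    hl.trans (maximalIdeal.isMaximal R).isPrime.radical.symm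
  obtain ⟨E⟩ := nonempty_limitPresentation_LC (maximalIdeal R) l hlJ R
  rw [genNumber_eq_one_iff]
  constructor
  · rintro ⟨hunm, v, hv, hv'⟩
    have hspan : socle R (maximalIdeal R) (LC R (maximalIdeal R) l.length (ModuleCat.of R R)) =
        R ∙ v.1 := by
      have := congrArg (Submodule.map (Submodule.subtype _)) hv'
      rw [Submodule.map_span, Set.image_singleton, Submodule.map_top,
        Submodule.range_subtype] at this
      exact this.symm
    have hinj := E.injective_of_socle hl
      (length_le_one_of_span_singleton hv' fun r hr => Subtype.ext (mem_socle.1 v.2 r hr))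
      (E.exists_ker_le_of_unmixed hl hunm)
    exact ⟨l.length, hd, _, isInjHull_of_socle hinj (E.powTorsion_eq_top hl)
      (fun h => hv (Subtype.ext h)) hspan, ⟨LinearEquiv.refl R _⟩⟩
  · rintro ⟨d', hd', E', hE', ⟨e⟩⟩
    obtain rfl : l.length = d' := by
      rw [hd] at hd'
      exact_mod_cast hd'
    refine ⟨fun P hP => ringKrullDim_quotient_eq_of_inLimits hl
      (fun y hy => E.eq_zero_of_inLimits hl hE' e hy) hP, ?_⟩
    obtain ⟨v, hv, hspan⟩ := hE'.exists_socle_eq_span e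
    refine ⟨⟨v, hspan ▸ Submodule.mem_span_singleton_self v⟩, fun h => hv (congrArg Subtype.val h),
      ?_⟩
    apply Submodule.map_injective_of_injective (Submodule.injective_subtype _)
    rw [Submodule.map_span, Set.image_singleton, Submodule.map_top, Submodule.range_subtype]
    exact hspan.symm
end

section
/- Let (R, m) be a Noetherian local ring of dimension d and M a finitely generated R-module of dimension d'. Suppose there exists n ∈ ℕ such that m^n · ({x}^lim_M / xM) = 0 for every system of parameters x of M. Then for every system of parameters x_1,…,x_{d'} of M and every 0 ≤ i ≤ d'-1, m^n · (((x_1,…,x_i)M :_M x_{i+1}) / (x_1,…,x_i)M) = 0. -/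
open CategoryTheory IsLocalRing Pointwise

section

variable {R M : Type*} [CommRing R] [AddCommGroup M] [Module R M]

/-- Over a local ring, a power of the maximal ideal kills any finite Artinian quotient. -/
theorem exists_maximalIdeal_pow_smul_top_le [IsLocalRing R] [IsNoetherianRing R]
    [Module.Finite R M] (N : Submodule R M) [IsArtinian R (M ⧸ N)] :
    ∃ k : ℕ, maximalIdeal R ^ k • (⊤ : Submodule R M) ≤ N := by
  let f : ℕ →o (Submodule R (M ⧸ N))ᵒᵈ :=
    ⟨fun k => OrderDual.toDual (maximalIdeal R ^ k • (⊤ : Submodule R (M ⧸ N))),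
      fun a b hab => Submodule.smul_mono_left (Ideal.pow_le_pow_right hab)⟩
  obtain ⟨k, hk⟩ := IsArtinian.monotone_stabilizes f
  have hk' : maximalIdeal R ^ k • (⊤ : Submodule R (M ⧸ N)) =
      maximalIdeal R ^ (k + 1) • (⊤ : Submodule R (M ⧸ N)) := hk (k + 1) k.le_succ
  have hbot : maximalIdeal R ^ k • (⊤ : Submodule R (M ⧸ N)) = ⊥ := by
    refine Submodule.eq_bot_of_le_smul_of_le_jacobson_bot (maximalIdeal R) _
      (IsNoetherian.noetherian _) ?_ (maximalIdeal_le_jacobson _)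
    rw [← mul_smul, ← pow_succ', ← hk']
  refine ⟨k, ?_⟩
  rw [← N.ker_mkQ, LinearMap.le_ker_iff_map, Submodule.map_smul'', Submodule.map_top,
    N.range_mkQ, hbot]

/-- A finite module over a Noetherian local ring has finite length modulo any submodule which
contains a power of the maximal ideal times the module. -/
theorem isFiniteLength_quotient_of_maximalIdeal_pow_smul_top_le [IsLocalRing R]
    [IsNoetherianRing R] [Module.Finite R M] {N : Submodule R M} {k : ℕ}
    (hk : maximalIdeal R ^ k • (⊤ : Submodule R M) ≤ N) : IsFiniteLength R (M ⧸ N) := by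
  have hm : maximalIdeal R ∈ (maximalIdeal R ^ (k + 1)).minimalPrimes :=
    ⟨⟨inferInstance, Ideal.pow_le_self k.succ_ne_zero⟩,
      fun p hp _ => hp.1.le_of_pow_le hp.2⟩
  have := quotient_artinian_of_mem_minimalPrimes_of_isLocalRing _ hm
  have htors : Module.IsTorsionBySet R (M ⧸ N) (maximalIdeal R ^ (k + 1) : Ideal R) := by
    rintro q ⟨a, ha⟩
    obtain ⟨q, rfl⟩ := N.mkQ_surjective q
    exact (Submodule.Quotient.mk_eq_zero N).2
      (hk (Submodule.smul_mem_smul (Ideal.pow_le_pow_right k.le_succ ha) trivial))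
  let := htors.module
  have : Module.Finite (R ⧸ maximalIdeal R ^ (k + 1)) (M ⧸ N) :=
    Module.Finite.of_restrictScalars_finite R _ _
  have hart : IsArtinian (R ⧸ maximalIdeal R ^ (k + 1)) (M ⧸ N) := inferInstance
  rw [isFiniteLength_iff_isNoetherian_isArtinian]
  refine ⟨inferInstance, ?_⟩
  exact (htors.semilinearMap.isArtinian_iff_of_bijective Function.bijective_id).2 hart

/-- Finite length of `M ⧸ J • ⊤` passes to `M ⧸ I • ⊤` for every ideal `I` whose radical
contains `J`. -/
theorem isFiniteLength_quotient_smul_top_of_le_radical [IsLocalRing R] [IsNoetherianRing R]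
    [Module.Finite R M] {I J : Ideal R} (hIJ : J ≤ I.radical)
    (hJ : IsFiniteLength R (M ⧸ (J • (⊤ : Submodule R M)))) :
    IsFiniteLength R (M ⧸ (I • (⊤ : Submodule R M))) := by
  have := (isFiniteLength_iff_isNoetherian_isArtinian.1 hJ).2
  obtain ⟨k, hk⟩ := exists_maximalIdeal_pow_smul_top_le (J • (⊤ : Submodule R M))
  obtain ⟨s, hs⟩ := Ideal.exists_pow_le_of_le_radical_of_fg hIJ (IsNoetherian.noetherian J)
  have hks (t : ℕ) : maximalIdeal R ^ (k * t) • (⊤ : Submodule R M) ≤ J ^ t • ⊤ := by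
    induction t with
    | zero => simp
    | succ t ih =>
      calc maximalIdeal R ^ (k * (t + 1)) • (⊤ : Submodule R M)
          = maximalIdeal R ^ k • maximalIdeal R ^ (k * t) • (⊤ : Submodule R M) := by
            rw [← mul_smul, ← pow_add]; ring_nf
        _ ≤ maximalIdeal R ^ k • J ^ t • (⊤ : Submodule R M) := Submodule.smul_mono le_rfl ih
        _ = J ^ t • maximalIdeal R ^ k • (⊤ : Submodule R M) := smul_comm _ _ _
        _ ≤ J ^ t • J • (⊤ : Submodule R M) := Submodule.smul_mono le_rfl hk
        _ = J ^ (t + 1) • (⊤ : Submodule R M) := by rw [← mul_smul, pow_succ]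
  exact isFiniteLength_quotient_of_maximalIdeal_pow_smul_top_le
    ((hks s).trans (Submodule.smul_mono_left hs))

/-- Krull's intersection theorem modulo a submodule. -/
theorem mem_of_forall_mem_sup_maximalIdeal_pow_smul_top [IsLocalRing R] [IsNoetherianRing R]
    [Module.Finite R M] {N : Submodule R M} {z : M}
    (hz : ∀ k : ℕ, z ∈ N ⊔ maximalIdeal R ^ k • (⊤ : Submodule R M)) : z ∈ N := by
  have hinf := Ideal.iInf_pow_smul_eq_bot_of_isLocalRing (M := M ⧸ N) (maximalIdeal R)
    (Ideal.IsPrime.ne_top inferInstance)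
  rw [← Submodule.Quotient.mk_eq_zero, ← Submodule.mem_bot R, ← hinf, Submodule.mem_iInf]
  intro k
  have := Submodule.mem_map_of_mem (f := N.mkQ) (hz k)
  rwa [Submodule.map_sup, Submodule.mkQ_map_self, bot_sup_eq, Submodule.map_smul'',
    Submodule.map_top, N.range_mkQ] at this

end

/-- If `i ∉ s`, multiplying by `x i` into the submodule generated by the `x j` with `j ∈ s` forces
membership in the limit closure. -/
theorem comap_lsmul_le_limClo {S : Type} [CommRing S] {M : Type} [AddCommGroup M] [Module S M]
    {v : ℕ} (x : Fin v → S) {s : Set (Fin v)} {i : Fin v} (hi : i ∉ s) :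
    (Ideal.span (x '' s) • (⊤ : Submodule S M)).comap (LinearMap.lsmul S M (x i)) ≤
      limClo S x M := by
  classical
  refine le_trans (fun a ha => ?_) (le_iSup _ 1)
  simp only [Submodule.mem_comap, LinearMap.lsmul_apply, pow_one] at ha ⊢
  rw [← Finset.prod_erase_mul _ _ (Finset.mem_univ i), mul_smul]
  have hle : Ideal.span (x '' s) • (⊤ : Submodule S M) ≤
      (Ideal.span (Set.range fun i => x i ^ (1 + 1)) • (⊤ : Submodule S M)).comap
        (LinearMap.lsmul S M (∏ j ∈ Finset.univ.erase i, x j)) := by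
    rw [Submodule.span_smul_eq, Submodule.set_smul_le_iff]
    rintro _ m ⟨j, hj, rfl⟩ -
    have hji : j ∈ Finset.univ.erase i :=
      Finset.mem_erase.2 ⟨fun h => hi (h ▸ hj), Finset.mem_univ j⟩
    simp only [Submodule.mem_comap, LinearMap.lsmul_apply]
    rw [smul_smul, ← Finset.prod_erase_mul _ _ hji, mul_assoc, ← sq, mul_comm, mul_smul]
    exact Submodule.smul_mem_smul (Ideal.subset_span ⟨j, rfl⟩) trivial
  exact hle ha

theorem stmt18 (R : Type) [CommRing R] [IsNoetherianRing R] [IsLocalRing R]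
    (d' : ℕ) (M : ModuleCat R) (hM : Module.Finite R ↥M)
    (hdim : mdim R ↥M = (d' : WithBot ℕ∞)) (n : ℕ)
    (h : ∀ x : Fin d' → R, (∀ i, x i ∈ maximalIdeal R) →
      IsFiniteLength R (↥M ⧸ (Ideal.span (Set.range x) • (⊤ : Submodule R ↥M))) →
      (maximalIdeal R) ^ n • limClo R x ↥M ≤ Ideal.span (Set.range x) • (⊤ : Submodule R ↥M)) :
    ∀ x : Fin d' → R, (∀ i, x i ∈ maximalIdeal R) →
      IsFiniteLength R (↥M ⧸ (Ideal.span (Set.range x) • (⊤ : Submodule R ↥M))) →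
      ∀ i : Fin d',
        (maximalIdeal R) ^ n •
            ((Ideal.span (x '' {j : Fin d' | (j : ℕ) < (i : ℕ)}) •
                (⊤ : Submodule R ↥M)).comap (LinearMap.lsmul R ↥M (x i))) ≤
          Ideal.span (x '' {j : Fin d' | (j : ℕ) < (i : ℕ)}) • (⊤ : Submodule R ↥M) := by
  intro x hx hlen i z hz
  set s : Set (Fin d') := {j : Fin d' | (j : ℕ) < (i : ℕ)} with hs
  refine mem_of_forall_mem_sup_maximalIdeal_pow_smul_top fun k => ?_
  let y : Fin d' → R := fun j => if j ∈ s then x j else x j ^ (k + 1)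
  have hi : i ∉ s := lt_irrefl (i : ℕ)
  have hyi : y i = x i ^ k * x i := (if_neg hi).trans (pow_succ _ _)
  have hys : y '' s = x '' s := Set.image_congr fun j hj => if_pos hj
  have hy (j : Fin d') : y j ∈ maximalIdeal R := by
    by_cases hj : j ∈ s
    · simpa [y, hj] using hx j
    · simpa [y, hj] using Ideal.pow_mem_of_mem _ (hx j) (k + 1) k.succ_pos
  have hrad : Ideal.span (Set.range x) ≤ (Ideal.span (Set.range y)).radical := by
    rw [Ideal.span_le]
    rintro _ ⟨j, rfl⟩
    have hyj : y j ∈ Ideal.span (Set.range y) := Ideal.subset_span ⟨j, rfl⟩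
    by_cases hj : j ∈ s
    · exact Ideal.le_radical (by simpa [y, hj] using hyj)
    · exact ⟨k + 1, by simpa [y, hj] using hyj⟩
  have hcomap : (Ideal.span (x '' s) • (⊤ : Submodule R ↥M)).comap
      (LinearMap.lsmul R ↥M (x i)) ≤ limClo R y ↥M := by
    refine le_trans (fun a ha => ?_) (comap_lsmul_le_limClo y hi)
    rw [Submodule.mem_comap, LinearMap.lsmul_apply] at ha ⊢
    rw [hys, hyi, mul_smul]
    exact Submodule.smul_mem _ _ ha
  have hspan : Ideal.span (Set.range y) ≤ Ideal.span (x '' s) ⊔ maximalIdeal R ^ k := by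
    rw [Ideal.span_le]
    rintro _ ⟨j, rfl⟩
    by_cases hj : j ∈ s
    · exact Ideal.mem_sup_left (Ideal.subset_span (hys ▸ Set.mem_image_of_mem y hj))
    · refine Ideal.mem_sup_right (Ideal.pow_le_pow_right k.le_succ ?_)
      simpa [y, hj] using Ideal.pow_mem_pow (hx j) (k + 1)
  rw [← Submodule.sup_smul]
  exact Submodule.smul_mono_left hspan
    (h y hy (isFiniteLength_quotient_smul_top_of_le_radical hrad hlen)
      (Submodule.smul_mono le_rfl hcomap hz))
end

section
/- Let (R, m) be a Buchsbaum Noetherian local ring of dimension d. Then for every system of parameters x = x_1,…,x_d of R, one has m · {x}^lim_R ⊆ (x_1,…,x_d)R, i.e. the limit closure of any parameter ideal is annihilated by m modulo that parameter ideal. Conversely, if m·({x}^lim_R/xR) = 0 for every system of parameters x, then R is Buchsbaum. -/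
open CategoryTheory IsLocalRing Pointwise

/-- The ideal generated by the powers `x i ^ a i` with `i ∈ S`. -/
def powerIdeal {R ι : Type*} [CommRing R] (x : ι → R) (a : ι → ℕ) (S : Set ι) : Ideal R :=
  Ideal.span ((fun i => x i ^ a i) '' S)

section PowerIdeal

variable {R ι : Type*} [CommRing R] {x : ι → R} {a b : ι → ℕ} {S T : Set ι}

theorem powerIdeal_le_iff {J : Ideal R} : powerIdeal x a S ≤ J ↔ ∀ i ∈ S, x i ^ a i ∈ J := by
  simp [powerIdeal, Ideal.span_le, Set.subset_def]

theorem pow_mem_powerIdeal {i : ι} {n : ℕ} (hi : i ∈ S) (h : a i ≤ n) :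
    x i ^ n ∈ powerIdeal x a S :=
  Ideal.pow_mem_of_pow_mem (m := a i) _ (Ideal.subset_span ⟨i, hi, rfl⟩) h

theorem powerIdeal_mono (hST : S ⊆ T) (h : ∀ i ∈ S, b i ≤ a i) :
    powerIdeal x a S ≤ powerIdeal x b T :=
  powerIdeal_le_iff.2 fun i hi => pow_mem_powerIdeal (hST hi) (h i hi)

theorem exists_eq_add_of_mem_powerIdeal {j : ι} (hj : j ∈ S) {r : R}
    (hr : r ∈ powerIdeal x a S) :
    ∃ c, ∃ q ∈ powerIdeal x a (S \ {j}), r = c * x j ^ a j + q := by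
  rw [powerIdeal, ← Set.insert_sdiff_self_of_mem hj, Set.image_insert_eq,
    Ideal.mem_span_insert] at hr
  exact hr

theorem mul_mem_of_mem_powerIdeal {J : Ideal R} {c r : R} (h : ∀ i ∈ S, c * x i ^ a i ∈ J)
    (hr : r ∈ powerIdeal x a S) : c * r ∈ J :=
  (powerIdeal_le_iff (J := Submodule.comap (LinearMap.mulLeft R c) J)).2 h hr

end PowerIdeal

section Local

variable {R : Type*} [CommRing R] [IsLocalRing R] [IsNoetherianRing R]

theorem mem_of_forall_mem_sup_maximalIdeal_pow {J : Ideal R} {r : R}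
    (h : ∀ n, r ∈ J ⊔ maximalIdeal R ^ n) : r ∈ J := by
  have key := Ideal.iInf_pow_smul_eq_bot_of_isLocalRing (M := R ⧸ J) (maximalIdeal R)
    Ideal.IsPrime.ne_top'
  rw [← Ideal.Quotient.eq_zero_iff_mem, ← Submodule.mem_bot R, ← key, Submodule.mem_iInf]
  intro n
  obtain ⟨u, hu, v, hv, rfl⟩ := Submodule.mem_sup.1 (h n)
  rw [map_add, Ideal.Quotient.eq_zero_iff_mem.2 hu, zero_add]
  have := Submodule.smul_mem_smul hv (Submodule.mem_top (x := (1 : R ⧸ J)) (R := R))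
  rwa [Algebra.smul_def, mul_one] at this

theorem isFiniteLength_quotient_iff_le_radical {I : Ideal R} :
    IsFiniteLength R (R ⧸ I) ↔ maximalIdeal R ≤ I.radical := by
  have hbij : IsArtinian R (R ⧸ I) ↔ IsArtinianRing (R ⧸ I) := by
    let e : R ⧸ I →ₛₗ[Ideal.Quotient.mk I] R ⧸ I := ⟨.id _, fun _ _ ↦ rfl⟩
    exact e.isArtinian_iff_of_bijective Function.bijective_id
  rw [isFiniteLength_iff_isNoetherian_isArtinian, hbij]
  constructor
  · rintro ⟨-, _⟩
    obtain ⟨n, hn⟩ := exists_maximalIdeal_pow_le_of_isArtinianRing_quotient I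
    exact fun s hs => ⟨n, hn (Ideal.pow_mem_pow hs n)⟩
  · intro h
    refine ⟨inferInstance, ?_⟩
    by_cases hI : I = ⊤
    · have : Subsingleton (R ⧸ I) := Ideal.Quotient.subsingleton_iff.2 hI
      exact inferInstanceAs (IsArtinian (R ⧸ I) (R ⧸ I))
    have : Nontrivial (R ⧸ I) := Ideal.Quotient.nontrivial_iff.mpr hI
    have := IsLocalRing.of_surjective' (Ideal.Quotient.mk I) Ideal.Quotient.mk_surjective
    have := IsLocalHom.of_surjective (Ideal.Quotient.mk I) Ideal.Quotient.mk_surjective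
    rw [isArtinianRing_iff_isNilpotent_maximalIdeal,
      Ideal.FG.isNilpotent_iff_le_nilradical (IsNoetherian.noetherian _)]
    intro y hy
    obtain ⟨y, rfl⟩ := Ideal.Quotient.mk_surjective y
    have hy' : y ∈ maximalIdeal R := by simpa using hy
    obtain ⟨n, hn⟩ := h hy'
    exact ⟨n, by rw [← map_pow, Ideal.Quotient.eq_zero_iff_mem.2 hn]; exact zero_mem _⟩

end Local

section WeakSequence

variable {R ι : Type*} [CommRing R] [IsLocalRing R] {x : ι → R}

/-- Multiplication by a power of any `x k` has kernel killed by the maximal ideal modulo powers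
of the remaining elements. -/
def IsUnconditionedWeakSequence (x : ι → R) : Prop :=
  ∀ (a : ι → ℕ) (k : ι) (n : ℕ) (r : R), (∀ i, 1 ≤ a i) →
    x k ^ n * r ∈ powerIdeal x a {k}ᶜ → ∀ s ∈ maximalIdeal R, s * r ∈ powerIdeal x a {k}ᶜ

variable [IsNoetherianRing R] [DecidableEq ι]

theorem IsUnconditionedWeakSequence.mul_mem_of_ne (hx : IsUnconditionedWeakSequence x)
    (hm : ∀ i, x i ∈ maximalIdeal R) {a : ι → ℕ} (ha : ∀ i, 1 ≤ a i) {j k : ι} {n : ℕ}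
    {r : R} (hr : x j ^ n * r ∈ powerIdeal x a ({k}ᶜ \ {j})) {s : R}
    (hs : s ∈ maximalIdeal R) : s * r ∈ powerIdeal x a ({k}ᶜ \ {j}) := by
  refine mem_of_forall_mem_sup_maximalIdeal_pow fun N => ?_
  have h1 : powerIdeal x a ({k}ᶜ \ {j}) ≤ powerIdeal x (Function.update a k (N + 1)) {j}ᶜ := by
    refine powerIdeal_mono (fun i hi => hi.2) fun i hi => ?_
    rw [Function.update_of_ne hi.1]
  have h2 := hx (Function.update a k (N + 1)) j n r (fun i => by
    rcases eq_or_ne i k with rfl | h <;> simp [*]) (h1 hr) s hs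
  refine powerIdeal_le_iff.2 (fun i hi => ?_) h2
  rcases eq_or_ne i k with rfl | h
  · rw [Function.update_self]
    exact Ideal.mem_sup_right (Ideal.pow_le_pow_right N.le_succ (Ideal.pow_mem_pow (hm i) _))
  · rw [Function.update_of_ne h]
    exact Ideal.mem_sup_left (pow_mem_powerIdeal ⟨h, hi⟩ le_rfl)

theorem IsUnconditionedWeakSequence.exists_sub_mem (hx : IsUnconditionedWeakSequence x)
    (hm : ∀ i, x i ∈ maximalIdeal R) {b : ι → ℕ} (hb : ∀ i, 1 ≤ b i) {j k : ι} (hjk : j ≠ k)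
    {e : R} (he : ∀ s ∈ maximalIdeal R, s * e ∈ powerIdeal x b {k}ᶜ) :
    ∃ e', x j * e - x j ^ b j * e' ∈ powerIdeal x b ({k}ᶜ \ {j}) ∧
      ∀ s ∈ maximalIdeal R, s * e' ∈ powerIdeal x (Function.update b j 1) {k}ᶜ := by
  have hj : j ∈ ({k}ᶜ : Set ι) := hjk
  obtain ⟨e', q, hq, h⟩ := exists_eq_add_of_mem_powerIdeal hj (he _ (hm j))
  have h0 : x j * e - x j ^ b j * e' = q := by rw [h]; ring
  refine ⟨e', h0 ▸ hq, ?_⟩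
  obtain ⟨n, hn⟩ : ∃ n, b j = n + 1 := ⟨b j - 1, by have := hb j; omega⟩
  have hk1 : x k * (e - x j ^ n * e') ∈ powerIdeal x b ({k}ᶜ \ {j}) :=
    hx.mul_mem_of_ne hm hb (n := 1) (by rwa [pow_one, mul_sub, ← mul_assoc, ← pow_succ', ← hn, h0])
      (hm k)
  obtain ⟨f, p, hp, h⟩ := exists_eq_add_of_mem_powerIdeal hj (he _ (hm k))
  have hk2 : x k * (x k * e' - f * x j) ∈ powerIdeal x b ({k}ᶜ \ {j}) := by
    refine hx.mul_mem_of_ne hm hb (n := n) ?_ (hm k)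
    have : x j ^ n * (x k * e' - f * x j) = p - x k * (e - x j ^ n * e') := by
      rw [mul_sub (x k), h, hn]; ring
    rw [this]
    exact sub_mem hp hk1
  have hle : powerIdeal x b ({k}ᶜ \ {j}) ≤ powerIdeal x (Function.update b j 1) {k}ᶜ :=
    powerIdeal_mono Set.sdiff_subset fun i hi => by rw [Function.update_of_ne hi.2]
  refine hx _ k 2 e' (fun i => by rcases eq_or_ne i j with rfl | h <;> simp [*]) ?_
  have : x k ^ 2 * e' = x k * (x k * e' - f * x j) + x k * f * x j ^ 1 := by ring
  rw [this]
  exact add_mem (hle hk2) (Ideal.mul_mem_left _ _ (pow_mem_powerIdeal hj (by simp)))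

theorem IsUnconditionedWeakSequence.exists_prod_sub_mem (hx : IsUnconditionedWeakSequence x)
    (hm : ∀ i, x i ∈ maximalIdeal R) {a : ι → ℕ} (ha : ∀ i, 1 ≤ a i) {k : ι} {w : R}
    (hw : ∀ s ∈ maximalIdeal R, s * w ∈ powerIdeal x a {k}ᶜ) (T : Finset ι) (hT : k ∉ T) :
    ∃ e, (∀ s ∈ maximalIdeal R,
        s * e ∈ powerIdeal x (fun i => if i ∈ T then 1 else a i) {k}ᶜ) ∧
      (∏ i ∈ T, x i) * w - (∏ i ∈ T, x i ^ a i) * e ∈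
        powerIdeal x (fun i => if i ∈ T then a i + 1 else a i) {k}ᶜ := by
  induction T using Finset.induction_on with
  | empty => exact ⟨w, by simpa using hw, by simp⟩
  | insert j T hjT ih =>
    simp only [Finset.mem_insert, not_or] at hT
    obtain ⟨e, he, hwe⟩ := ih hT.2
    obtain ⟨e', hee', he'⟩ := hx.exists_sub_mem hm
      (b := fun i => if i ∈ T then 1 else a i) (fun i => by split_ifs <;> simp [ha])
      (Ne.symm hT.1) he
    simp only [hjT, if_false] at hee'
    refine ⟨e', ?_, ?_⟩
    · convert he' using 4 with s hs
      ext i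
      rcases eq_or_ne i j with rfl | h <;> simp [*]
    · rw [Finset.prod_insert hjT, Finset.prod_insert hjT]
      have : x j * (∏ i ∈ T, x i) * w - x j ^ a j * (∏ i ∈ T, x i ^ a i) * e' =
          x j * ((∏ i ∈ T, x i) * w - (∏ i ∈ T, x i ^ a i) * e) +
          (∏ i ∈ T, x i ^ a i) * (x j * e - x j ^ a j * e') := by ring
      rw [this]
      refine add_mem ?_ ?_
      · refine mul_mem_of_mem_powerIdeal (fun i hi => ?_) hwe
        rcases eq_or_ne i j with rfl | h
        · rw [if_neg hjT, ← pow_succ']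
          exact pow_mem_powerIdeal hi (by simp)
        · exact Ideal.mul_mem_left _ _ (pow_mem_powerIdeal hi (by simp [h]))
      · refine mul_mem_of_mem_powerIdeal (fun i hi => ?_) hee'
        have hij : i ≠ j := hi.2
        by_cases hiT : i ∈ T
        · rw [if_pos hiT, ← Finset.prod_erase_mul _ _ hiT, mul_assoc, ← pow_add]
          exact Ideal.mul_mem_left _ _ (pow_mem_powerIdeal hi.1 (by simp [hiT]))
        · exact Ideal.mul_mem_left _ _ (pow_mem_powerIdeal hi.1 (by simp [hiT, hij]))

theorem IsUnconditionedWeakSequence.mul_mem_of_prod_mul_mem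
    (hx : IsUnconditionedWeakSequence x) (hm : ∀ i, x i ∈ maximalIdeal R) (I : Finset ι)
    (n : ι → ℕ) (r : R)
    (hr : (∏ i ∈ I, x i ^ n i) * r ∈
      powerIdeal x (fun i => if i ∈ I then n i + 1 else 1) Set.univ) :
    ∀ s ∈ maximalIdeal R, s * r ∈ powerIdeal x (fun _ => 1) Set.univ := by
  induction I using Finset.induction_on generalizing n r with
  | empty =>
    intro s hs
    exact Ideal.mul_mem_left _ _ (by simpa using hr)
  | insert k I hk ih =>
    obtain ⟨c, q, hq, h⟩ := exists_eq_add_of_mem_powerIdeal (Set.mem_univ k) hr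
    rw [Finset.prod_insert hk] at h
    simp only [Finset.mem_insert, true_or, if_true] at h
    rw [← Set.compl_eq_univ_sdiff] at hq
    have hq' : q ∈ powerIdeal x (fun i => if i ∈ I then n i + 1 else 1) {k}ᶜ := by
      refine powerIdeal_mono subset_rfl (fun i hi => ?_) hq
      have : i ≠ k := hi
      simp [this]
    have hw := hx (fun i => if i ∈ I then n i + 1 else 1) k (n k)
      ((∏ i ∈ I, x i ^ n i) * r - c * x k)
      (fun i => by split_ifs <;> simp) (by
        convert hq' using 1
        rw [mul_sub, ← mul_assoc, h]
        ring)
    obtain ⟨e, he, hwe⟩ := hx.exists_prod_sub_mem hm (a := fun i => if i ∈ I then n i + 1 else 1)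
      (fun i => by split_ifs <;> simp) hw I hk
    have he' : ∀ s ∈ maximalIdeal R, s * e ∈ powerIdeal x (fun _ => 1) Set.univ := by
      intro s hs
      refine powerIdeal_mono (Set.subset_univ _) (fun i _ => ?_) (he s hs)
      split_ifs <;> simp
    have hre := ih (fun i => n i + 1) (r - e) (by
      have h1 : (∏ i ∈ I, x i) * ∏ i ∈ I, x i ^ n i = ∏ i ∈ I, x i ^ (n i + 1) := by
        rw [← Finset.prod_mul_distrib]
        exact Finset.prod_congr rfl fun i _ => (pow_succ' _ _).symm
      have h2 : ∏ i ∈ I, x i ^ (if i ∈ I then n i + 1 else 1) = ∏ i ∈ I, x i ^ (n i + 1) :=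
        Finset.prod_congr rfl fun i hi => by rw [if_pos hi]
      rw [h2] at hwe
      have h3 : (∏ i ∈ I, x i ^ (n i + 1)) * (r - e) =
          ((∏ i ∈ I, x i) * ((∏ i ∈ I, x i ^ n i) * r - c * x k) -
            (∏ i ∈ I, x i ^ (n i + 1)) * e) + (∏ i ∈ I, x i) * c * x k ^ 1 := by
        rw [← h1]; ring
      rw [h3]
      refine add_mem (powerIdeal_mono (Set.subset_univ _) (fun i _ => ?_) hwe)
        (Ideal.mul_mem_left _ _ (pow_mem_powerIdeal (Set.mem_univ k) (by simp [hk])))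
      by_cases hi : i ∈ I <;> simp [hi])
    intro s hs
    have := add_mem (hre s hs) (he' s hs)
    rwa [← mul_add, sub_add_cancel] at this

end WeakSequence

theorem le_radical_span_range_of_forall_pow_mem {R ι : Type*} [CommRing R] {x y : ι → R}
    {I : Ideal R} (hx : I ≤ (Ideal.span (Set.range x)).radical)
    (h : ∀ i, ∃ n, x i ^ n ∈ Ideal.span (Set.range y)) :
    I ≤ (Ideal.span (Set.range y)).radical := by
  refine hx.trans (Ideal.radical_le_radical_iff.2 (Ideal.span_le.2 ?_))
  rintro _ ⟨i, rfl⟩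
  exact h i

theorem isUnconditionedWeakSequence_of_isBuchsbaum {R : Type*} [CommRing R] [IsNoetherianRing R]
    [IsLocalRing R] {d : ℕ}
    (H : ∀ x : Fin d → R, (∀ i, x i ∈ maximalIdeal R) →
        IsFiniteLength R (R ⧸ Ideal.span (Set.range x)) →
        ∀ i : Fin d, ∀ r : R,
          x i * r ∈ Ideal.span (x '' {j : Fin d | (j : ℕ) < (i : ℕ)}) →
          ∀ s ∈ maximalIdeal R, s * r ∈ Ideal.span (x '' {j : Fin d | (j : ℕ) < (i : ℕ)}))
    {x : Fin d → R} (hm : ∀ i, x i ∈ maximalIdeal R)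
    (hx : IsFiniteLength R (R ⧸ Ideal.span (Set.range x))) :
    IsUnconditionedWeakSequence x := by
  intro a k n r ha hr s hs
  obtain rfl | hn := Nat.eq_zero_or_pos n
  · exact Ideal.mul_mem_left _ _ (by simpa using hr)
  let l : Fin d := ⟨d - 1, by have := k.2; omega⟩
  let σ : Equiv.Perm (Fin d) := Equiv.swap k l
  let g : Fin d → R := fun i => x i ^ Function.update a k n i
  have hg : ∀ i, g i ∈ maximalIdeal R := fun i => by
    refine Ideal.pow_mem_of_mem _ (hm i) _ ?_
    rcases eq_or_ne i k with rfl | h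
    · simpa using hn
    · simpa [h] using Nat.pos_of_ne_zero (Nat.one_le_iff_ne_zero.1 (ha i))
  have hrange : Set.range (g ∘ σ) = Set.range g := σ.surjective.range_comp g
  have hl : {j : Fin d | (j : ℕ) < (l : ℕ)} = {l}ᶜ := by
    ext j
    have := j.2
    simp only [Set.mem_ofPred_eq, Set.mem_compl_iff, Set.mem_singleton_iff, Fin.ext_iff, l]
    omega
  have himage : Ideal.span ((g ∘ σ) '' {j : Fin d | (j : ℕ) < (l : ℕ)}) =
      powerIdeal x a {k}ᶜ := by
    have hσ : σ l = k := Equiv.swap_apply_right _ _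
    rw [hl, Set.image_comp, Set.image_compl_eq σ.bijective, Set.image_singleton, hσ, powerIdeal]
    congr 1
    refine Set.image_congr fun i hi => ?_
    simp only [g]
    rw [Function.update_of_ne hi]
  have key := H (g ∘ σ) (fun i => hg _) (by
    rw [hrange]
    refine isFiniteLength_quotient_iff_le_radical.2 (le_radical_span_range_of_forall_pow_mem
      (isFiniteLength_quotient_iff_le_radical.1 hx) fun i => ⟨_, Ideal.subset_span ⟨i, rfl⟩⟩))
    l r
  rw [himage] at key
  refine key ?_ s hs
  simpa [g, σ] using hr

theorem maximalIdeal_smul_limClo_le_of_isUnconditionedWeakSequence {R : Type} [CommRing R]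
    [IsNoetherianRing R] [IsLocalRing R] {d : ℕ} {x : Fin d → R}
    (hx : IsUnconditionedWeakSequence x) (hm : ∀ i, x i ∈ maximalIdeal R) :
    maximalIdeal R • limClo R x R ≤ Ideal.span (Set.range x) := by
  refine Submodule.smul_le.2 fun s hs r hr => ?_
  have hone : powerIdeal x (fun _ => 1) Set.univ = Ideal.span (Set.range x) := by
    simp [powerIdeal]
  have hle : limClo R x R ≤
      Submodule.comap (LinearMap.mulLeft R s) (Ideal.span (Set.range x)) := by
    refine iSup_le fun t r hr => ?_
    have hr' : (∏ i, x i) ^ t * r ∈ Ideal.span (Set.range fun i => x i ^ (t + 1)) := by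
      simpa using hr
    have := hx.mul_mem_of_prod_mul_mem hm Finset.univ (fun _ => t) r
      (by simpa [powerIdeal, Finset.prod_pow] using hr') s hs
    rwa [hone] at this
  exact hle hr

theorem mem_limClo_of_mul_mem {R : Type} [CommRing R] {d : ℕ} {x : Fin d → R} {i : Fin d} {r : R}
    (hr : x i * r ∈ Ideal.span (x '' {j : Fin d | (j : ℕ) < (i : ℕ)})) (n : ℕ) :
    r ∈ limClo R (fun j : Fin d => if (j : ℕ) < (i : ℕ) then x j else x j ^ (n + 1)) R := by
  set y : Fin d → R := fun j => if (j : ℕ) < (i : ℕ) then x j else x j ^ (n + 1) with hy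
  refine Submodule.mem_iSup_of_mem 1 ?_
  suffices (∏ j, y j) * r ∈ Ideal.span (Set.range fun j => y j ^ 2) by simpa using this
  have hyi : y i = x i ^ n * x i := by simp [hy, pow_succ]
  rw [← Finset.prod_erase_mul _ _ (Finset.mem_univ i), hyi, mul_assoc, mul_assoc, ← mul_assoc]
  refine (Ideal.span_le (I := Submodule.comap (LinearMap.mulLeft R
    ((∏ j ∈ Finset.univ.erase i, y j) * x i ^ n)) (Ideal.span (Set.range fun j => y j ^ 2)))).2
    ?_ hr
  rintro _ ⟨j, hj, rfl⟩
  have hji : j ≠ i := fun h => by simp [h] at hj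
  have hyj : y j = x j := if_pos hj
  rw [← Finset.prod_erase_mul _ _ (Finset.mem_erase.2 ⟨hji, Finset.mem_univ j⟩)]
  have hj2 : y j ^ 2 ∈ Ideal.span (Set.range fun j => y j ^ 2) := Ideal.subset_span ⟨j, rfl⟩
  simp only [SetLike.mem_coe, Submodule.mem_comap, LinearMap.mulLeft_apply]
  rw [← hyj]
  convert Ideal.mul_mem_left _ ((∏ z ∈ (Finset.univ.erase i).erase j, y z) * x i ^ n) hj2 using 1
  ring

theorem stmt19 (R : Type) [CommRing R] [IsNoetherianRing R] [IsLocalRing R]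
    (d : ℕ) (hd : ringKrullDim R = (d : WithBot ℕ∞)) :
    (∀ x : Fin d → R, (∀ i, x i ∈ maximalIdeal R) →
        IsFiniteLength R (R ⧸ Ideal.span (Set.range x)) →
        ∀ i : Fin d, ∀ r : R,
          x i * r ∈ Ideal.span (x '' {j : Fin d | (j : ℕ) < (i : ℕ)}) →
          ∀ s ∈ maximalIdeal R, s * r ∈ Ideal.span (x '' {j : Fin d | (j : ℕ) < (i : ℕ)})) ↔
    (∀ x : Fin d → R, (∀ i, x i ∈ maximalIdeal R) →
        IsFiniteLength R (R ⧸ Ideal.span (Set.range x)) →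
        maximalIdeal R • limClo R x R ≤ Ideal.span (Set.range x)) := by
  constructor
  · exact fun H x hm hx => maximalIdeal_smul_limClo_le_of_isUnconditionedWeakSequence
      (isUnconditionedWeakSequence_of_isBuchsbaum H hm hx) hm
  · intro H x hm hx i r hr s hs
    refine mem_of_forall_mem_sup_maximalIdeal_pow fun n => ?_
    have hy := H (fun j => if (j : ℕ) < (i : ℕ) then x j else x j ^ (n + 1))
      (fun j => by
        split_ifs
        exacts [hm j, Ideal.pow_mem_of_mem _ (hm j) _ n.succ_pos])
      (isFiniteLength_quotient_iff_le_radical.2 (le_radical_span_range_of_forall_pow_mem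
        (isFiniteLength_quotient_iff_le_radical.1 hx) fun j => by
          refine ⟨n + 1, ?_⟩
          have := Ideal.subset_span (α := R) (Set.mem_range_self
            (f := fun j : Fin d => if (j : ℕ) < (i : ℕ) then x j else x j ^ (n + 1)) j)
          split_ifs at this
          exacts [Ideal.pow_mem_of_mem _ this _ n.succ_pos, this]))
      (Submodule.smul_mem_smul hs (mem_limClo_of_mul_mem hr n))
    refine Ideal.span_le.2 ?_ hy
    rintro _ ⟨j, rfl⟩
    dsimp only
    split_ifs with hj
    · exact Ideal.mem_sup_left (Ideal.subset_span ⟨j, hj, rfl⟩)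
    · exact Ideal.mem_sup_right
        (Ideal.pow_le_pow_right n.le_succ (Ideal.pow_mem_pow (hm j) _))
end
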